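/- Let α,β>−1 and let M,N≥0 be integers with M+N>0. Then there exists a constant C such that for all θ,φ∈(0,π) with θ≠φ: (∫₀^∞ |∂_t^M δ_N^even H_t^{α,β}(θ,φ)|² t^{2M+2N−1} dt)^{1/2} ≤ C/μ⁺_{α,β}(B(θ,|θ−φ|)), and moreover (∫₀^∞ |∂_θ ∂_t^M δ_N^even H_t^{α,β}(θ,φ)|² t^{2M+2N−1} dt)^{1/2} + (∫₀^∞ |∂_φ ∂_t^M δ_N^even H_t^{α,β}(θ,φ)|² t^{2M+2N−1} dt)^{1/2} ≤ C/(|θ−φ|·μ⁺_{α,β}(B(θ,|θ−φ|))), where δ_N^even acts in the variable θ. -/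

import Mathlib

open MeasureTheory Real Set
open scoped ENNReal

noncomputable section

/-- The classical Jacobi polynomial `P_n^{α,β}`. -/
def jacobiP (α β : ℝ) (n : ℕ) (x : ℝ) : ℝ :=
  ∑ m ∈ Finset.range (n + 1),
    (Real.Gamma (α + n + 1) * Real.Gamma (α + β + n + m + 1)) /
      ((m.factorial : ℝ) * ((n - m).factorial : ℝ) * Real.Gamma (α + β + n + 1) *
        Real.Gamma (α + m + 1)) * ((x - 1) / 2) ^ m

/-- `Ψ^{α,β}(θ) = |sin(θ/2)|^{α+1/2} (cos(θ/2))^{β+1/2}`. -/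
def jPsi (α β θ : ℝ) : ℝ := |Real.sin (θ / 2)| ^ (α + 1 / 2) * Real.cos (θ / 2) ^ (β + 1 / 2)

/-- The measure `μ_{α,β}` on `(−π, π)`, with density `(Ψ^{α,β})²` w.r.t. Lebesgue measure. -/
def jacobiMeasure (α β : ℝ) : Measure ℝ :=
  (volume.restrict (Ioo (-π) π)).withDensity fun θ => ENNReal.ofReal (jPsi α β θ ^ 2)

/-- The restriction `μ⁺_{α,β}` of `μ_{α,β}` to `(0, π)`. -/
def jacobiMeasurePlus (α β : ℝ) : Measure ℝ := (jacobiMeasure α β).restrict (Ioo 0 π)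

/-- The normalizing constant `c_n^{α,β}` making `𝒫_n^{α,β}` have unit `L²(μ⁺)` norm. -/
def cJ (α β : ℝ) (n : ℕ) : ℝ :=
  (∫ θ, jacobiP α β n (Real.cos θ) ^ 2 ∂(jacobiMeasurePlus α β)) ^ (-(1 / 2) : ℝ)

/-- The normalized trigonometric Jacobi polynomial `𝒫_n^{α,β}(θ)`. -/
def trigP (α β : ℝ) (n : ℕ) (θ : ℝ) : ℝ := cJ α β n * jacobiP α β n (Real.cos θ)

/-- The eigenvalue `λ_n^{α,β} = (n + (α+β+1)/2)²`. -/
def jLam (α β : ℝ) (n : ℕ) : ℝ := ((n : ℝ) + (α + β + 1) / 2) ^ 2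

/-- The symmetrized system `Φ_n^{α,β}`. -/
def symPhi (α β : ℝ) (n : ℕ) (θ : ℝ) : ℝ :=
  if Even n then (Real.sqrt 2)⁻¹ * trigP α β (n / 2) θ
  else (Real.sqrt 2)⁻¹ * (Real.sin θ / 2) * trigP (α + 1) (β + 1) ((n - 1) / 2) θ

/-- The Jacobi functions `φ_n^{α,β} = Ψ^{α,β} 𝒫_n^{α,β}`. -/
def phiFun (α β : ℝ) (n : ℕ) (θ : ℝ) : ℝ := jPsi α β θ * trigP α β n θ

/-- The symmetrized Jacobi function system `Θ_n^{α,β}`. -/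
def jTheta (α β : ℝ) (n : ℕ) (θ : ℝ) : ℝ :=
  if Even n then (Real.sqrt 2)⁻¹ * phiFun α β (n / 2) θ
  else (Real.sqrt 2)⁻¹ * Real.sign θ * phiFun (α + 1) (β + 1) ((n - 1) / 2) θ

/-- The symmetrized Jacobi–Poisson semigroup `ℍ_t^{α,β}f(θ)` (polynomial setting). -/
def symH (α β : ℝ) (f : ℝ → ℝ) (t θ : ℝ) : ℝ :=
  ∑' n : ℕ, Real.exp (-t * Real.sqrt (jLam α β ((n + 1) / 2))) *
    (∫ φ, f φ * symPhi α β n φ ∂(jacobiMeasure α β)) * symPhi α β n θ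

/-- The symmetrized Jacobi–Poisson semigroup `H̄_t^{α,β}f(θ)` (function setting). -/
def symHbar (α β : ℝ) (f : ℝ → ℝ) (t θ : ℝ) : ℝ :=
  ∑' n : ℕ, Real.exp (-t * Real.sqrt (jLam α β ((n + 1) / 2))) *
    (∫ φ in Ioo (-π) π, f φ * jTheta α β n φ) * jTheta α β n θ

/-- The non-symmetrized Jacobi–Poisson semigroup `ℋ_t^{α,β}f(θ)` (polynomial setting). -/
def jacH (α β : ℝ) (f : ℝ → ℝ) (t θ : ℝ) : ℝ :=
  ∑' n : ℕ, Real.exp (-t * Real.sqrt (jLam α β n)) *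
    (∫ φ, f φ * trigP α β n φ ∂(jacobiMeasurePlus α β)) * trigP α β n θ

/-- The non-symmetrized Jacobi–Poisson semigroup `𝓗̄_t^{α,β}f(θ)` (function setting). -/
def jacHbar (α β : ℝ) (f : ℝ → ℝ) (t θ : ℝ) : ℝ :=
  ∑' n : ℕ, Real.exp (-t * Real.sqrt (jLam α β n)) *
    (∫ φ in Ioo 0 π, f φ * phiFun α β n φ) * phiFun α β n θ

/-- The symmetrized derivative `𝔻_{α,β}`. -/
def symD (α β : ℝ) (f : ℝ → ℝ) : ℝ → ℝ := fun θ =>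
  deriv f θ + (α - β + (α + β + 1) * Real.cos θ) / Real.sin θ * ((f θ - f (-θ)) / 2)

/-- The symmetrized derivative `D̄_{α,β}` (function setting). -/
def symDbar (α β : ℝ) (f : ℝ → ℝ) : ℝ → ℝ := fun θ =>
  deriv f θ -
    ((2 * α + 1) / 4 * (Real.cos (θ / 2) / Real.sin (θ / 2)) -
      (2 * β + 1) / 4 * Real.tan (θ / 2)) * f (-θ)

/-- The derivative `D_{α,β}` (non-symmetrized function setting). -/
def jacD (α β : ℝ) (f : ℝ → ℝ) : ℝ → ℝ := fun θ =>
  deriv f θ - (2 * α + 1) / 4 * (Real.cos (θ / 2) / Real.sin (θ / 2)) * f θ +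
    (2 * β + 1) / 4 * Real.tan (θ / 2) * f θ

/-- `δ*_{α,β} = −d/dθ − (α+1/2)cot(θ/2) + (β+1/2)tan(θ/2)`. -/
def delStar (α β : ℝ) (f : ℝ → ℝ) : ℝ → ℝ := fun θ =>
  -deriv f θ - (α + 1 / 2) * (Real.cos (θ / 2) / Real.sin (θ / 2)) * f θ +
    (β + 1 / 2) * Real.tan (θ / 2) * f θ

/-- `δ_N^even`: `N` alternating factors, rightmost (first applied) one being `δ = d/dθ`. -/
def deltaEven (α β : ℝ) : ℕ → (ℝ → ℝ) → ℝ → ℝ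
  | 0 => fun f => f
  | N + 1 => fun f => (if N % 2 = 0 then deriv else delStar α β) (deltaEven α β N f)

/-- `δ_N^odd`: `N` alternating factors, rightmost (first applied) one being `δ*_{α,β}`. -/
def deltaOdd (α β : ℝ) : ℕ → (ℝ → ℝ) → ℝ → ℝ
  | 0 => fun f => f
  | N + 1 => fun f => (if N % 2 = 0 then delStar α β else deriv) (deltaOdd α β N f)

/-- The Jacobi–Poisson kernel `H_t^{α,β}(θ,φ)` (even part of the symmetrized kernel). -/
def jHker (α β t θ φ : ℝ) : ℝ :=
  (1 / 2) * ∑' n : ℕ, Real.exp (-t * Real.sqrt (jLam α β n)) * trigP α β n θ * trigP α β n φ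

/-- The kernel `H̃_t^{α,β}(θ,φ)` (odd part of the symmetrized kernel). -/
def jHtil (α β t θ φ : ℝ) : ℝ :=
  (1 / 8) * Real.sin θ * Real.sin φ *
    ∑' n : ℕ, Real.exp (-t * Real.sqrt (jLam α β (n + 1))) *
      trigP (α + 1) (β + 1) n θ * trigP (α + 1) (β + 1) n φ

/-- `μ⁺_{α,β}(B(θ,r))` where `B(θ,r) = (θ−r, θ+r) ∩ (0,π)`. -/
def ballMeasure (α β θ r : ℝ) : ℝ≥0∞ := jacobiMeasurePlus α β (Ioo (θ - r) (θ + r))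

/-- The Muckenhoupt class `A_p^{α,β}` (`1 < p < ∞`) on `(−π,π)` w.r.t. `μ_{α,β}`. -/
def IsApWeight (α β p : ℝ) (w : ℝ → ℝ) : Prop :=
  (∀ θ, 0 ≤ w θ) ∧
    ∃ C : ℝ, ∀ a b : ℝ, -π ≤ a → a ≤ b → b ≤ π →
      (∫⁻ θ in Ioo a b, ENNReal.ofReal (w θ) ∂(jacobiMeasure α β)) *
          (∫⁻ θ in Ioo a b, ENNReal.ofReal (w θ ^ (-1 / (p - 1))) ∂(jacobiMeasure α β)) ^
            (p - 1) ≤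
        ENNReal.ofReal C * jacobiMeasure α β (Ioo a b) ^ p

/-- The Muckenhoupt class `A_1^{α,β}` on `(−π,π)` w.r.t. `μ_{α,β}`. -/
def IsA1Weight (α β : ℝ) (w : ℝ → ℝ) : Prop :=
  (∀ θ, 0 ≤ w θ) ∧
    ∃ C : ℝ, ∀ a b : ℝ, -π ≤ a → a ≤ b → b ≤ π →
      ∫⁻ θ in Ioo a b, ENNReal.ofReal (w θ) ∂(jacobiMeasure α β) ≤
        ENNReal.ofReal C *
          essInf (fun θ => ENNReal.ofReal (w θ)) ((jacobiMeasure α β).restrict (Ioo a b)) *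
          jacobiMeasure α β (Ioo a b)

/-- The Muckenhoupt class `(A_p^{α,β})⁺` (`1 < p < ∞`) on `(0,π)` w.r.t. `μ⁺_{α,β}`. -/
def IsApWeightPlus (α β p : ℝ) (w : ℝ → ℝ) : Prop :=
  (∀ θ, 0 ≤ w θ) ∧
    ∃ C : ℝ, ∀ a b : ℝ, 0 ≤ a → a ≤ b → b ≤ π →
      (∫⁻ θ in Ioo a b, ENNReal.ofReal (w θ) ∂(jacobiMeasurePlus α β)) *
          (∫⁻ θ in Ioo a b, ENNReal.ofReal (w θ ^ (-1 / (p - 1))) ∂(jacobiMeasurePlus α β)) ^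
            (p - 1) ≤
        ENNReal.ofReal C * jacobiMeasurePlus α β (Ioo a b) ^ p

/-- The Muckenhoupt class `(A_1^{α,β})⁺` on `(0,π)` w.r.t. `μ⁺_{α,β}`. -/
def IsA1WeightPlus (α β : ℝ) (w : ℝ → ℝ) : Prop :=
  (∀ θ, 0 ≤ w θ) ∧
    ∃ C : ℝ, ∀ a b : ℝ, 0 ≤ a → a ≤ b → b ≤ π →
      ∫⁻ θ in Ioo a b, ENNReal.ofReal (w θ) ∂(jacobiMeasurePlus α β) ≤
        ENNReal.ofReal C *
          essInf (fun θ => ENNReal.ofReal (w θ)) ((jacobiMeasurePlus α β).restrict (Ioo a b)) *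
          jacobiMeasurePlus α β (Ioo a b)

/-- The double power weight `w_{r,s}(θ) = |sin(θ/2)|^r (cos(θ/2))^s`. -/
def wrs (r s θ : ℝ) : ℝ := |Real.sin (θ / 2)| ^ r * Real.cos (θ / 2) ^ s

/-! ### Weights -/

def jW (α β θ : ℝ) : ℝ := Real.sin (θ / 2) ^ (2 * α + 1) * Real.cos (θ / 2) ^ (2 * β + 1)

def jOm (α β θ : ℝ) : ℝ := Real.sin (θ / 2) ^ (2 * α + 2) * Real.cos (θ / 2) ^ (2 * β + 2)

lemma sin_half_pos {θ : ℝ} (h : θ ∈ Ioo 0 π) : 0 < Real.sin (θ / 2) :=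
  Real.sin_pos_of_pos_of_lt_pi (by linarith [h.1]) (by linarith [h.2, Real.pi_pos])

lemma cos_half_pos {θ : ℝ} (h : θ ∈ Ioo 0 π) : 0 < Real.cos (θ / 2) :=
  Real.cos_pos_of_mem_Ioo ⟨by linarith [h.1, Real.pi_pos], by linarith [h.2]⟩

lemma sin_half_nonneg {θ : ℝ} (h : θ ∈ Icc 0 π) : 0 ≤ Real.sin (θ / 2) :=
  Real.sin_nonneg_of_nonneg_of_le_pi (by linarith [h.1]) (by linarith [h.2, Real.pi_pos])

lemma cos_half_nonneg {θ : ℝ} (h : θ ∈ Icc 0 π) : 0 ≤ Real.cos (θ / 2) :=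
  Real.cos_nonneg_of_mem_Icc ⟨by linarith [h.1, Real.pi_pos], by linarith [h.2]⟩

lemma sin_eq_half (θ : ℝ) : Real.sin θ = 2 * Real.sin (θ / 2) * Real.cos (θ / 2) := by
  rw [← Real.sin_two_mul]; ring_nf

lemma cos_eq_half (θ : ℝ) : Real.cos θ = Real.cos (θ / 2) ^ 2 - Real.sin (θ / 2) ^ 2 := by
  have := Real.cos_two_mul (θ / 2)
  have h2 := Real.sin_sq_add_cos_sq (θ / 2)
  rw [show 2 * (θ / 2) = θ by ring] at this
  rw [this]; linarith

lemma jW_pos (α β : ℝ) {θ : ℝ} (h : θ ∈ Ioo 0 π) : 0 < jW α β θ :=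
  mul_pos (Real.rpow_pos_of_pos (sin_half_pos h) _) (Real.rpow_pos_of_pos (cos_half_pos h) _)

lemma jW_nonneg (α β : ℝ) {θ : ℝ} (h : θ ∈ Icc 0 π) : 0 ≤ jW α β θ :=
  mul_nonneg (Real.rpow_nonneg (sin_half_nonneg h) _) (Real.rpow_nonneg (cos_half_nonneg h) _)

lemma jW_mul_sin (α β : ℝ) {θ : ℝ} (h : θ ∈ Ioo 0 π) :
    jW α β θ * Real.sin θ = 2 * jOm α β θ := by
  unfold jW jOm
  have hs := sin_half_pos h
  have hc := cos_half_pos h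
  have e1 : Real.sin (θ / 2) ^ (2 * α + 2) = Real.sin (θ / 2) ^ (2 * α + 1) * Real.sin (θ / 2) := by
    rw [← Real.rpow_add_one hs.ne']; ring_nf
  have e2 : Real.cos (θ / 2) ^ (2 * β + 2) = Real.cos (θ / 2) ^ (2 * β + 1) * Real.cos (θ / 2) := by
    rw [← Real.rpow_add_one hc.ne']; ring_nf
  rw [sin_eq_half θ, e1, e2]
  generalize Real.sin (θ / 2) ^ (2 * α + 1) = x
  generalize Real.cos (θ / 2) ^ (2 * β + 1) = y
  ring

lemma jOm_continuous {α β : ℝ} (hα : -1 < α) (hβ : -1 < β) : Continuous (jOm α β) := by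
  unfold jOm
  refine Continuous.mul ?_ ?_
  · exact Continuous.rpow_const (by fun_prop) fun _ => Or.inr (by linarith)
  · exact Continuous.rpow_const (by fun_prop) fun _ => Or.inr (by linarith)

lemma jOm_zero {α : ℝ} (β : ℝ) (hα : -1 < α) : jOm α β 0 = 0 := by
  simp [jOm, Real.zero_rpow (show 2 * α + 2 ≠ 0 by linarith)]

lemma jOm_pi (α : ℝ) {β : ℝ} (hβ : -1 < β) : jOm α β π = 0 := by
  simp [jOm, Real.zero_rpow (show 2 * β + 2 ≠ 0 by linarith)]

lemma sin_half_hasDerivAt (θ : ℝ) :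
    HasDerivAt (fun θ : ℝ => Real.sin (θ / 2)) (Real.cos (θ / 2) * (1 / 2)) θ := by
  simpa using ((hasDerivAt_id θ).div_const 2).sin

lemma cos_half_hasDerivAt (θ : ℝ) :
    HasDerivAt (fun θ : ℝ => Real.cos (θ / 2)) (-Real.sin (θ / 2) * (1 / 2)) θ := by
  simpa using ((hasDerivAt_id θ).div_const 2).cos

lemma jOm_hasDerivAt (α β : ℝ) {θ : ℝ} (h : θ ∈ Ioo 0 π) :
    HasDerivAt (jOm α β) (jW α β θ *
      ((α + 1) * Real.cos (θ / 2) ^ 2 - (β + 1) * Real.sin (θ / 2) ^ 2)) θ := by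
  have hs := sin_half_pos h
  have hc := cos_half_pos h
  have h1 : HasDerivAt (fun θ : ℝ => Real.sin (θ / 2)) (Real.cos (θ / 2) * (1 / 2)) θ :=
    sin_half_hasDerivAt θ
  have h2 : HasDerivAt (fun θ : ℝ => Real.cos (θ / 2)) (-Real.sin (θ / 2) * (1 / 2)) θ :=
    cos_half_hasDerivAt θ
  have h3 := (h1.rpow_const (p := 2 * α + 2) (Or.inl hs.ne')).mul
    (h2.rpow_const (p := 2 * β + 2) (Or.inl hc.ne'))
  refine h3.congr_deriv ?_
  simp only [jW]
  have e1 : Real.sin (θ / 2) ^ (2 * α + 2) = Real.sin (θ / 2) ^ (2 * α + 1) * Real.sin (θ / 2) := by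
    rw [← Real.rpow_add_one hs.ne']; ring_nf
  have e2 : Real.cos (θ / 2) ^ (2 * β + 2) = Real.cos (θ / 2) ^ (2 * β + 1) * Real.cos (θ / 2) := by
    rw [← Real.rpow_add_one hc.ne']; ring_nf
  rw [show 2 * α + 2 - 1 = 2 * α + 1 by ring, show 2 * β + 2 - 1 = 2 * β + 1 by ring, e1, e2]
  generalize Real.sin (θ / 2) ^ (2 * α + 1) = x
  generalize Real.cos (θ / 2) ^ (2 * β + 1) = y
  ring

lemma jW_refl (α β θ : ℝ) : jW β α (π - θ) = jW α β θ := by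
  unfold jW
  rw [show (π - θ) / 2 = π / 2 - θ / 2 by ring, Real.sin_pi_div_two_sub, Real.cos_pi_div_two_sub]
  ring

lemma jW_measurable (α β : ℝ) : Measurable (jW α β) := by
  unfold jW; fun_prop

lemma jW_int_aux {α : ℝ} (β : ℝ) (hα : -1 < α) :
    IntervalIntegrable (jW α β) volume 0 (π / 2) := by
  have hpi := Real.pi_pos
  have key : IntervalIntegrable
      (fun θ => (2 * α + 2) * Real.sin (θ / 2) ^ (2 * α + 1) * (Real.cos (θ / 2) * (1 / 2)))
      volume 0 (π / 2) := by
    rw [intervalIntegrable_iff_integrableOn_Ioc_of_le (by linarith)]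
    refine intervalIntegral.integrableOn_deriv_of_nonneg
      (g := fun θ => Real.sin (θ / 2) ^ (2 * α + 2)) ?_ ?_ ?_
    · exact (Continuous.rpow_const (by fun_prop) fun _ => Or.inr (by linarith)).continuousOn
    · intro θ hθ
      have h1 : HasDerivAt (fun θ : ℝ => Real.sin (θ / 2)) (Real.cos (θ / 2) * (1 / 2)) θ :=
        sin_half_hasDerivAt θ
      have hs := sin_half_pos (θ := θ) ⟨hθ.1, by linarith [hθ.2]⟩
      refine (h1.rpow_const (p := 2 * α + 2) (Or.inl hs.ne')).congr_deriv ?_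
      rw [show 2 * α + 2 - 1 = 2 * α + 1 by ring]; ring
    · intro θ hθ
      have hs := sin_half_pos (θ := θ) ⟨hθ.1, by linarith [hθ.2]⟩
      have hc := cos_half_pos (θ := θ) ⟨hθ.1, by linarith [hθ.2]⟩
      have := Real.rpow_pos_of_pos hs (2 * α + 1)
      have h3 : 0 < 2 * α + 2 := by linarith
      positivity
  have hcpos : ∀ θ ∈ uIcc 0 (π / 2), 0 < Real.cos (θ / 2) := by
    intro θ hθ
    rw [uIcc_of_le (by linarith)] at hθ
    exact Real.cos_pos_of_mem_Ioo ⟨by linarith [hθ.1], by linarith [hθ.2]⟩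
  have hc : ContinuousOn (fun θ => (α + 1)⁻¹ * Real.cos (θ / 2) ^ (2 * β + 1) /
      Real.cos (θ / 2)) (uIcc 0 (π / 2)) := by
    refine ContinuousOn.div ?_ (by fun_prop) fun θ hθ => (hcpos θ hθ).ne'
    refine continuousOn_const.mul ?_
    exact ContinuousOn.rpow_const (by fun_prop) fun θ hθ => Or.inl (hcpos θ hθ).ne'
  have := key.mul_continuousOn hc
  refine this.congr ?_
  intro θ hθ
  have h := hcpos θ (uIoc_subset_uIcc hθ)
  have h1 : α + 1 ≠ 0 := by linarith
  simp only [jW]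
  field_simp

lemma jW_int {α β : ℝ} (hα : -1 < α) (hβ : -1 < β) :
    IntervalIntegrable (jW α β) volume 0 π := by
  refine (jW_int_aux β hα).trans ?_
  have := (jW_int_aux α hβ).comp_sub_left π
  simp only [jW_refl] at this
  convert this.symm using 1 <;> ring

lemma jW_mul_int {α β : ℝ} (hα : -1 < α) (hβ : -1 < β) {g : ℝ → ℝ} (hg : Continuous g) :
    IntervalIntegrable (fun θ => jW α β θ * g θ) volume 0 π :=
  (jW_int hα hβ).mul_continuousOn hg.continuousOn

lemma jW_mul_int' {α β : ℝ} (hα : -1 < α) (hβ : -1 < β) {g : ℝ → ℝ}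
    (hg : ContinuousOn g (Icc 0 π)) :
    IntervalIntegrable (fun θ => jW α β θ * g θ) volume 0 π :=
  (jW_int hα hβ).mul_continuousOn (by rwa [uIcc_of_le Real.pi_pos.le])

/-- Nonnegativity and monotonicity of weighted integrals. -/
lemma jW_integral_mono {α β : ℝ} (hα : -1 < α) (hβ : -1 < β) {f g : ℝ → ℝ}
    (hf : Continuous f) (hg : Continuous g) (h : ∀ θ ∈ Ioo 0 π, f θ ≤ g θ) :
    ∫ θ in 0..π, jW α β θ * f θ ≤ ∫ θ in 0..π, jW α β θ * g θ := by
  refine intervalIntegral.integral_mono_on_of_le_Ioo Real.pi_pos.le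
    (jW_mul_int hα hβ hf) (jW_mul_int hα hβ hg) ?_
  intro θ hθ
  exact mul_le_mul_of_nonneg_left (h θ hθ) (jW_pos α β hθ).le

/-! ### Systems of Jacobi polynomials -/

def jl (α β : ℝ) (n : ℕ) : ℝ := n * (n + α + β + 1)

def ct (α β θ : ℝ) : ℝ :=
  (α + 1 / 2) * (Real.cos (θ / 2) / Real.sin (θ / 2)) - (β + 1 / 2) * Real.tan (θ / 2)

def pj (P : ℕ → Polynomial ℝ) (n : ℕ) (θ : ℝ) : ℝ := (P n).eval (Real.cos θ)
def ej (P : ℕ → Polynomial ℝ) (n : ℕ) (θ : ℝ) : ℝ := (P n).derivative.eval (Real.cos θ)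
def dj (P : ℕ → Polynomial ℝ) (n : ℕ) (θ : ℝ) : ℝ := -Real.sin θ * ej P n θ

structure JSys (α β : ℝ) (P : ℕ → Polynomial ℝ) : Prop where
  hα : -1 < α
  hβ : -1 < β
  deg : ∀ n, (P n).degree = n
  ode : ∀ n x, (1 - x ^ 2) * (P n).derivative.derivative.eval x +
    (β - α - (α + β + 2) * x) * (P n).derivative.eval x + jl α β n * (P n).eval x = 0
  nrm : ∀ n, ∫ θ in 0..π, jW α β θ * (pj P n θ) ^ 2 = 1

lemma ct_mul_sin (α β : ℝ) {θ : ℝ} (h : θ ∈ Ioo 0 π) :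
    ct α β θ * Real.sin θ = (α - β) + (α + β + 1) * Real.cos θ := by
  have hs := sin_half_pos h
  have hc := cos_half_pos h
  have h1 := Real.sin_sq_add_cos_sq (θ / 2)
  rw [sin_eq_half θ, cos_eq_half θ, ct, Real.tan_eq_sin_div_cos]
  field_simp
  linear_combination (α - β) * h1

lemma jl_nonneg {α β : ℝ} (hα : -1 < α) (hβ : -1 < β) (n : ℕ) : 0 ≤ jl α β n := by
  unfold jl
  rcases Nat.eq_zero_or_pos n with h | h
  · simp [h]
  · have : (1 : ℝ) ≤ n := by exact_mod_cast h
    exact mul_nonneg (by linarith) (by linarith)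

lemma pj_continuous (P : ℕ → Polynomial ℝ) (n : ℕ) : Continuous (pj P n) := by
  unfold pj; fun_prop
lemma ej_continuous (P : ℕ → Polynomial ℝ) (n : ℕ) : Continuous (ej P n) := by
  unfold ej; fun_prop
lemma dj_continuous (P : ℕ → Polynomial ℝ) (n : ℕ) : Continuous (dj P n) := by
  unfold dj; exact Real.continuous_sin.neg.mul (ej_continuous P n)

lemma pj_hasDerivAt (P : ℕ → Polynomial ℝ) (n : ℕ) (θ : ℝ) :
    HasDerivAt (pj P n) (dj P n θ) θ := by
  have := ((P n).hasDerivAt (Real.cos θ)).comp θ (Real.hasDerivAt_cos θ)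
  refine this.congr_deriv ?_
  simp [dj, ej]; ring

lemma ej_hasDerivAt (P : ℕ → Polynomial ℝ) (n : ℕ) (θ : ℝ) :
    HasDerivAt (ej P n) (-Real.sin θ * (P n).derivative.derivative.eval (Real.cos θ)) θ := by
  have := ((P n).derivative.hasDerivAt (Real.cos θ)).comp θ (Real.hasDerivAt_cos θ)
  refine this.congr_deriv ?_
  ring

namespace JSys
variable {α β : ℝ} {P : ℕ → Polynomial ℝ}

lemma dj_hasDerivAt (S : JSys α β P) (n : ℕ) {θ : ℝ} (h : θ ∈ Ioo 0 π) :
    HasDerivAt (dj P n) (-jl α β n * pj P n θ - ct α β θ * dj P n θ) θ := by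
  have := (Real.hasDerivAt_sin θ).neg.mul (ej_hasDerivAt P n θ)
  refine this.congr_deriv ?_
  have h1 := ct_mul_sin α β h
  have h2 := S.ode n (Real.cos θ)
  have h3 := Real.sin_sq_add_cos_sq θ
  simp only [dj, pj, ej, Pi.neg_apply]
  linear_combination h2 - (P n).derivative.eval (Real.cos θ) * h1 +
    (P n).derivative.derivative.eval (Real.cos θ) * h3

/-- The flux `W p_n'`, in a form continuous up to the endpoints. -/
lemma flux_hasDerivAt (S : JSys α β P) (n : ℕ) {θ : ℝ} (h : θ ∈ Ioo 0 π) :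
    HasDerivAt (fun θ => -2 * jOm α β θ * ej P n θ) (-jl α β n * (jW α β θ * pj P n θ)) θ := by
  have := ((jOm_hasDerivAt α β h).const_mul (-2)).mul (ej_hasDerivAt P n θ)
  refine this.congr_deriv ?_
  have h2 := S.ode n (Real.cos θ)
  have h3 := Real.sin_sq_add_cos_sq (θ / 2)
  have h4 := jW_mul_sin α β h
  have h5 := cos_eq_half θ
  have h6 := Real.sin_sq_add_cos_sq θ
  simp only [pj, ej]
  linear_combination jW α β θ * h2 +
    (P n).derivative.derivative.eval (Real.cos θ) * Real.sin θ * (-h4) + jW α β θ *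
    (P n).derivative.derivative.eval (Real.cos θ) * h6 + jW α β θ *
    (P n).derivative.eval (Real.cos θ) * ((α + β + 2) * h5 + (β - α) * h3)

lemma dj_eq_flux (_ : JSys α β P) (n : ℕ) {θ : ℝ} (h : θ ∈ Ioo 0 π) :
    jW α β θ * dj P n θ = -2 * jOm α β θ * ej P n θ := by
  rw [dj, ← mul_assoc, mul_neg, jW_mul_sin α β h]; ring

/-- Green's formula. -/
lemma green (S : JSys α β P) (n : ℕ) {q q' : ℝ → ℝ} (hq : ∀ θ, HasDerivAt q (q' θ) θ)
    (hq' : Continuous q') :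
    ∫ θ in 0..π, jW α β θ * (jl α β n * pj P n θ * q θ) =
      ∫ θ in 0..π, jW α β θ * (dj P n θ * q' θ) := by
  have hqc : Continuous q := continuous_iff_continuousAt.2 fun θ => (hq θ).continuousAt
  have hi1 := jW_mul_int S.hα S.hβ (g := fun θ => jl α β n * pj P n θ * q θ)
    (((pj_continuous P n).const_mul _).mul hqc)
  have hi2 := jW_mul_int S.hα S.hβ (g := fun θ => dj P n θ * q' θ)
    ((dj_continuous P n).mul hq')
  have key := intervalIntegral.integral_eq_sub_of_hasDerivAt_of_le (a := 0) (b := π)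
    (f := fun θ => -2 * jOm α β θ * ej P n θ * q θ)
    (f' := fun θ => jW α β θ * (dj P n θ * q' θ) - jW α β θ * (jl α β n * pj P n θ * q θ))
    Real.pi_pos.le ?_ ?_ (hi2.sub hi1)
  · rw [intervalIntegral.integral_sub hi2 hi1] at key
    simp only [jOm_zero β S.hα, jOm_pi α S.hβ] at key
    linarith
  · exact (((jOm_continuous S.hα S.hβ).const_mul (-2)).mul (ej_continuous P n)
      |>.mul hqc).continuousOn
  · intro θ hθ
    refine ((S.flux_hasDerivAt n hθ).mul (hq θ)).congr_deriv ?_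
    rw [← S.dj_eq_flux n hθ]; ring

lemma jl_inj (S : JSys α β P) {m n : ℕ} (h : jl α β m = jl α β n) : m = n := by
  have hα := S.hα
  have hβ := S.hβ
  by_contra hne
  wlog hlt : m < n generalizing m n with H
  · exact H h.symm (Ne.symm hne) (lt_of_le_of_ne (not_lt.1 hlt) (Ne.symm hne))
  have h1 : (m : ℝ) + 1 ≤ n := by exact_mod_cast hlt
  have h0 : (0 : ℝ) ≤ m := Nat.cast_nonneg m
  unfold jl at h
  have : ((n : ℝ) - m) * (n + m + α + β + 1) = 0 := by linear_combination -h
  rcases mul_eq_zero.1 this with h | h <;> linarith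

lemma ortho (S : JSys α β P) (m n : ℕ) :
    ∫ θ in 0..π, jW α β θ * (pj P m θ * pj P n θ) = if m = n then 1 else 0 := by
  split_ifs with h
  · subst h; simpa [sq] using S.nrm m
  · have h1 := S.green m (pj_hasDerivAt P n) (dj_continuous P n)
    have h2 := S.green n (pj_hasDerivAt P m) (dj_continuous P m)
    have e1 : ∀ θ, jW α β θ * (jl α β m * pj P m θ * pj P n θ) =
      jl α β m * (jW α β θ * (pj P m θ * pj P n θ)) := fun θ => by ring
    have e2 : ∀ θ, jW α β θ * (jl α β n * pj P n θ * pj P m θ) =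
      jl α β n * (jW α β θ * (pj P m θ * pj P n θ)) := fun θ => by ring
    have e3 : ∀ θ, jW α β θ * (dj P n θ * dj P m θ) = jW α β θ * (dj P m θ * dj P n θ) :=
      fun θ => by ring
    simp only [e1, e2, e3, intervalIntegral.integral_const_mul] at h1 h2
    have h3 : (jl α β m - jl α β n) * ∫ θ in 0..π, jW α β θ * (pj P m θ * pj P n θ) = 0 := by
      rw [sub_mul, h1, h2, sub_self]
    rcases mul_eq_zero.1 h3 with h4 | h4
    · exact absurd (S.jl_inj (by linarith)) h
    · exact h4

lemma ortho_d (S : JSys α β P) (m n : ℕ) :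
    ∫ θ in 0..π, jW α β θ * (dj P m θ * dj P n θ) = if m = n then jl α β m else 0 := by
  have h1 := S.green m (pj_hasDerivAt P n) (dj_continuous P n)
  have e1 : ∀ θ, jW α β θ * (jl α β m * pj P m θ * pj P n θ) =
      jl α β m * (jW α β θ * (pj P m θ * pj P n θ)) := fun θ => by ring
  simp only [e1, intervalIntegral.integral_const_mul, S.ortho] at h1
  rw [← h1]; split_ifs <;> simp

/-- reflection -/
lemma refl (S : JSys α β P) : JSys β α (fun n => (P n).comp (-Polynomial.X)) where
  hα := S.hβ
  hβ := S.hα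
  deg n := by
    have hnd : (P n).natDegree = n := Polynomial.natDegree_eq_of_degree_eq_some (S.deg n)
    have h0 : P n ≠ 0 := by
      intro h; have := S.deg n; rw [h] at this; simp at this
    have h1 : ((P n).comp (-Polynomial.X)).natDegree = n := by
      rw [Polynomial.natDegree_comp, Polynomial.natDegree_neg, Polynomial.natDegree_X, hnd, mul_one]
    rw [Polynomial.degree_eq_natDegree, h1]
    intro h
    apply h0
    have := congrArg (fun p => p.comp (-Polynomial.X)) h
    simpa [Polynomial.comp_assoc] using this
  ode n x := by
    have := S.ode n (-x)
    simp only [Polynomial.derivative_comp, Polynomial.derivative_neg, Polynomial.derivative_X,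
      Polynomial.eval_mul, Polynomial.eval_neg, Polynomial.eval_one, Polynomial.eval_comp,
      Polynomial.eval_X, Polynomial.derivative_mul, Polynomial.derivative_one,
      Polynomial.eval_add, Polynomial.eval_zero, neg_zero, jl] at this ⊢
    linear_combination this
  nrm n := by
    have := S.nrm n
    have h2 := intervalIntegral.integral_comp_sub_left (a := 0) (b := π)
      (fun θ => jW α β θ * pj P n θ ^ 2) π
    simp only [sub_self, sub_zero] at h2
    rw [← this, ← h2]
    refine intervalIntegral.integral_congr fun θ _ => ?_
    simp [pj, jW_refl]

end JSys

/-! ### The volume function -/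

lemma rpow_comp_le {x y c : ℝ} (a : ℝ) (hx : 0 < x) (hy : 0 < y) (hc : 0 < c) (h1 : x ≤ c * y)
    (h2 : y ≤ c * x) : x ^ a ≤ c ^ |a| * y ^ a := by
  rcases le_or_gt 0 a with ha | ha
  · rw [abs_of_nonneg ha, ← Real.mul_rpow hc.le hy.le]
    exact Real.rpow_le_rpow hx.le h1 ha
  · rw [abs_of_neg ha]
    have h3 : y / c ≤ x := by rw [div_le_iff₀ hc]; linarith
    have h4 := Real.rpow_le_rpow_of_nonpos (div_pos hy hc) h3 ha.le
    rw [Real.div_rpow hy.le hc.le] at h4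
    rw [Real.rpow_neg hc.le]
    calc x ^ a ≤ _ := h4
      _ = _ := by rw [div_eq_inv_mul]

def jV (α β θ r : ℝ) : ℝ := r * (θ + r) ^ (2 * α + 1) * (π - θ + r) ^ (2 * β + 1)

def jD (α β : ℝ) : ℝ := 1 + |2 * α + 1| + |2 * β + 1|

def jeps (α β : ℝ) : ℝ := 1 + min 0 (min (2 * α + 1) (2 * β + 1))

lemma jeps_pos {α β : ℝ} (hα : -1 < α) (hβ : -1 < β) : 0 < jeps α β := by
  unfold jeps
  have : -1 < min 0 (min (2 * α + 1) (2 * β + 1)) := by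
    refine lt_min (by norm_num) (lt_min (by linarith) (by linarith))
  linarith

lemma jD_pos (α β : ℝ) : 0 < jD α β := by unfold jD; positivity

lemma jV_pos (α β : ℝ) {θ r : ℝ} (h : θ ∈ Ioo 0 π) (hr : 0 < r) : 0 < jV α β θ r := by
  unfold jV
  have h1 : 0 < θ + r := by linarith [h.1]
  have h2 : 0 < π - θ + r := by linarith [h.2]
  have := Real.rpow_pos_of_pos h1 (2 * α + 1)
  have := Real.rpow_pos_of_pos h2 (2 * β + 1)
  positivity

lemma jV_refl (α β θ r : ℝ) : jV β α (π - θ) r = jV α β θ r := by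
  unfold jV; rw [show π - (π - θ) + r = θ + r by ring]; ring

/-- general comparison -/
lemma jV_comp {α β θ φ r s c : ℝ} (hc : 0 < c) (h1 : 0 < θ + r) (h2 : 0 < φ + s)
    (h3 : 0 < π - θ + r) (h4 : 0 < π - φ + s) (hr : 0 ≤ r) (hs : 0 ≤ s) (hrs : r ≤ c * s)
    (h5 : θ + r ≤ c * (φ + s)) (h6 : φ + s ≤ c * (θ + r))
    (h7 : π - θ + r ≤ c * (π - φ + s)) (h8 : π - φ + s ≤ c * (π - θ + r)) :
    jV α β θ r ≤ c ^ jD α β * jV α β φ s := by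
  have k1 := rpow_comp_le (2 * α + 1) h1 h2 hc h5 h6
  have k2 := rpow_comp_le (2 * β + 1) h3 h4 hc h7 h8
  have e : c ^ jD α β = c * c ^ |2 * α + 1| * c ^ |2 * β + 1| := by
    rw [jD, Real.rpow_add hc, Real.rpow_add hc, Real.rpow_one]
  have p1 := Real.rpow_nonneg h1.le (2 * α + 1)
  have p2 := Real.rpow_nonneg h3.le (2 * β + 1)
  have p3 := Real.rpow_nonneg h2.le (2 * α + 1)
  have p4 := Real.rpow_nonneg h4.le (2 * β + 1)
  have p5 := Real.rpow_nonneg hc.le |2 * α + 1|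
  unfold jV
  rw [e]
  calc r * (θ + r) ^ (2 * α + 1) * (π - θ + r) ^ (2 * β + 1)
      ≤ (c * s) * (c ^ |2 * α + 1| * (φ + s) ^ (2 * α + 1)) *
        (c ^ |2 * β + 1| * (π - φ + s) ^ (2 * β + 1)) := by gcongr
    _ = _ := by ring

lemma jV_doubling {α β θ r R : ℝ} (h : θ ∈ Ioo 0 π) (hr : 0 < r) (hR : r ≤ R) :
    jV α β θ R ≤ (R / r) ^ jD α β * jV α β θ r := by
  have h1 := h.1
  have h2 := h.2
  have hc : 1 ≤ R / r := (one_le_div hr).2 hR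
  have e : R / r * r = R := by field_simp
  refine jV_comp (by positivity) (by linarith) (by linarith) (by linarith) (by linarith)
    (by linarith) hr.le (by rw [e]) ?_ ?_ ?_ ?_
  all_goals nlinarith [mul_nonneg (sub_nonneg.2 hc) h1.le,
    mul_nonneg (sub_nonneg.2 hc) (sub_nonneg.2 h2.le), mul_nonneg (sub_nonneg.2 hc) hr.le,
    mul_nonneg (sub_nonneg.2 hc) (sub_nonneg.2 hR)]

lemma jV_near {α β θ φ r : ℝ} (h : θ ∈ Ioo 0 π) (h' : φ ∈ Ioo 0 π) (hr : 0 < r)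
    (hd : |θ - φ| ≤ r) : jV α β θ r ≤ 2 ^ jD α β * jV α β φ r := by
  have h1 := h.1
  have h2 := h.2
  have h3 := h'.1
  have h4 := h'.2
  obtain ⟨h5, h6⟩ := abs_le.1 hd
  refine jV_comp (by positivity) ?_ ?_ ?_ ?_ hr.le hr.le ?_ ?_ ?_ ?_ ?_ <;> linarith

lemma rpow_rev_aux {y Y c m b : ℝ} (hy : 0 < y) (hyY : y ≤ Y) (hc : 1 ≤ c) (hY : Y ≤ c * y)
    (hm : m ≤ 0) (hmb : m ≤ b) : y ^ b * c ^ m ≤ Y ^ b := by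
  have hc0 : 0 < c := by linarith
  rcases le_or_gt 0 b with hb | hb
  · have := Real.rpow_le_rpow hy.le hyY hb
    have h2 : c ^ m ≤ 1 := Real.rpow_le_one_of_one_le_of_nonpos hc hm
    have h3 := Real.rpow_nonneg hy.le b
    nlinarith
  · have h1 : c ^ m ≤ c ^ b := Real.rpow_le_rpow_of_exponent_le hc hmb
    calc y ^ b * c ^ m ≤ y ^ b * c ^ b :=
          mul_le_mul_of_nonneg_left h1 (Real.rpow_nonneg hy.le b)
      _ = (c * y) ^ b := by rw [Real.mul_rpow hc0.le hy.le]; ring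
      _ ≤ Y ^ b := Real.rpow_le_rpow_of_nonpos (by linarith) hY hb.le

lemma jV_reverse {α β θ r R : ℝ} (h : θ ∈ Ioo 0 π) (hr : 0 < r) (hR : r ≤ R) (hRπ : R ≤ π) :
    jV α β θ r * (R / r) ^ jeps α β ≤ 3 ^ jD α β * jV α β θ R := by
  have h1 := h.1
  have h2 := h.2
  have hc : 1 ≤ R / r := (one_le_div hr).2 hR
  have hc0 : 0 < R / r := by linarith
  have e : R / r * r = R := by field_simp
  set m := min 0 (min (2 * α + 1) (2 * β + 1)) with hm
  have hm0 : m ≤ 0 := min_le_left _ _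
  have hma : m ≤ 2 * α + 1 := (min_le_right _ _).trans (min_le_left _ _)
  have hmb : m ≤ 2 * β + 1 := (min_le_right _ _).trans (min_le_right _ _)
  have hX : θ + R ≤ R / r * (θ + r) := by
    nlinarith [mul_nonneg (sub_nonneg.2 hc) h1.le]
  have hY : π - θ + R ≤ R / r * (π - θ + r) := by
    nlinarith [mul_nonneg (sub_nonneg.2 hc) (sub_nonneg.2 h2.le)]
  have key : (θ + r) ^ (2 * α + 1) * (π - θ + r) ^ (2 * β + 1) * (R / r) ^ m ≤
      3 ^ jD α β * ((θ + R) ^ (2 * α + 1) * (π - θ + R) ^ (2 * β + 1)) := by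
    have a1 := rpow_rev_aux (y := θ + r) (Y := θ + R) (b := 2 * α + 1) (by linarith)
      (by linarith) hc hX hm0 hma
    have a2 := rpow_rev_aux (y := π - θ + r) (Y := π - θ + R) (b := 2 * β + 1) (by linarith)
      (by linarith) hc hY hm0 hmb
    have q1 : 0 < (θ + r) ^ (2 * α + 1) := Real.rpow_pos_of_pos (by linarith) _
    have q2 : 0 < (π - θ + r) ^ (2 * β + 1) := Real.rpow_pos_of_pos (by linarith) _
    have q3 : 0 < (θ + R) ^ (2 * α + 1) := Real.rpow_pos_of_pos (by linarith) _
    have q4 : 0 < (π - θ + R) ^ (2 * β + 1) := Real.rpow_pos_of_pos (by linarith) _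
    have q5 : 0 < (R / r) ^ m := Real.rpow_pos_of_pos hc0 _
    rcases le_total (π / 2) θ with hθ | hθ
    · have a3 : (θ + r) ^ (2 * α + 1) ≤ 3 ^ |2 * α + 1| * (θ + R) ^ (2 * α + 1) :=
        rpow_comp_le _ (by linarith) (by linarith) (by norm_num) (by linarith) (by linarith)
      have a4 : (3 : ℝ) ^ |2 * α + 1| ≤ 3 ^ jD α β := by
        refine Real.rpow_le_rpow_of_exponent_le (by norm_num) ?_
        unfold jD; linarith [abs_nonneg (2 * β + 1)]
      calc (θ + r) ^ (2 * α + 1) * (π - θ + r) ^ (2 * β + 1) * (R / r) ^ m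
          = (θ + r) ^ (2 * α + 1) * ((π - θ + r) ^ (2 * β + 1) * (R / r) ^ m) := by ring
        _ ≤ (3 ^ jD α β * (θ + R) ^ (2 * α + 1)) * ((π - θ + R) ^ (2 * β + 1)) := by
            gcongr
            exact a3.trans (by gcongr)
        _ = _ := by ring
    · have a3 : (π - θ + r) ^ (2 * β + 1) ≤ 3 ^ |2 * β + 1| * (π - θ + R) ^ (2 * β + 1) :=
        rpow_comp_le _ (by linarith) (by linarith) (by norm_num) (by linarith) (by linarith)
      have a4 : (3 : ℝ) ^ |2 * β + 1| ≤ 3 ^ jD α β := by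
        refine Real.rpow_le_rpow_of_exponent_le (by norm_num) ?_
        unfold jD; linarith [abs_nonneg (2 * α + 1)]
      calc (θ + r) ^ (2 * α + 1) * (π - θ + r) ^ (2 * β + 1) * (R / r) ^ m
          = (π - θ + r) ^ (2 * β + 1) * ((θ + r) ^ (2 * α + 1) * (R / r) ^ m) := by ring
        _ ≤ (3 ^ jD α β * (π - θ + R) ^ (2 * β + 1)) * ((θ + R) ^ (2 * α + 1)) := by
            gcongr
            exact a3.trans (by gcongr)
        _ = _ := by ring
  have e2 : (R / r) ^ jeps α β = (R / r) * (R / r) ^ m := by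
    rw [jeps, Real.rpow_add hc0, Real.rpow_one]
  unfold jV
  rw [e2]
  have hR0 : 0 < R := by linarith
  calc r * (θ + r) ^ (2 * α + 1) * (π - θ + r) ^ (2 * β + 1) * (R / r * (R / r) ^ m)
      = (R / r * r) * ((θ + r) ^ (2 * α + 1) * (π - θ + r) ^ (2 * β + 1) * (R / r) ^ m) := by ring
    _ ≤ R * (3 ^ jD α β * ((θ + R) ^ (2 * α + 1) * (π - θ + R) ^ (2 * β + 1))) := by
        rw [e]; gcongr
    _ = _ := by ring

lemma jV_lower (α β : ℝ) : ∃ c > 0, ∀ θ ∈ Ioo 0 π, ∀ r, 0 < r → r ≤ π →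
    c * r ^ jD α β ≤ jV α β θ r := by
  have hpi := Real.pi_pos
  refine ⟨(2 * π) ^ (-jD α β) * jV α β (π / 2) π, ?_, ?_⟩
  · exact mul_pos (Real.rpow_pos_of_pos (by positivity) _)
      (jV_pos α β ⟨by linarith, by linarith⟩ hpi)
  · intro θ hθ r hr hrπ
    have h1 := hθ.1
    have h2 := hθ.2
    have : jV α β (π / 2) π ≤ (2 * π / r) ^ jD α β * jV α β θ r := by
      have hc : 2 ≤ 2 * π / r := by rw [le_div_iff₀ hr]; linarith
      have e : 2 * π / r * r = 2 * π := by field_simp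
      refine jV_comp (by positivity) (by linarith) (by linarith) (by linarith) (by linarith)
        hpi.le hr.le (by rw [e]; linarith) ?_ ?_ ?_ ?_
      all_goals nlinarith [mul_nonneg (sub_nonneg.2 hc) h1.le,
        mul_nonneg (sub_nonneg.2 hc) (sub_nonneg.2 h2.le)]
    rw [Real.div_rpow (by positivity) hr.le] at this
    have h5 : 0 < r ^ jD α β := Real.rpow_pos_of_pos hr _
    have h6 : 0 < (2 * π) ^ jD α β := Real.rpow_pos_of_pos (by positivity) _
    rw [Real.rpow_neg (by positivity)]
    rw [div_mul_eq_mul_div, le_div_iff₀ h5] at this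
    rw [mul_assoc, inv_mul_le_iff₀ h6]
    linarith

lemma sin_half_lower {x : ℝ} (h0 : 0 ≤ x) (h1 : x ≤ π) : x / π ≤ Real.sin (x / 2) := by
  have := Real.mul_le_sin (x := x / 2) (by linarith) (by linarith)
  calc x / π = 2 / π * (x / 2) := by ring
    _ ≤ _ := this

lemma sin_half_upper {x : ℝ} (h0 : 0 ≤ x) : Real.sin (x / 2) ≤ x / 2 :=
  Real.sin_le (by linarith)

lemma cos_half_eq (x : ℝ) : Real.cos (x / 2) = Real.sin ((π - x) / 2) := by
  rw [show (π - x) / 2 = π / 2 - x / 2 by ring, Real.sin_pi_div_two_sub]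

/-- comparison of the weight and the volume function -/
lemma jW_jV_comp {α β θ r ψ : ℝ} (hψ : ψ ∈ Ioo 0 π) (hr : 0 < r) (hθ : θ ∈ Ioo 0 π)
    (h1 : θ + r ≤ 4 * ψ) (h2 : ψ ≤ 2 * (θ + r)) (h3 : π - θ + r ≤ 4 * (π - ψ))
    (h4 : π - ψ ≤ 2 * (π - θ + r)) :
    jV α β θ r ≤ (4 * π) ^ jD α β * (r * jW α β ψ) ∧
      r * jW α β ψ ≤ (4 * π) ^ jD α β * jV α β θ r := by
  have hpi := Real.pi_pos
  have hpi3 := Real.pi_gt_three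
  have hθ1 := hθ.1
  have hθ2 := hθ.2
  have hψ1 := hψ.1
  have hψ2 := hψ.2
  have s1 := sin_half_lower hψ.1.le hψ.2.le
  have s2 := sin_half_upper hψ.1.le
  have c1 := sin_half_lower (x := π - ψ) (by linarith) (by linarith)
  have c2 := sin_half_upper (x := π - ψ) (by linarith)
  rw [← cos_half_eq] at c1 c2
  rw [div_le_iff₀ hpi] at s1 c1
  have sp := sin_half_pos hψ
  have cp := cos_half_pos hψ
  have e : (4 * π) ^ jD α β = (4 * π) * (4 * π) ^ |2 * α + 1| * (4 * π) ^ |2 * β + 1| := by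
    rw [jD, Real.rpow_add (by positivity), Real.rpow_add (by positivity), Real.rpow_one]
  have x1 : θ + r ≤ 4 * π * Real.sin (ψ / 2) := by linarith
  have x2 : Real.sin (ψ / 2) ≤ 4 * π * (θ + r) := by nlinarith
  have x3 : π - θ + r ≤ 4 * π * Real.cos (ψ / 2) := by linarith
  have x4 : Real.cos (ψ / 2) ≤ 4 * π * (π - θ + r) := by nlinarith
  have q0 : 0 < θ + r := by linarith
  have q0' : 0 < π - θ + r := by linarith
  have q1 : 0 < (θ + r) ^ (2 * α + 1) := Real.rpow_pos_of_pos (by linarith) _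
  have q2 : 0 < (π - θ + r) ^ (2 * β + 1) := Real.rpow_pos_of_pos (by linarith) _
  have q3 : 0 < Real.sin (ψ / 2) ^ (2 * α + 1) := Real.rpow_pos_of_pos sp _
  have q4 : 0 < Real.cos (ψ / 2) ^ (2 * β + 1) := Real.rpow_pos_of_pos cp _
  have hA : (0 : ℝ) < (4 * π) ^ |2 * α + 1| := Real.rpow_pos_of_pos (by positivity) _
  have hB : (0 : ℝ) < (4 * π) ^ |2 * β + 1| := Real.rpow_pos_of_pos (by positivity) _
  have h4pi : (1 : ℝ) ≤ 4 * π := by linarith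
  rw [e]
  unfold jV jW
  constructor
  · have k1 := rpow_comp_le (2 * α + 1) q0 sp (by positivity) x1 x2
    have k2 := rpow_comp_le (2 * β + 1) q0' cp (by positivity) x3 x4
    calc r * (θ + r) ^ (2 * α + 1) * (π - θ + r) ^ (2 * β + 1)
        ≤ (4 * π * r) * ((4 * π) ^ |2 * α + 1| * Real.sin (ψ / 2) ^ (2 * α + 1)) *
          ((4 * π) ^ |2 * β + 1| * Real.cos (ψ / 2) ^ (2 * β + 1)) := by
          gcongr; nlinarith
      _ = _ := by ring
  · have k1 := rpow_comp_le (2 * α + 1) sp q0 (by positivity) x2 x1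
    have k2 := rpow_comp_le (2 * β + 1) cp q0' (by positivity) x4 x3
    calc r * (Real.sin (ψ / 2) ^ (2 * α + 1) * Real.cos (ψ / 2) ^ (2 * β + 1))
        ≤ (4 * π * r) * (((4 * π) ^ |2 * α + 1| * (θ + r) ^ (2 * α + 1)) *
          ((4 * π) ^ |2 * β + 1| * (π - θ + r) ^ (2 * β + 1))) := by
          gcongr; nlinarith
      _ = _ := by ring

/-- The mass near the left endpoint. -/
lemma jW_mass_left {α β : ℝ} (hα : -1 < α) (hβ : -1 < β) : ∃ C > 0, ∀ x ∈ Ioc 0 π,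
    ∫ θ in 0..x, jW α β θ ≤ C * x ^ (2 * α + 2) := by
  have hpi := Real.pi_pos
  have hpi3 := Real.pi_gt_three
  set m := ∫ θ in 0..π, jW α β θ with hm
  have hm0 : 0 ≤ m := intervalIntegral.integral_nonneg hpi.le fun θ h => jW_nonneg α β h
  set A := π ^ |2 * α + 1| * 2 ^ |2 * β + 1| with hA
  have hA0 : 0 < A := mul_pos (Real.rpow_pos_of_pos hpi _) (Real.rpow_pos_of_pos (by norm_num) _)
  have ha : 0 < 2 * α + 2 := by linarith
  refine ⟨A / (2 * α + 2) + m, by positivity, ?_⟩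
  intro x hx
  have hxp : 0 < x ^ (2 * α + 2) := Real.rpow_pos_of_pos hx.1 _
  rcases le_total x (π / 2) with h | h
  · have hIntg : IntervalIntegrable (jW α β) volume 0 x :=
      (jW_int hα hβ).mono_set (by
        rw [uIcc_of_le hx.1.le, uIcc_of_le hpi.le]; exact Icc_subset_Icc_right hx.2)
    have hint2 : IntervalIntegrable (fun y : ℝ => A * y ^ (2 * α + 1)) volume 0 x :=
      (intervalIntegral.intervalIntegrable_rpow' (by linarith)).const_mul _
    have := intervalIntegral.integral_mono_on_of_le_Ioo hx.1.le hIntg hint2 (fun y hy => ?_)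
    · rw [intervalIntegral.integral_const_mul, integral_rpow (Or.inl (by linarith)),
        show 2 * α + 1 + 1 = 2 * α + 2 by ring, Real.zero_rpow ha.ne'] at this
      calc _ ≤ _ := this
        _ = A / (2 * α + 2) * x ^ (2 * α + 2) := by ring
        _ ≤ _ := by nlinarith
    · have hy' : y ∈ Ioo 0 π := ⟨hy.1, by linarith [hy.2]⟩
      have hy1 := hy.1
      have hy2 := hy.2
      have s1 := sin_half_lower hy'.1.le hy'.2.le
      have s2 := sin_half_upper hy'.1.le
      rw [div_le_iff₀ hpi] at s1
      have c1 := sin_half_lower (x := π - y) (by linarith) (by linarith)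
      rw [← cos_half_eq] at c1
      have c2 : (1 : ℝ) / 2 ≤ Real.cos (y / 2) := by
        refine le_trans ?_ c1
        rw [le_div_iff₀ hpi]; linarith
      have k1 := rpow_comp_le (2 * α + 1) (sin_half_pos hy') hy'.1 hpi (by nlinarith) (by linarith)
      have k2 := rpow_comp_le (y := 1) (c := 2) (2 * β + 1) (cos_half_pos hy') one_pos
        (by norm_num) (by linarith [Real.cos_le_one (y / 2)]) (by linarith)
      rw [Real.one_rpow, mul_one] at k2
      have q3 := Real.rpow_pos_of_pos (sin_half_pos hy') (2 * α + 1)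
      have q4 := Real.rpow_pos_of_pos (cos_half_pos hy') (2 * β + 1)
      have q5 := Real.rpow_pos_of_pos hy.1 (2 * α + 1)
      have q6 := Real.rpow_pos_of_pos hpi |2 * α + 1|
      unfold jW
      calc _ ≤ (π ^ |2 * α + 1| * y ^ (2 * α + 1)) * 2 ^ |2 * β + 1| := by gcongr
        _ = _ := by rw [hA]; ring
  · have h1 : ∫ θ in 0..x, jW α β θ ≤ m :=
      intervalIntegral.integral_mono_interval le_rfl hx.1.le hx.2
        ((ae_restrict_iff' measurableSet_Ioc).2 (Filter.Eventually.of_forall fun y hy =>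
          jW_nonneg α β (Ioc_subset_Icc_self hy))) (jW_int hα hβ)
    have h2 : 1 ≤ x ^ (2 * α + 2) := Real.one_le_rpow (by linarith) ha.le
    have h3 : 0 ≤ A / (2 * α + 2) := by positivity
    nlinarith

lemma jPsi_sq (α β : ℝ) {θ : ℝ} (h : θ ∈ Ioo 0 π) : jPsi α β θ ^ 2 = jW α β θ := by
  have hs := sin_half_pos h
  have hc := cos_half_pos h
  unfold jPsi jW
  rw [abs_of_pos hs, mul_pow, ← Real.rpow_natCast, ← Real.rpow_natCast, ← Real.rpow_mul hs.le,
    ← Real.rpow_mul hc.le]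
  congr 2 <;> (push_cast; ring)

lemma jacobiMeasurePlus_eq (α β : ℝ) : jacobiMeasurePlus α β =
    (volume.restrict (Ioo 0 π)).withDensity fun θ => ENNReal.ofReal (jW α β θ) := by
  have hpi := Real.pi_pos
  unfold jacobiMeasurePlus jacobiMeasure
  rw [restrict_withDensity measurableSet_Ioo, Measure.restrict_restrict measurableSet_Ioo,
    inter_eq_left.2 (Ioo_subset_Ioo_left (by linarith))]
  refine withDensity_congr_ae ?_
  refine (ae_restrict_iff' measurableSet_Ioo).2 (Filter.Eventually.of_forall fun θ h => ?_)
  simp only [jPsi_sq α β h]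

lemma ballMeasure_eq (α β θ r : ℝ) : ballMeasure α β θ r =
    ∫⁻ ψ in Ioo (θ - r) (θ + r) ∩ Ioo 0 π, ENNReal.ofReal (jW α β ψ) := by
  unfold ballMeasure
  rw [jacobiMeasurePlus_eq, withDensity_apply _ measurableSet_Ioo,
    Measure.restrict_restrict measurableSet_Ioo]

lemma ballMeasure_left {α β : ℝ} (hα : -1 < α) (hβ : -1 < β) : ∃ C > 0, ∀ θ ∈ Ioo 0 π,
    ∀ r, 0 < r → θ / 2 < r → r ≤ π →
      ∫⁻ ψ in Ioo (θ - r) (θ + r) ∩ Ioo 0 π, ENNReal.ofReal (jW α β ψ) ≤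
        ENNReal.ofReal (C * jV α β θ r) := by
  have hpi := Real.pi_pos
  obtain ⟨C, hC, H⟩ := jW_mass_left hα hβ
  have hQ : 0 < π ^ (2 * β + 1) := Real.rpow_pos_of_pos hpi _
  refine ⟨C * 3 * (2 ^ |2 * β + 1| / π ^ (2 * β + 1)), by positivity, ?_⟩
  intro θ hθ r hr hrθ hrπ
  have h1 := hθ.1
  have h2 := hθ.2
  have hx : min (θ + r) π ∈ Ioc 0 π := ⟨lt_min (by linarith) hpi, min_le_right _ _⟩
  have hsub : Ioo (θ - r) (θ + r) ∩ Ioo 0 π ⊆ Ioc 0 (min (θ + r) π) := by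
    rintro y ⟨hy1, hy2⟩
    exact ⟨hy2.1, le_min hy1.2.le hy2.2.le⟩
  have hIntg : IntervalIntegrable (jW α β) volume 0 (min (θ + r) π) :=
    (jW_int hα hβ).mono_set (by
      rw [uIcc_of_le hx.1.le, uIcc_of_le hpi.le]; exact Icc_subset_Icc_right hx.2)
  calc _ ≤ ∫⁻ ψ in Ioc 0 (min (θ + r) π), ENNReal.ofReal (jW α β ψ) :=
        lintegral_mono_set hsub
    _ = ENNReal.ofReal (∫ ψ in 0..(min (θ + r) π), jW α β ψ) := by
        rw [intervalIntegral.integral_of_le hx.1.le, ofReal_integral_eq_lintegral_ofReal]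
        · exact (intervalIntegrable_iff_integrableOn_Ioc_of_le hx.1.le).1 hIntg
        · exact (ae_restrict_iff' measurableSet_Ioc).2 (Filter.Eventually.of_forall fun y hy =>
            jW_nonneg α β ⟨hy.1.le, hy.2.trans hx.2⟩)
    _ ≤ _ := by
        refine ENNReal.ofReal_le_ofReal ((H _ hx).trans ?_)
        have h0 : 0 < θ + r := by linarith
        have a1 : (min (θ + r) π) ^ (2 * α + 2) ≤ (θ + r) ^ (2 * α + 2) :=
          Real.rpow_le_rpow hx.1.le (min_le_left _ _) (by linarith)
        have a2 : (θ + r) ^ (2 * α + 2) = (θ + r) ^ (2 * α + 1) * (θ + r) := by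
          rw [← Real.rpow_add_one h0.ne']; ring_nf
        have a3 := rpow_comp_le (x := π) (y := π - θ + r) (c := 2) (2 * β + 1) hpi (by linarith)
          (by norm_num) (by linarith) (by linarith)
        have a4 : 0 < (θ + r) ^ (2 * α + 1) := Real.rpow_pos_of_pos h0 _
        have a5 : 1 ≤ 2 ^ |2 * β + 1| / π ^ (2 * β + 1) * (π - θ + r) ^ (2 * β + 1) := by
          rw [div_mul_eq_mul_div, le_div_iff₀ hQ]; linarith
        unfold jV
        calc C * (min (θ + r) π) ^ (2 * α + 2) ≤ C * ((θ + r) ^ (2 * α + 1) * (3 * r)) * 1 := by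
              rw [a2] at a1
              rw [mul_one]
              gcongr
              exact a1.trans (by gcongr; linarith)
          _ ≤ C * ((θ + r) ^ (2 * α + 1) * (3 * r)) *
              (2 ^ |2 * β + 1| / π ^ (2 * β + 1) * (π - θ + r) ^ (2 * β + 1)) := by gcongr
          _ = _ := by ring

lemma ballMeasure_le {α β : ℝ} (hα : -1 < α) (hβ : -1 < β) : ∃ C > 0, ∀ θ ∈ Ioo 0 π,
    ∀ r, 0 < r → r ≤ π → ballMeasure α β θ r ≤ ENNReal.ofReal (C * jV α β θ r) := by
  have hpi := Real.pi_pos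
  obtain ⟨C1, hC1, H1⟩ := ballMeasure_left hα hβ
  obtain ⟨C2, hC2, H2⟩ := ballMeasure_left hβ hα
  have hK : 0 < (4 * π) ^ jD α β := Real.rpow_pos_of_pos (by positivity) _
  refine ⟨C1 + C2 + 2 * (4 * π) ^ jD α β, by positivity, ?_⟩
  intro θ hθ r hr hrπ
  have h1 := hθ.1
  have h2 := hθ.2
  have hV := jV_pos α β hθ hr
  rw [ballMeasure_eq]
  rcases lt_or_ge (θ / 2) r with h | h
  · refine (H1 θ hθ r hr h hrπ).trans (ENNReal.ofReal_le_ofReal ?_)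
    gcongr; linarith
  rcases lt_or_ge ((π - θ) / 2) r with h' | h'
  · have := H2 (π - θ) ⟨by linarith, by linarith⟩ r hr h' hrπ
    rw [jV_refl] at this
    refine le_trans (le_of_eq ?_) (this.trans (ENNReal.ofReal_le_ofReal ?_))
    · have mp := Measure.measurePreserving_sub_left volume π
      have e : Ioo (θ - r) (θ + r) ∩ Ioo 0 π =
          (fun y => π - y) ⁻¹' (Ioo (π - θ - r) (π - θ + r) ∩ Ioo 0 π) := by
        ext y
        simp only [mem_inter_iff, mem_Ioo, mem_preimage]
        constructor
        · rintro ⟨⟨a, b⟩, c, d⟩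
          exact ⟨⟨by linarith, by linarith⟩, by linarith, by linarith⟩
        · rintro ⟨⟨a, b⟩, c, d⟩
          exact ⟨⟨by linarith, by linarith⟩, by linarith, by linarith⟩
      rw [e, ← mp.setLIntegral_comp_preimage (measurableSet_Ioo.inter measurableSet_Ioo)
        (by exact (jW_measurable β α).ennreal_ofReal)]
      simp only [jW_refl]
    · gcongr; linarith
  · calc _ ≤ ∫⁻ ψ in Ioo (θ - r) (θ + r) ∩ Ioo 0 π,
            ENNReal.ofReal ((4 * π) ^ jD α β * jV α β θ r / r) := by
          refine setLIntegral_mono measurable_const fun ψ hψ => ENNReal.ofReal_le_ofReal ?_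
          rw [le_div_iff₀ hr, mul_comm]
          obtain ⟨⟨a, b⟩, c⟩ := hψ
          exact (jW_jV_comp c hr hθ (by linarith) (by linarith) (by linarith) (by linarith)).2
      _ ≤ ∫⁻ ψ in Ioo (θ - r) (θ + r),
            ENNReal.ofReal ((4 * π) ^ jD α β * jV α β θ r / r) :=
          lintegral_mono_set inter_subset_left
      _ = ENNReal.ofReal ((4 * π) ^ jD α β * jV α β θ r / r * (2 * r)) := by
          rw [setLIntegral_const, Real.volume_Ioo, ← ENNReal.ofReal_mul (by positivity)]
          congr 2; ring
      _ ≤ _ := by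
          refine ENNReal.ofReal_le_ofReal ?_
          have : (4 * π) ^ jD α β * jV α β θ r / r * (2 * r) = 2 * (4 * π) ^ jD α β * jV α β θ r := by
            field_simp
          rw [this]
          gcongr
          linarith

lemma ballMeasure_pos (α β : ℝ) {θ r : ℝ} (h : θ ∈ Ioo 0 π) (hr : 0 < r) :
    0 < ballMeasure α β θ r := by
  rw [ballMeasure_eq]
  rw [setLIntegral_pos_iff (jW_measurable α β).ennreal_ofReal]
  have hsub : Ioo (θ - r) (θ + r) ∩ Ioo 0 π ⊆
    Function.support (fun ψ => ENNReal.ofReal (jW α β ψ)) ∩ (Ioo (θ - r) (θ + r) ∩ Ioo 0 π) := by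
    intro y hy
    exact ⟨by simpa using jW_pos α β hy.2, hy⟩
  refine lt_of_lt_of_le ?_ (measure_mono hsub)
  exact (isOpen_Ioo.inter isOpen_Ioo).measure_pos volume ⟨θ, ⟨by linarith, by linarith⟩, h⟩

lemma sin_lower_mid {r ψ : ℝ} (h1 : r / 2 ≤ ψ) (h2 : ψ ≤ π - r / 2) (hr : 0 < r) :
    r / π ≤ Real.sin ψ := by
  have hpi := Real.pi_pos
  rcases le_or_gt ψ (π / 2) with h | h
  · have := Real.mul_le_sin (x := ψ) (by linarith) h
    refine le_trans ?_ this
    rw [div_mul_eq_mul_div]; gcongr; linarith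
  · have := Real.mul_le_sin (x := π - ψ) (by linarith) (by linarith)
    rw [Real.sin_pi_sub] at this
    refine le_trans ?_ this
    rw [div_mul_eq_mul_div]; gcongr; linarith

def jA (α β : ℝ) : ℝ := |α - β| + |α + β + 1|

lemma jA_nonneg (α β : ℝ) : 0 ≤ jA α β := by unfold jA; positivity

lemma ct_bound (α β : ℝ) {r ψ : ℝ} (hψ : ψ ∈ Ioo 0 π) (h1 : r / 2 ≤ ψ) (h2 : ψ ≤ π - r / 2)
    (hr : 0 < r) : |ct α β ψ| * r ≤ jA α β * π := by
  have hpi := Real.pi_pos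
  have hs := sin_lower_mid h1 h2 hr
  have h3 : |ct α β ψ| * Real.sin ψ ≤ jA α β := by
    have hsp : 0 < Real.sin ψ := Real.sin_pos_of_mem_Ioo hψ
    rw [← abs_of_pos hsp, ← abs_mul, ct_mul_sin α β hψ]
    unfold jA
    refine (abs_add_le _ _).trans ?_
    rw [abs_mul]
    have := Real.abs_cos_le_one ψ
    have := abs_nonneg (α + β + 1)
    nlinarith
  have h4 : r ≤ Real.sin ψ * π := by rwa [div_le_iff₀ hpi] at hs
  calc |ct α β ψ| * r ≤ |ct α β ψ| * (Real.sin ψ * π) := by gcongr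
    _ = |ct α β ψ| * Real.sin ψ * π := by ring
    _ ≤ _ := by gcongr

lemma sobolev_loc {α β : ℝ} (hα : -1 < α) (hβ : -1 < β) {θ r : ℝ} (hr : 0 < r) (h1 : r ≤ θ)
    (h2 : θ ≤ π - r) {f f' : ℝ → ℝ} (hf : ∀ ψ ∈ Ioo 0 π, HasDerivAt f (f' ψ) ψ)
    (hf' : ContinuousOn f' (Ioo 0 π)) :
    jV α β θ r * f θ ^ 2 ≤ 2 * (4 * π) ^ jD α β *
      ∫ ψ in (θ - r / 2)..θ, jW α β ψ * (2 * f ψ ^ 2 + r ^ 2 * f' ψ ^ 2) := by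
  set a := θ - r / 2 with ha
  have hab : a ≤ θ := by linarith
  have hsub : Icc a θ ⊆ Ioo 0 π := fun x hx => ⟨by linarith [hx.1], by linarith [hx.2]⟩
  have huI : uIcc a θ = Icc a θ := uIcc_of_le hab
  have hfc : ContinuousOn f (Icc a θ) := fun x hx => (hf x (hsub hx)).continuousAt.continuousWithinAt
  have hfc' : ContinuousOn f' (Icc a θ) := hf'.mono hsub
  have hK : 0 < (4 * π) ^ jD α β := Real.rpow_pos_of_pos (by positivity) _
  have ftc : ∫ ψ in a..θ, (f ψ ^ 2 + (ψ - a) * (2 * f ψ * f' ψ)) = r / 2 * f θ ^ 2 := by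
    rw [intervalIntegral.integral_eq_sub_of_hasDerivAt (f := fun ψ => (ψ - a) * f ψ ^ 2)]
    · simp only [ha]; ring
    · intro x hx
      rw [huI] at hx
      refine (((hasDerivAt_id x).sub_const a).mul ((hf x (hsub hx)).pow 2)).congr_deriv ?_
      simp
    · apply ContinuousOn.intervalIntegrable
      rw [huI]; fun_prop
  have hWi : IntervalIntegrable (fun ψ => jW α β ψ * (2 * f ψ ^ 2 + r ^ 2 * f' ψ ^ 2)) volume a θ := by
    have hw : IntervalIntegrable (jW α β) volume a θ :=
      (jW_int hα hβ).mono_set (by rw [huI, uIcc_of_le Real.pi_pos.le]; exact hsub.trans Ioo_subset_Icc_self)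
    refine hw.mul_continuousOn ?_
    rw [huI]; fun_prop
  have hmono : ∫ ψ in a..θ, jV α β θ r * (f ψ ^ 2 + (ψ - a) * (2 * f ψ * f' ψ)) ≤
      ∫ ψ in a..θ, ((4 * π) ^ jD α β * r) * (jW α β ψ * (2 * f ψ ^ 2 + r ^ 2 * f' ψ ^ 2)) := by
    refine intervalIntegral.integral_mono_on hab ?_ (hWi.const_mul _) ?_
    · apply ContinuousOn.intervalIntegrable
      rw [huI]; fun_prop
    · intro x hx
      have hx0 := hsub hx
      have hθ : θ ∈ Ioo 0 π := hsub ⟨hab, le_rfl⟩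
      have hc := (jW_jV_comp (α := α) (β := β) hx0 hr hθ (by linarith [hx.1]) (by linarith [hx.2])
        (by linarith [hx.2]) (by linarith [hx.1])).1
      have hv := jV_pos α β hθ hr
      have e1 : f x ^ 2 + (x - a) * (2 * f x * f' x) ≤ 2 * f x ^ 2 + r ^ 2 * f' x ^ 2 := by
        have hx1 : 0 ≤ x - a := by linarith [hx.1]
        have hx2 : x - a ≤ r := by linarith [hx.2]
        have : (x - a) ^ 2 ≤ r ^ 2 := by gcongr
        nlinarith [sq_nonneg (f x - (x - a) * f' x), sq_nonneg (f' x), mul_le_mul_of_nonneg_right this (sq_nonneg (f' x))]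
      have e2 : 0 ≤ 2 * f x ^ 2 + r ^ 2 * f' x ^ 2 := by positivity
      calc _ ≤ jV α β θ r * (2 * f x ^ 2 + r ^ 2 * f' x ^ 2) := by gcongr
        _ ≤ ((4 * π) ^ jD α β * (r * jW α β x)) * (2 * f x ^ 2 + r ^ 2 * f' x ^ 2) := by gcongr
        _ = _ := by ring
  rw [intervalIntegral.integral_const_mul, intervalIntegral.integral_const_mul, ftc] at hmono
  have : r * (jV α β θ r * f θ ^ 2) ≤ r * (2 * (4 * π) ^ jD α β *
      ∫ ψ in a..θ, jW α β ψ * (2 * f ψ ^ 2 + r ^ 2 * f' ψ ^ 2)) := by linarith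
  exact le_of_mul_le_mul_left this hr

def jK (α β : ℝ) : ℝ := 1 + |α + β + 1|

lemma jK_pos (α β : ℝ) : 0 < jK α β := by unfold jK; positivity

lemma jl_le (α β : ℝ) (n : ℕ) : jl α β n ≤ jK α β * (n : ℝ) ^ 2 := by
  unfold jl jK
  rcases Nat.eq_zero_or_pos n with h | h
  · simp [h]
  · have h1 : (1 : ℝ) ≤ n := by exact_mod_cast h
    have := le_abs_self (α + β + 1)
    have h3 := abs_nonneg (α + β + 1)
    have : (n : ℝ) + α + β + 1 ≤ n + |α + β + 1| * n := by nlinarith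
    nlinarith

lemma jl_r_le (α β : ℝ) {n T : ℕ} {r κ : ℝ} (hr : 0 ≤ r) (hn : n ≤ T) (h : T * r ≤ κ) :
    jl α β n * r ^ 2 ≤ jK α β * κ ^ 2 := by
  have h1 : (n : ℝ) ≤ T := by exact_mod_cast hn
  have h2 : (n : ℝ) * r ≤ κ := le_trans (by gcongr) h
  calc jl α β n * r ^ 2 ≤ jK α β * (n : ℝ) ^ 2 * r ^ 2 := by gcongr; exact jl_le α β n
    _ = jK α β * ((n : ℝ) * r) ^ 2 := by ring
    _ ≤ _ := by have := jK_pos α β; gcongr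

namespace JSys
variable {α β : ℝ} {P : ℕ → Polynomial ℝ}

lemma parseval (S : JSys α β P) (s : Finset ℕ) (a : ℕ → ℝ) :
    ∫ θ in 0..π, jW α β θ * (∑ n ∈ s, a n * pj P n θ) ^ 2 = ∑ n ∈ s, a n ^ 2 := by
  have e : ∀ θ, jW α β θ * (∑ n ∈ s, a n * pj P n θ) ^ 2 =
      ∑ m ∈ s, ∑ n ∈ s, a m * a n * (jW α β θ * (pj P m θ * pj P n θ)) := by
    intro θ
    rw [sq, Finset.sum_mul_sum, Finset.mul_sum]
    refine Finset.sum_congr rfl fun m _ => ?_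
    rw [Finset.mul_sum]
    exact Finset.sum_congr rfl fun n _ => by ring
  have hi : ∀ m n, IntervalIntegrable (fun θ => a m * a n * (jW α β θ * (pj P m θ * pj P n θ)))
      volume 0 π := fun m n => (jW_mul_int S.hα S.hβ
        ((pj_continuous P m).mul (pj_continuous P n))).const_mul _
  simp only [e]
  rw [intervalIntegral.integral_finsetSum]
  · refine Finset.sum_congr rfl fun m hm => ?_
    rw [intervalIntegral.integral_finsetSum]
    · simp only [intervalIntegral.integral_const_mul, S.ortho]
      simp [hm, sq]
    · exact fun n _ => hi m n
  · intro m _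
    have := IntervalIntegrable.sum s fun n _ => hi m n
    exact IntervalIntegrable.congr (fun x _ => by simp only [Finset.sum_apply]) this

lemma parseval_d (S : JSys α β P) (s : Finset ℕ) (a : ℕ → ℝ) :
    ∫ θ in 0..π, jW α β θ * (∑ n ∈ s, a n * dj P n θ) ^ 2 = ∑ n ∈ s, jl α β n * a n ^ 2 := by
  have e : ∀ θ, jW α β θ * (∑ n ∈ s, a n * dj P n θ) ^ 2 =
      ∑ m ∈ s, ∑ n ∈ s, a m * a n * (jW α β θ * (dj P m θ * dj P n θ)) := by
    intro θ
    rw [sq, Finset.sum_mul_sum, Finset.mul_sum]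
    refine Finset.sum_congr rfl fun m _ => ?_
    rw [Finset.mul_sum]
    exact Finset.sum_congr rfl fun n _ => by ring
  have hi : ∀ m n, IntervalIntegrable (fun θ => a m * a n * (jW α β θ * (dj P m θ * dj P n θ)))
      volume 0 π := fun m n => (jW_mul_int S.hα S.hβ
        ((dj_continuous P m).mul (dj_continuous P n))).const_mul _
  simp only [e]
  rw [intervalIntegral.integral_finsetSum]
  · refine Finset.sum_congr rfl fun m hm => ?_
    rw [intervalIntegral.integral_finsetSum]
    · simp only [intervalIntegral.integral_const_mul, S.ortho_d]
      simp [hm, sq]; ring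
    · exact fun n _ => hi m n
  · intro m _
    have := IntervalIntegrable.sum s fun n _ => hi m n
    exact IntervalIntegrable.congr (fun x _ => by simp only [Finset.sum_apply]) this

lemma int_sub_le {a θ : ℝ} (ha : 0 ≤ a) (hab : a ≤ θ) (hθ : θ ≤ π) (S : JSys α β P) {g : ℝ → ℝ}
    (hg : Continuous g) :
    ∫ ψ in a..θ, jW α β ψ * g ψ ^ 2 ≤ ∫ ψ in 0..π, jW α β ψ * g ψ ^ 2 := by
  have hi := jW_mul_int S.hα S.hβ (g := fun x => g x ^ 2) (hg.pow 2)
  refine intervalIntegral.integral_mono_interval ha hab hθ ?_ hi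
  rw [Filter.EventuallyLE, ae_restrict_iff' measurableSet_Ioc]
  refine Filter.Eventually.of_forall fun x hx => ?_
  exact mul_nonneg (jW_nonneg α β ⟨hx.1.le, hx.2⟩) (sq_nonneg _)

/-- Interior Christoffel bounds -/
lemma chr_int (S : JSys α β P) : ∃ C > 0, ∀ θ r, 0 < r → r ≤ θ → θ ≤ π - r → ∀ T : ℕ,
    T * r ≤ 1 → jV α β θ r * ∑ n ∈ Finset.range (T + 1), pj P n θ ^ 2 ≤ C ∧
      jV α β θ r * (r ^ 2 * ∑ n ∈ Finset.range (T + 1), dj P n θ ^ 2) ≤ C := by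
  have hK : 0 < (4 * π) ^ jD α β := Real.rpow_pos_of_pos (by positivity) _
  set K := (4 * π) ^ jD α β
  have hk := jK_pos α β
  set k := jK α β with hkdef
  have hA := jA_nonneg α β
  set B := jA α β * π with hB
  refine ⟨2 * K * (2 + k) + 2 * K * ((2 + 2 * B ^ 2) * k + 2 * k ^ 2), by positivity, ?_⟩
  intro θ r hr h1 h2 T hT
  have hθ : θ ∈ Ioo 0 π := ⟨by linarith, by linarith⟩
  have hV := jV_pos α β hθ hr
  set s := Finset.range (T + 1)
  have hjl : ∀ n ∈ s, jl α β n * r ^ 2 ≤ k := fun n hn => by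
    have := jl_r_le α β hr.le (Nat.lt_succ_iff.1 (Finset.mem_range.1 hn)) hT
    simpa using this
  have hsubset : ∀ x ∈ Icc (θ - r / 2) θ, x ∈ Ioo 0 π := fun x hx =>
    ⟨by linarith [hx.1], by linarith [hx.2]⟩
  have hpc : ∀ a : ℕ → ℝ, Continuous fun θ => ∑ n ∈ s, a n * pj P n θ := fun a =>
    continuous_finsetSum _ fun n _ => (pj_continuous P n).const_mul _
  have hdc : ∀ a : ℕ → ℝ, Continuous fun θ => ∑ n ∈ s, a n * dj P n θ := fun a =>
    continuous_finsetSum _ fun n _ => (dj_continuous P n).const_mul _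
  have hii : ∀ g : ℝ → ℝ, Continuous g → IntervalIntegrable (fun ψ => jW α β ψ * g ψ ^ 2) volume
      (θ - r / 2) θ := by
    intro g hg
    refine (jW_mul_int S.hα S.hβ (g := fun x => g x ^ 2) (hg.pow 2)).mono_set ?_
    rw [uIcc_of_le (by linarith), uIcc_of_le Real.pi_pos.le]
    exact fun x hx => Ioo_subset_Icc_self (hsubset x hx)
  -- two quadratic bounds
  have b1 : ∀ a : ℕ → ℝ, jV α β θ r * (∑ n ∈ s, a n * pj P n θ) ^ 2 ≤
      2 * K * (2 + k) * ∑ n ∈ s, a n ^ 2 := by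
    intro a
    have h := sobolev_loc S.hα S.hβ hr h1 h2 (f := fun θ => ∑ n ∈ s, a n * pj P n θ)
      (f' := fun θ => ∑ n ∈ s, a n * dj P n θ)
      (fun ψ _ => HasDerivAt.fun_sum fun n _ => (pj_hasDerivAt P n ψ).const_mul _)
      (hdc a).continuousOn
    refine h.trans ?_
    rw [mul_assoc (2 * K)]
    gcongr
    have e : ∀ ψ, jW α β ψ * (2 * (∑ n ∈ s, a n * pj P n ψ) ^ 2 + r ^ 2 * (∑ n ∈ s, a n * dj P n ψ) ^ 2)
      = 2 * (jW α β ψ * (∑ n ∈ s, a n * pj P n ψ) ^ 2) + r ^ 2 * (jW α β ψ * (∑ n ∈ s, a n * dj P n ψ) ^ 2) := fun ψ => by ring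
    simp only [e]
    rw [intervalIntegral.integral_add ((hii _ (hpc a)).const_mul _) ((hii _ (hdc a)).const_mul _),
      intervalIntegral.integral_const_mul, intervalIntegral.integral_const_mul]
    have q1 := int_sub_le (by linarith) (by linarith) hθ.2.le S (hpc a) (a := θ - r / 2)
    have q2 := int_sub_le (by linarith) (by linarith) hθ.2.le S (hdc a) (a := θ - r / 2)
    rw [S.parseval] at q1
    rw [S.parseval_d] at q2
    have q3 : r ^ 2 * ∑ n ∈ s, jl α β n * a n ^ 2 ≤ k * ∑ n ∈ s, a n ^ 2 := by
      rw [Finset.mul_sum, Finset.mul_sum]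
      refine Finset.sum_le_sum fun n hn => ?_
      have := hjl n hn
      nlinarith [sq_nonneg (a n)]
    have q4 := mul_le_mul_of_nonneg_left q2 (sq_nonneg r)
    linarith
  have b2 : ∀ a : ℕ → ℝ, jV α β θ r * (r ^ 2 * (∑ n ∈ s, a n * dj P n θ) ^ 2) ≤
      2 * K * ((2 + 2 * B ^ 2) * k + 2 * k ^ 2) * ∑ n ∈ s, a n ^ 2 := by
    intro a
    have h := sobolev_loc S.hα S.hβ hr h1 h2 (f := fun θ => ∑ n ∈ s, a n * dj P n θ)
      (f' := fun θ => ∑ n ∈ s, a n * (-jl α β n * pj P n θ - ct α β θ * dj P n θ))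
      (fun ψ hψ => HasDerivAt.fun_sum fun n _ => (S.dj_hasDerivAt n hψ).const_mul _) ?_
    swap
    · have hct : ContinuousOn (ct α β) (Ioo 0 π) := by
        have : ContinuousOn (fun x => ((α - β) + (α + β + 1) * Real.cos x) / Real.sin x) (Ioo 0 π) := by
          refine ContinuousOn.div (by fun_prop) (by fun_prop) ?_
          exact fun x hx => (Real.sin_pos_of_mem_Ioo hx).ne'
        refine this.congr fun x hx => ?_
        rw [eq_div_iff (Real.sin_pos_of_mem_Ioo hx).ne']
        exact ct_mul_sin α β hx
      refine continuousOn_finsetSum _ fun n _ => ?_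
      have := (pj_continuous P n).continuousOn (s := Ioo 0 π)
      have := (dj_continuous P n).continuousOn (s := Ioo 0 π)
      fun_prop
    have h' := mul_le_mul_of_nonneg_left h (sq_nonneg r)
    have hle : ∫ ψ in (θ - r / 2)..θ, jW α β ψ * (2 * (∑ n ∈ s, a n * dj P n ψ) ^ 2 +
        r ^ 2 * (∑ n ∈ s, a n * (-jl α β n * pj P n ψ - ct α β ψ * dj P n ψ)) ^ 2) ≤
        ∫ ψ in (θ - r / 2)..θ, ((2 + 2 * B ^ 2) * (jW α β ψ * (∑ n ∈ s, a n * dj P n ψ) ^ 2) +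
          2 * r ^ 2 * (jW α β ψ * (∑ n ∈ s, (a n * jl α β n) * pj P n ψ) ^ 2)) := by
      refine intervalIntegral.integral_mono_on (by linarith) ?_
        (((hii _ (hdc a)).const_mul _).add ((hii _ (hpc _)).const_mul _)) ?_
      · have hw : IntervalIntegrable (jW α β) volume (θ - r / 2) θ :=
          (jW_int S.hα S.hβ).mono_set (by
            rw [uIcc_of_le (by linarith), uIcc_of_le Real.pi_pos.le]
            exact fun x hx => Ioo_subset_Icc_self (hsubset x hx))
        refine hw.mul_continuousOn ?_
        rw [uIcc_of_le (by linarith)]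
        have hct : ContinuousOn (ct α β) (Icc (θ - r / 2) θ) := by
          have : ContinuousOn (fun x => ((α - β) + (α + β + 1) * Real.cos x) / Real.sin x)
              (Icc (θ - r / 2) θ) := by
            refine ContinuousOn.div (by fun_prop) (by fun_prop) ?_
            exact fun x hx => (Real.sin_pos_of_mem_Ioo (hsubset x hx)).ne'
          refine this.congr fun x hx => ?_
          rw [eq_div_iff (Real.sin_pos_of_mem_Ioo (hsubset x hx)).ne']
          exact ct_mul_sin α β (hsubset x hx)
        have hd' := (hdc a).continuousOn (s := Icc (θ - r / 2) θ)
        have : ContinuousOn (fun ψ => ∑ n ∈ s, a n * (-jl α β n * pj P n ψ - ct α β ψ * dj P n ψ))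
            (Icc (θ - r / 2) θ) := by
          refine continuousOn_finsetSum _ fun n _ => ?_
          have := (pj_continuous P n).continuousOn (s := Icc (θ - r / 2) θ)
          have := (dj_continuous P n).continuousOn (s := Icc (θ - r / 2) θ)
          fun_prop
        fun_prop
      · intro x hx
        have hw := jW_nonneg α β (Ioo_subset_Icc_self (hsubset x hx))
        have hcb := ct_bound α β (hsubset x hx) (r := r) (by linarith [hx.1]) (by linarith [hx.2]) hr
        have e : ∑ n ∈ s, a n * (-jl α β n * pj P n x - ct α β x * dj P n x) =
          -(∑ n ∈ s, (a n * jl α β n) * pj P n x) - ct α β x * ∑ n ∈ s, a n * dj P n x := by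
          rw [Finset.mul_sum, ← Finset.sum_neg_distrib, ← Finset.sum_sub_distrib]
          exact Finset.sum_congr rfl fun n _ => by ring
        rw [e]
        set X := ∑ n ∈ s, (a n * jl α β n) * pj P n x
        set Y := ∑ n ∈ s, a n * dj P n x
        have hc2 : (ct α β x * r) ^ 2 ≤ B ^ 2 := by
          rw [← sq_abs, abs_mul, abs_of_pos hr]; gcongr
        have : 2 * Y ^ 2 + r ^ 2 * (-X - ct α β x * Y) ^ 2 ≤ (2 + 2 * B ^ 2) * Y ^ 2 + 2 * r ^ 2 * X ^ 2 := by
          nlinarith [sq_nonneg (r * (X - ct α β x * Y)), mul_le_mul_of_nonneg_right hc2 (sq_nonneg Y)]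
        calc _ ≤ jW α β x * ((2 + 2 * B ^ 2) * Y ^ 2 + 2 * r ^ 2 * X ^ 2) := by gcongr
          _ = _ := by ring
    rw [intervalIntegral.integral_add ((hii _ (hdc a)).const_mul _) ((hii _ (hpc _)).const_mul _),
      intervalIntegral.integral_const_mul, intervalIntegral.integral_const_mul] at hle
    have q1 := int_sub_le (by linarith) (by linarith) hθ.2.le S (hpc fun n => a n * jl α β n) (a := θ - r / 2)
    have q2 := int_sub_le (by linarith) (by linarith) hθ.2.le S (hdc a) (a := θ - r / 2)
    rw [S.parseval] at q1
    rw [S.parseval_d] at q2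
    have q3 : r ^ 2 * ∑ n ∈ s, jl α β n * a n ^ 2 ≤ k * ∑ n ∈ s, a n ^ 2 := by
      rw [Finset.mul_sum, Finset.mul_sum]
      refine Finset.sum_le_sum fun n hn => ?_
      have := hjl n hn
      nlinarith [sq_nonneg (a n)]
    have q4 : r ^ 2 * (r ^ 2 * ∑ n ∈ s, (a n * jl α β n) ^ 2) ≤ k ^ 2 * ∑ n ∈ s, a n ^ 2 := by
      rw [Finset.mul_sum, Finset.mul_sum, Finset.mul_sum]
      refine Finset.sum_le_sum fun n hn => ?_
      have h0 : 0 ≤ jl α β n * r ^ 2 := mul_nonneg (jl_nonneg S.hα S.hβ n) (sq_nonneg r)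
      have : (jl α β n * r ^ 2) ^ 2 ≤ k ^ 2 := pow_le_pow_left₀ h0 (hjl n hn) 2
      nlinarith [sq_nonneg (a n)]
    calc jV α β θ r * (r ^ 2 * (∑ n ∈ s, a n * dj P n θ) ^ 2)
        = r ^ 2 * (jV α β θ r * (∑ n ∈ s, a n * dj P n θ) ^ 2) := by ring
      _ ≤ _ := h'
      _ ≤ r ^ 2 * (2 * K * ((2 + 2 * B ^ 2) * (∑ n ∈ s, jl α β n * a n ^ 2) + 2 * r ^ 2 * ∑ n ∈ s, (a n * jl α β n) ^ 2)) := by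
          gcongr
          refine hle.trans ?_
          gcongr
      _ = 2 * K * ((2 + 2 * B ^ 2) * (r ^ 2 * ∑ n ∈ s, jl α β n * a n ^ 2) + 2 * (r ^ 2 * (r ^ 2 * ∑ n ∈ s, (a n * jl α β n) ^ 2))) := by ring
      _ ≤ 2 * K * ((2 + 2 * B ^ 2) * (k * ∑ n ∈ s, a n ^ 2) + 2 * (k ^ 2 * ∑ n ∈ s, a n ^ 2)) := by gcongr
      _ = _ := by ring
  have sq_trick : ∀ v c X : ℝ, 0 < v → 0 ≤ X → 0 ≤ c → v * X ^ 2 ≤ c * X → v * X ≤ c := by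
    intro v c X hv hX hc h
    rcases hX.eq_or_lt with h0 | h0
    · rw [← h0]; simpa using hc
    · refine le_of_mul_le_mul_right ?_ h0
      calc v * X * X = v * X ^ 2 := by ring
        _ ≤ _ := h
  constructor
  · have := b1 (fun n => pj P n θ)
    simp only [← sq] at this
    have := sq_trick _ _ _ hV (Finset.sum_nonneg fun n _ => sq_nonneg (pj P n θ)) (by positivity) this
    have : 0 ≤ 2 * K * ((2 + 2 * B ^ 2) * k + 2 * k ^ 2) := by positivity
    linarith
  · have := b2 (fun n => dj P n θ)
    simp only [← sq] at this
    have := sq_trick (jV α β θ r * r ^ 2) (2 * K * ((2 + 2 * B ^ 2) * k + 2 * k ^ 2))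
      (∑ n ∈ s, dj P n θ ^ 2) (by positivity)
      (Finset.sum_nonneg fun n _ => sq_nonneg (dj P n θ)) (by positivity) (by rw [mul_assoc]; exact this)
    have : 0 ≤ 2 * K * (2 + k) := by positivity
    linarith
end JSys

namespace JSys
variable {α β : ℝ} {P : ℕ → Polynomial ℝ}

lemma endpt_ej (S : JSys α β P) {r s : ℝ} (hr : 0 < r) (hrπ : r < π)
    (hs2 : r * (α + β + 2) ≤ α + 1) (hr1 : r ≤ 1) (n : ℕ)
    (hS : ∀ ψ ∈ Icc 0 r, |pj P n ψ| ≤ s) {θ : ℝ} (hθ : θ ∈ Ioc 0 r) :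
    |ej P n θ| ≤ jl α β n * s / (α + 1) := by
  have hα1 : 0 < α + 1 := by linarith [S.hα]
  have hβ1 : 0 < β + 1 := by linarith [S.hβ]
  set c := 2 / (α + 1) * jl α β n * s with hc
  have hs0 : 0 ≤ s := (abs_nonneg _).trans (hS 0 ⟨le_rfl, hr.le⟩)
  have hjl := jl_nonneg S.hα S.hβ n
  have hc0 : 0 ≤ c := by positivity
  have hmono : ∀ σ : ℝ, |σ| ≤ 1 →
      MonotoneOn (fun x => c * jOm α β x + σ * (-2 * jOm α β x * ej P n x)) (Icc 0 r) := by
    intro σ hσ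
    refine monotoneOn_of_deriv_nonneg (convex_Icc 0 r) ?_ ?_ ?_
    · have h1 := jOm_continuous S.hα S.hβ
      have h2 := ej_continuous P n
      fun_prop
    · intro x hx
      rw [interior_Icc] at hx
      have hx' : x ∈ Ioo 0 π := ⟨hx.1, hx.2.trans hrπ⟩
      exact (((jOm_hasDerivAt α β hx').const_mul c).add
        ((S.flux_hasDerivAt n hx').const_mul σ)).differentiableAt.differentiableWithinAt
    · intro x hx
      rw [interior_Icc] at hx
      have hx' : x ∈ Ioo 0 π := ⟨hx.1, hx.2.trans hrπ⟩
      have hd := ((jOm_hasDerivAt α β hx').const_mul c).add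
        ((S.flux_hasDerivAt n hx').const_mul σ)
      have he : deriv (fun x => c * jOm α β x + σ * (-2 * jOm α β x * ej P n x)) x = _ := hd.deriv
      rw [he]
      have hw := jW_pos α β hx'
      have hp := hS x ⟨hx.1.le, hx.2.le⟩
      have h1 := sin_half_upper hx.1.le
      have h2 := sin_half_pos hx'
      have h3 : Real.sin (x / 2) ^ 2 ≤ r / 4 := by
        have : Real.sin (x / 2) ^ 2 ≤ (x / 2) ^ 2 := by gcongr
        nlinarith [hx.1, hx.2]
      have h4 := Real.sin_sq_add_cos_sq (x / 2)
      have h5 : (α + 1) / 2 ≤ (α + 1) * Real.cos (x / 2) ^ 2 - (β + 1) * Real.sin (x / 2) ^ 2 := by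
        have : Real.cos (x / 2) ^ 2 = 1 - Real.sin (x / 2) ^ 2 := by linarith
        rw [this]
        nlinarith
      have h6 : jl α β n * s ≤ c * ((α + 1) * Real.cos (x / 2) ^ 2 - (β + 1) * Real.sin (x / 2) ^ 2) := by
        calc jl α β n * s = c * ((α + 1) / 2) := by rw [hc]; field_simp
          _ ≤ _ := by gcongr
      have h7 : |σ * (jl α β n * pj P n x)| ≤ jl α β n * s := by
        rw [abs_mul, abs_mul, abs_of_nonneg hjl]
        calc |σ| * (jl α β n * |pj P n x|) ≤ 1 * (jl α β n * s) := by gcongr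
          _ = _ := one_mul _
      have h8 := (abs_le.1 h7).2
      have : 0 ≤ jW α β x * (c * ((α + 1) * Real.cos (x / 2) ^ 2 - (β + 1) * Real.sin (x / 2) ^ 2)
        - σ * (jl α β n * pj P n x)) := mul_nonneg hw.le (by linarith)
      linarith
  have hOm : 0 < jOm α β θ := by
    have hx' : θ ∈ Ioo 0 π := ⟨hθ.1, hθ.2.trans_lt hrπ⟩
    have h2 := sin_half_pos hx'
    have h3 := cos_half_pos hx'
    unfold jOm
    exact mul_pos (Real.rpow_pos_of_pos h2 _) (Real.rpow_pos_of_pos h3 _)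
  have hz := jOm_zero β S.hα
  have m1 := hmono 1 (by simp) ⟨le_rfl, hr.le⟩ ⟨hθ.1.le, hθ.2⟩ hθ.1.le
  have m2 := hmono (-1) (by simp) ⟨le_rfl, hr.le⟩ ⟨hθ.1.le, hθ.2⟩ hθ.1.le
  simp only [hz] at m1 m2
  have e : c = 2 * (jl α β n * s / (α + 1)) := by rw [hc]; field_simp
  rw [e] at m1 m2
  rw [abs_le]
  constructor
  · have : 0 ≤ 2 * jOm α β θ * (jl α β n * s / (α + 1) + ej P n θ) := by linarith
    have := nonneg_of_mul_nonneg_right this (by positivity)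
    linarith
  · have : 0 ≤ 2 * jOm α β θ * (jl α β n * s / (α + 1) - ej P n θ) := by linarith
    have := nonneg_of_mul_nonneg_right this (by positivity)
    linarith

lemma endpt (S : JSys α β P) : ∃ κ : ℝ, κ > 0 ∧ κ ≤ 1 ∧ ∀ r : ℝ, 0 < r → r ≤ κ → ∀ n : ℕ, (n : ℝ) * r ≤ κ →
    ∀ θ ∈ Ioc 0 r, |pj P n θ| ≤ 2 * |pj P n r| ∧
      |ej P n θ| ≤ 2 / (α + 1) * jl α β n * |pj P n r| := by
  have hα1 : 0 < α + 1 := by linarith [S.hα]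
  have hβ1 : 0 < β + 1 := by linarith [S.hβ]
  have hk := jK_pos α β
  set κ := min 1 (min ((α + 1) / (α + β + 2)) ((α + 1) / (2 * jK α β))) with hκ
  have hab : 0 < α + β + 2 := by linarith
  have k0 : 0 < κ := by rw [hκ]; refine lt_min one_pos (lt_min (by positivity) (by positivity))
  have k1 : κ ≤ 1 := min_le_left _ _
  have k2 : κ ≤ (α + 1) / (α + β + 2) := (min_le_right _ _).trans (min_le_left _ _)
  have k3 : κ ≤ (α + 1) / (2 * jK α β) := (min_le_right _ _).trans (min_le_right _ _)
  refine ⟨κ, k0, k1, ?_⟩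
  intro r hr hrκ n hn θ hθ
  have hr1 : r ≤ 1 := hrκ.trans k1
  have hrπ : r < π := by linarith [Real.pi_gt_three]
  have hjl := jl_nonneg S.hα S.hβ n
  obtain ⟨ψ, hψ, hmax⟩ := isCompact_Icc.exists_isMaxOn (nonempty_Icc.2 hr.le)
    ((pj_continuous P n).abs.continuousOn (s := Icc 0 r))
  have hS : ∀ x ∈ Icc 0 r, |pj P n x| ≤ |pj P n ψ| := fun x hx => hmax hx
  set s := |pj P n ψ| with hs
  have hs0 : 0 ≤ s := abs_nonneg _
  have hE : ∀ x ∈ Ioc 0 r, |ej P n x| ≤ jl α β n * s / (α + 1) := fun x hx =>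
    S.endpt_ej hr hrπ (by
      calc r * (α + β + 2) ≤ (α + 1) / (α + β + 2) * (α + β + 2) := by gcongr; exact hrκ.trans k2
        _ = _ := by field_simp) hr1 n hS hx
  have hDj : ∀ x ∈ Icc 0 r, ‖dj P n x‖ ≤ r * (jl α β n * s / (α + 1)) := by
    intro x hx
    rcases hx.1.eq_or_lt with h | h
    · rw [← h]; simp [dj]; positivity
    · rw [dj, norm_mul, norm_neg]
      have := hE x ⟨h, hx.2⟩
      have h3 : |Real.sin x| ≤ r := by
        rw [abs_of_nonneg (Real.sin_nonneg_of_nonneg_of_le_pi hx.1 (by linarith [hx.2]))]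
        exact (Real.sin_le hx.1).trans hx.2
      simp only [Real.norm_eq_abs]
      gcongr
  have hmv := (convex_Icc 0 r).norm_image_sub_le_of_norm_hasDerivWithin_le
    (fun x _ => (pj_hasDerivAt P n x).hasDerivWithinAt) hDj (x := r) (y := ψ) ⟨hr.le, le_rfl⟩ hψ
  have hjr : jl α β n * r ^ 2 ≤ (α + 1) / 2 := by
    have := jl_r_le α β hr.le (le_refl n) hn
    calc _ ≤ _ := this
      _ ≤ jK α β * κ := mul_le_mul_of_nonneg_left (by nlinarith) hk.le
      _ ≤ jK α β * ((α + 1) / (2 * jK α β)) := by gcongr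
      _ = _ := by field_simp
  have h1 : ‖pj P n ψ - pj P n r‖ ≤ s / 2 := by
    refine hmv.trans ?_
    have : ‖ψ - r‖ ≤ r := by
      rw [Real.norm_eq_abs, abs_le]; constructor <;> linarith [hψ.1, hψ.2]
    calc r * (jl α β n * s / (α + 1)) * ‖ψ - r‖ ≤ r * (jl α β n * s / (α + 1)) * r := by gcongr
      _ = (jl α β n * r ^ 2) * (s / (α + 1)) := by ring
      _ ≤ (α + 1) / 2 * (s / (α + 1)) := by gcongr
      _ = s / 2 := by field_simp
  have h2 : s ≤ 2 * |pj P n r| := by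
    have := abs_sub_abs_le_abs_sub (pj P n ψ) (pj P n r)
    rw [Real.norm_eq_abs] at h1
    linarith
  refine ⟨(hS θ ⟨hθ.1.le, hθ.2⟩).trans h2, (hE θ hθ).trans ?_⟩
  calc jl α β n * s / (α + 1) ≤ jl α β n * (2 * |pj P n r|) / (α + 1) := by gcongr
    _ = _ := by ring

/-- Christoffel bounds -/
def Chr (α β : ℝ) (P : ℕ → Polynomial ℝ) (κ C θ : ℝ) : Prop :=
  ∀ r, 0 < r → r ≤ κ → ∀ T : ℕ, T * r ≤ κ →
    jV α β θ r * ∑ n ∈ Finset.range (T + 1), pj P n θ ^ 2 ≤ C ∧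
    jV α β θ r * (r ^ 2 * ∑ n ∈ Finset.range (T + 1), dj P n θ ^ 2) ≤ C ∧
    jV α β θ r * (r ^ 4 * ∑ n ∈ Finset.range (T + 1), ej P n θ ^ 2) ≤ C

lemma chr_left (S : JSys α β P) : ∃ κ : ℝ, κ > 0 ∧ κ ≤ 1 ∧ ∃ C > 0, ∀ θ, 0 < θ → θ ≤ π / 2 →
    Chr α β P κ C θ := by
  obtain ⟨κ, hκ, hκ1, He⟩ := S.endpt
  obtain ⟨C, hC, Hi⟩ := S.chr_int
  have hpi := Real.pi_pos
  have hpi3 := Real.pi_gt_three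
  have hα1 : 0 < α + 1 := by linarith [S.hα]
  have hD : 0 < (2 : ℝ) ^ jD α β := Real.rpow_pos_of_pos (by positivity) _
  set D := (2 : ℝ) ^ jD α β
  set k := jK α β
  have hk : 0 < k := jK_pos α β
  refine ⟨κ, hκ, hκ1, C * (1 + π ^ 2) + D * (4 + 4 / (α + 1) ^ 2 * k ^ 2) * C, by positivity, ?_⟩
  intro θ h0 h1 r hr hrκ T hT
  have hpos2 : 0 ≤ D * (4 + 4 / (α + 1) ^ 2 * k ^ 2) * C := by positivity
  have hpos3 : 0 ≤ C * π ^ 2 := by positivity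
  have hθ : θ ∈ Ioo 0 π := ⟨h0, by linarith⟩
  have hV := jV_pos α β hθ hr
  rcases le_or_gt r θ with h | h
  · obtain ⟨a1, a2⟩ := Hi θ r hr h (by linarith) T (hT.trans hκ1)
    refine ⟨by linarith, by linarith, ?_⟩
    have hs : r / π ≤ Real.sin θ := sin_lower_mid (by linarith) (by linarith) hr
    have e : ∀ n, r ^ 2 * ej P n θ ^ 2 ≤ π ^ 2 * dj P n θ ^ 2 := by
      intro n
      have : r ≤ Real.sin θ * π := by rwa [div_le_iff₀ hpi] at hs
      have : r ^ 2 ≤ (Real.sin θ * π) ^ 2 := by gcongr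
      calc r ^ 2 * ej P n θ ^ 2 ≤ (Real.sin θ * π) ^ 2 * ej P n θ ^ 2 := by gcongr
        _ = _ := by rw [dj]; ring
    calc _ = jV α β θ r * (r ^ 2 * ∑ n ∈ Finset.range (T + 1), r ^ 2 * ej P n θ ^ 2) := by
          rw [← Finset.mul_sum]; ring
      _ ≤ jV α β θ r * (r ^ 2 * ∑ n ∈ Finset.range (T + 1), π ^ 2 * dj P n θ ^ 2) := by
          refine mul_le_mul_of_nonneg_left (mul_le_mul_of_nonneg_left (Finset.sum_le_sum fun n _ => e n) (sq_nonneg r)) hV.le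
      _ = π ^ 2 * (jV α β θ r * (r ^ 2 * ∑ n ∈ Finset.range (T + 1), dj P n θ ^ 2)) := by
          rw [← Finset.mul_sum]; ring
      _ ≤ π ^ 2 * C := by gcongr
      _ ≤ _ := by linarith
  · have hrr : r ∈ Ioo 0 π := ⟨hr, by linarith⟩
    obtain ⟨a1, a2⟩ := Hi r r hr le_rfl (by linarith) T (hT.trans hκ1)
    have hnear : jV α β θ r ≤ D * jV α β r r := jV_near hθ hrr hr (by rw [abs_le]; constructor <;> linarith)
    have hVr := jV_pos α β hrr hr
    have hn : ∀ n ∈ Finset.range (T + 1), (n : ℝ) * r ≤ κ := by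
      intro n hn
      have : (n : ℝ) ≤ T := by exact_mod_cast Nat.lt_succ_iff.1 (Finset.mem_range.1 hn)
      exact le_trans (by gcongr) hT
    have gen : ∀ (f : ℕ → ℝ) (A : ℝ), 0 ≤ A → (∀ n ∈ Finset.range (T + 1), f n ≤ A * pj P n r ^ 2) →
        jV α β θ r * ∑ n ∈ Finset.range (T + 1), f n ≤ D * A * C := by
      intro f A hA hf
      calc jV α β θ r * ∑ n ∈ Finset.range (T + 1), f n ≤
          jV α β θ r * ∑ n ∈ Finset.range (T + 1), A * pj P n r ^ 2 := by
            gcongr with n hn; exact hf n hn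
        _ ≤ D * jV α β r r * ∑ n ∈ Finset.range (T + 1), A * pj P n r ^ 2 := by
            gcongr
        _ = D * A * (jV α β r r * ∑ n ∈ Finset.range (T + 1), pj P n r ^ 2) := by
            rw [← Finset.mul_sum]; ring
        _ ≤ _ := by gcongr
    have hej : ∀ n ∈ Finset.range (T + 1), r ^ 4 * ej P n θ ^ 2 ≤ (4 / (α + 1) ^ 2 * k ^ 2) * pj P n r ^ 2 := by
      intro n hn'
      have h2 := (He r hr hrκ n (hn n hn') θ ⟨h0, h.le⟩).2
      have hj := jl_r_le α β hr.le (le_refl n) ((hn n hn').trans hκ1)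
      have hjl := jl_nonneg S.hα S.hβ n
      rw [one_pow, mul_one] at hj
      have h3 : r ^ 2 * |ej P n θ| ≤ 2 / (α + 1) * k * |pj P n r| := by
        calc r ^ 2 * |ej P n θ| ≤ r ^ 2 * (2 / (α + 1) * jl α β n * |pj P n r|) := by gcongr
          _ = 2 / (α + 1) * (jl α β n * r ^ 2) * |pj P n r| := by ring
          _ ≤ _ := by gcongr
      have := pow_le_pow_left₀ (by positivity) h3 2
      rw [mul_pow, mul_pow, sq_abs, sq_abs] at this
      calc _ = (r ^ 2) ^ 2 * ej P n θ ^ 2 := by ring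
        _ ≤ _ := this
        _ = _ := by rw [mul_pow, div_pow]; norm_num
    have hsin : Real.sin θ ^ 2 ≤ r ^ 2 := by
      have := Real.sin_le h0.le
      have := Real.sin_pos_of_mem_Ioo hθ
      gcongr; linarith
    have hbig : ∀ A : ℝ, A ≤ 4 + 4 / (α + 1) ^ 2 * k ^ 2 → D * A * C ≤
        C * (1 + π ^ 2) + D * (4 + 4 / (α + 1) ^ 2 * k ^ 2) * C := by
      intro A hA
      have : D * A * C ≤ D * (4 + 4 / (α + 1) ^ 2 * k ^ 2) * C := by gcongr
      have : 0 ≤ C * (1 + π ^ 2) := by positivity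
      linarith
    have hq : 0 ≤ 4 / (α + 1) ^ 2 * k ^ 2 := by positivity
    refine ⟨?_, ?_, ?_⟩
    · refine (gen _ 4 (by norm_num) ?_).trans (hbig _ (by linarith))
      intro n hn'
      have h2 := (He r hr hrκ n (hn n hn') θ ⟨h0, h.le⟩).1
      have := pow_le_pow_left₀ (by positivity) h2 2
      rw [mul_pow, sq_abs, sq_abs] at this
      linarith
    · rw [Finset.mul_sum]
      refine (gen _ (4 / (α + 1) ^ 2 * k ^ 2) hq ?_).trans (hbig _ (by linarith))
      intro n hn'
      refine le_trans ?_ (hej n hn')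
      rw [dj]
      calc r ^ 2 * (-Real.sin θ * ej P n θ) ^ 2 = r ^ 2 * Real.sin θ ^ 2 * ej P n θ ^ 2 := by ring
        _ ≤ r ^ 2 * r ^ 2 * ej P n θ ^ 2 := by gcongr
        _ = _ := by ring
    · rw [Finset.mul_sum]
      exact (gen _ (4 / (α + 1) ^ 2 * k ^ 2) hq hej).trans (hbig _ (by linarith))

lemma Chr.mono {κ κ' C C' θ : ℝ} (h : Chr α β P κ C θ) (hκ : κ' ≤ κ) (hC : C ≤ C') :
    Chr α β P κ' C' θ := fun r hr hrκ T hT => by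
  obtain ⟨a, b, c⟩ := h r hr (hrκ.trans hκ) T (hT.trans hκ)
  exact ⟨a.trans hC, b.trans hC, c.trans hC⟩

lemma chr (S : JSys α β P) : ∃ κ : ℝ, κ > 0 ∧ κ ≤ 1 ∧ ∃ C > 0, ∀ θ ∈ Ioo 0 π, Chr α β P κ C θ := by
  obtain ⟨κ, hκ, hκ1, C, hC, H⟩ := S.chr_left
  obtain ⟨κ', hκ', hκ1', C', hC', H'⟩ := S.refl.chr_left
  refine ⟨min κ κ', lt_min hκ hκ', (min_le_left _ _).trans hκ1, max C C', lt_max_of_lt_left hC, ?_⟩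
  intro θ hθ
  rcases le_or_gt θ (π / 2) with h | h
  · exact (H θ hθ.1 h).mono (min_le_left _ _) (le_max_left _ _)
  · have h2 := (H' (π - θ) (by linarith [hθ.2]) (by linarith)).mono
      (κ' := min κ κ') (C' := max C C') (min_le_right _ _) (le_max_right _ _)
    intro r hr hrκ T hT
    have := h2 r hr hrκ T hT
    rw [jV_refl] at this
    simpa [pj, dj, ej, Polynomial.derivative_comp, Real.sin_pi_sub] using this
end JSys

lemma weighted_sum {α β κ C θ : ℝ} (hκ : 0 < κ) (hκ1 : κ ≤ 1) (hC : 0 < C) (hθ : θ ∈ Ioo 0 π)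
    (e : ℕ) (B : ℕ → ℝ) (hB0 : ∀ n, 0 ≤ B n)
    (hB : ∀ r, 0 < r → r ≤ κ → ∀ T : ℕ, T * r ≤ κ →
      jV α β θ r * (r ^ e * ∑ n ∈ Finset.range (T + 1), B n) ≤ C)
    (Q : ℕ) (hQ : ⌈jD α β⌉₊ + e + 2 ≤ Q) (R : ℝ) (hR : 0 < R) (hRπ : R ≤ π) (T : ℕ) :
    jV α β θ R * (R ^ e * ∑ n ∈ Finset.range T, ((1 + R * n) ^ Q)⁻¹ * B n) ≤
      C * (π / κ) ^ (⌈jD α β⌉₊ + e) * ∑' k : ℕ, (((k : ℝ) + 1) ^ 2)⁻¹ := by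
  have hpi := Real.pi_pos
  set D := ⌈jD α β⌉₊ with hD
  have hV := jV_pos α β hθ hR
  set K := ⌊R * T⌋₊ + 1 with hK
  have hsm : Summable fun k : ℕ => (((k : ℝ) + 1) ^ 2)⁻¹ := by
    have := (summable_nat_add_iff 1).2 (Real.summable_nat_pow_inv.2 (by norm_num : 1 < 2))
    simpa using this
  -- pointwise
  have h1 : ∀ n ∈ Finset.range T, ((1 + R * n) ^ Q)⁻¹ * B n ≤
      ∑ k ∈ Finset.range K, (((k : ℝ) + 1) ^ Q)⁻¹ * (if R * n < k + 1 then B n else 0) := by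
    intro n hn
    have hn' : (n : ℝ) ≤ T := by exact_mod_cast (Finset.mem_range.1 hn).le
    have hRn : 0 ≤ R * n := by positivity
    have hmem : ⌊R * n⌋₊ ∈ Finset.range K := by
      rw [Finset.mem_range, hK, Nat.lt_succ_iff]
      exact Nat.floor_mono (by gcongr)
    have := Finset.single_le_sum (f := fun k : ℕ => (((k : ℝ) + 1) ^ Q)⁻¹ * (if R * n < k + 1 then B n else 0))
      (fun k _ => mul_nonneg (by positivity) (by split_ifs; exacts [hB0 n, le_rfl])) hmem
    refine le_trans ?_ this
    rw [if_pos (Nat.lt_floor_add_one _)]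
    have hf := Nat.floor_le hRn
    refine mul_le_mul_of_nonneg_right ?_ (hB0 n)
    refine inv_anti₀ (by positivity) ?_
    refine pow_le_pow_left₀ (by positivity) (by linarith) _
  -- block bound
  have h2 : ∀ k : ℕ, jV α β θ R * (R ^ e * ∑ n ∈ Finset.range T, (if R * n < k + 1 then B n else 0)) ≤
      C * (π / κ) ^ (D + e) * ((k : ℝ) + 1) ^ (D + e) := by
    intro k
    set r := κ * R / (π * (k + 1)) with hr
    have hk1 : (1 : ℝ) ≤ k + 1 := by have : (0 : ℝ) ≤ k := Nat.cast_nonneg k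
                                     linarith
    have hr0 : 0 < r := by positivity
    have hrR : R / r = π / κ * (k + 1) := by rw [hr]; field_simp
    have hpk : 1 ≤ π / κ := by rw [one_le_div hκ]; linarith [Real.pi_gt_three]
    have hrR1 : 1 ≤ R / r := by rw [hrR]; nlinarith
    have hrκ : r ≤ κ := by
      rw [hr, div_le_iff₀ (by positivity)]
      nlinarith [mul_le_mul_of_nonneg_left hRπ hκ.le, mul_le_mul_of_nonneg_left hk1 (mul_pos hκ hpi).le]
    set T' := ⌊((k : ℝ) + 1) / R⌋₊ with hT'
    have hT'r : T' * r ≤ κ := by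
      have : (T' : ℝ) ≤ (k + 1) / R := Nat.floor_le (by positivity)
      calc T' * r ≤ (k + 1) / R * r := by gcongr
        _ = κ / π := by rw [hr]; field_simp
        _ ≤ κ := div_le_self hκ.le (by linarith [Real.pi_gt_three])
    have hb := hB r hr0 hrκ T' hT'r
    have hdoub := jV_doubling (α := α) (β := β) hθ hr0 (one_le_div hr0 |>.1 hrR1)
    have hVr := jV_pos α β hθ hr0
    have hrp : (R / r) ^ jD α β ≤ (R / r) ^ D := by
      rw [← Real.rpow_natCast]
      exact Real.rpow_le_rpow_of_exponent_le hrR1 (Nat.le_ceil _)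
    have hsum : ∑ n ∈ Finset.range T, (if R * n < k + 1 then B n else 0) ≤
        ∑ n ∈ Finset.range (T' + 1), B n := by
      rw [← Finset.sum_filter]
      refine Finset.sum_le_sum_of_subset_of_nonneg ?_ fun n _ _ => hB0 n
      intro n hn
      rw [Finset.mem_filter] at hn
      rw [Finset.mem_range, Nat.lt_succ_iff]
      refine Nat.le_floor ?_
      rw [le_div_iff₀ hR]; linarith [hn.2]
    have hs0 : 0 ≤ ∑ n ∈ Finset.range (T' + 1), B n := Finset.sum_nonneg fun n _ => hB0 n
    have hRe : R ^ e = (R / r) ^ e * r ^ e := by rw [← mul_pow]; congr 1; field_simp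
    calc _ ≤ jV α β θ R * (R ^ e * ∑ n ∈ Finset.range (T' + 1), B n) := by gcongr
      _ ≤ ((R / r) ^ D * jV α β θ r) * (R ^ e * ∑ n ∈ Finset.range (T' + 1), B n) := by
          refine mul_le_mul_of_nonneg_right (hdoub.trans ?_) (by positivity)
          gcongr
      _ = (R / r) ^ (D + e) * (jV α β θ r * (r ^ e * ∑ n ∈ Finset.range (T' + 1), B n)) := by
          rw [hRe, pow_add]; ring
      _ ≤ (R / r) ^ (D + e) * C := by gcongr
      _ = _ := by rw [hrR, mul_pow]; ring
  calc jV α β θ R * (R ^ e * ∑ n ∈ Finset.range T, ((1 + R * n) ^ Q)⁻¹ * B n)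
      ≤ jV α β θ R * (R ^ e * ∑ n ∈ Finset.range T, ∑ k ∈ Finset.range K, (((k : ℝ) + 1) ^ Q)⁻¹ * (if R * n < k + 1 then B n else 0)) :=
        mul_le_mul_of_nonneg_left (mul_le_mul_of_nonneg_left (Finset.sum_le_sum h1) (by positivity)) hV.le
    _ = ∑ k ∈ Finset.range K, (((k : ℝ) + 1) ^ Q)⁻¹ * (jV α β θ R * (R ^ e * ∑ n ∈ Finset.range T, (if R * n < k + 1 then B n else 0))) := by
        rw [Finset.sum_comm, Finset.mul_sum, Finset.mul_sum]
        refine Finset.sum_congr rfl fun k _ => ?_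
        rw [← Finset.mul_sum]; ring
    _ ≤ ∑ k ∈ Finset.range K, (((k : ℝ) + 1) ^ Q)⁻¹ * (C * (π / κ) ^ (D + e) * ((k : ℝ) + 1) ^ (D + e)) := by
        exact Finset.sum_le_sum fun k _ => mul_le_mul_of_nonneg_left (h2 k) (by positivity)
    _ ≤ ∑ k ∈ Finset.range K, C * (π / κ) ^ (D + e) * (((k : ℝ) + 1) ^ 2)⁻¹ := by
        refine Finset.sum_le_sum fun k _ => ?_
        have hk1 : (1 : ℝ) ≤ k + 1 := by have : (0 : ℝ) ≤ k := Nat.cast_nonneg k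
                                         linarith
        have : (((k : ℝ) + 1) ^ Q)⁻¹ * ((k : ℝ) + 1) ^ (D + e) ≤ (((k : ℝ) + 1) ^ 2)⁻¹ := by
          rw [inv_mul_eq_div, ← one_div, div_le_div_iff₀ (by positivity) (by positivity), one_mul,
            ← pow_add]
          exact pow_le_pow_right₀ hk1 hQ
        calc _ = C * (π / κ) ^ (D + e) * ((((k : ℝ) + 1) ^ Q)⁻¹ * ((k : ℝ) + 1) ^ (D + e)) := by ring
          _ ≤ _ := by gcongr
    _ = C * (π / κ) ^ (D + e) * ∑ k ∈ Finset.range K, (((k : ℝ) + 1) ^ 2)⁻¹ := by rw [Finset.mul_sum]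
    _ ≤ _ := by
        gcongr
        exact hsm.sum_le_tsum _ fun k _ => by positivity

/-- the three families -/
def fj (P : ℕ → Polynomial ℝ) (k n : ℕ) (θ : ℝ) : ℝ :=
  if k = 0 then pj P n θ else if k = 1 then dj P n θ else ej P n θ

lemma fj_zero (P : ℕ → Polynomial ℝ) (n : ℕ) (θ : ℝ) : fj P 0 n θ = pj P n θ := by simp [fj]
lemma fj_one (P : ℕ → Polynomial ℝ) (n : ℕ) (θ : ℝ) : fj P 1 n θ = dj P n θ := by simp [fj]
lemma fj_two (P : ℕ → Polynomial ℝ) (n : ℕ) (θ : ℝ) : fj P 2 n θ = ej P n θ := by simp [fj]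

namespace JSys
variable {α β : ℝ} {P : ℕ → Polynomial ℝ}

lemma sumB (S : JSys α β P) : ∃ Q : ℕ, ∃ C > 0, ∀ θ ∈ Ioo 0 π, ∀ R, 0 < R → R ≤ π → ∀ k ≤ 2,
    Summable (fun n : ℕ => ((1 + R * n) ^ Q)⁻¹ * fj P k n θ ^ 2) ∧
    jV α β θ R * (R ^ (2 * k) * ∑' n : ℕ, ((1 + R * n) ^ Q)⁻¹ * fj P k n θ ^ 2) ≤ C := by
  obtain ⟨κ, hκ, hκ1, C, hC, H⟩ := S.chr
  have hpi := Real.pi_pos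
  have hpk : 1 ≤ π / κ := by rw [one_le_div hκ]; linarith [Real.pi_gt_three]
  set Z := ∑' k : ℕ, (((k : ℝ) + 1) ^ 2)⁻¹ with hZ
  have hZ0 : 0 ≤ Z := tsum_nonneg fun k => by positivity
  set A := C * (π / κ) ^ (⌈jD α β⌉₊ + 4) * Z + 1 with hA
  have hA0 : 0 < A := by positivity
  refine ⟨⌈jD α β⌉₊ + 4 + 2, A, hA0, ?_⟩
  intro θ hθ R hR hRπ k hk
  set Q := ⌈jD α β⌉₊ + 4 + 2
  have hV := jV_pos α β hθ hR
  have hfin : ∀ T : ℕ, jV α β θ R * (R ^ (2 * k) * ∑ n ∈ Finset.range T, ((1 + R * n) ^ Q)⁻¹ * fj P k n θ ^ 2) ≤ A := by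
    intro T
    have := weighted_sum (α := α) (β := β) hκ hκ1 hC hθ (2 * k) (fun n => fj P k n θ ^ 2)
      (fun n => sq_nonneg _) ?_ Q (by simp only [Q]; omega) R hR hRπ T
    · refine this.trans ?_
      rw [hA]
      have : C * (π / κ) ^ (⌈jD α β⌉₊ + 2 * k) * Z ≤ C * (π / κ) ^ (⌈jD α β⌉₊ + 4) * Z := by
        gcongr
        omega
      linarith
    · intro r hr hrκ T hT
      obtain ⟨a, b, c⟩ := H θ hθ r hr hrκ T hT
      interval_cases k
      · simpa [fj] using a
      · simpa [fj] using b
      · simpa [fj] using c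
  have h0 : ∀ n : ℕ, 0 ≤ ((1 + R * n) ^ Q)⁻¹ * fj P k n θ ^ 2 := fun n => by positivity
  have hfin' : ∀ T : ℕ, ∑ n ∈ Finset.range T, ((1 + R * n) ^ Q)⁻¹ * fj P k n θ ^ 2 ≤
      A / (jV α β θ R * R ^ (2 * k)) := by
    intro T
    rw [le_div_iff₀ (by positivity)]
    calc _ = _ := by ring
      _ ≤ _ := hfin T
  have hs := summable_of_sum_range_le h0 hfin'
  refine ⟨hs, ?_⟩
  have := Real.tsum_le_of_sum_range_le h0 hfin'
  rw [le_div_iff₀ (by positivity)] at this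
  calc _ = _ := by ring
    _ ≤ _ := this

lemma sumAB (S : JSys α β P) : ∃ Q : ℕ, ∃ C > 0, ∀ θ ∈ Ioo 0 π, ∀ φ ∈ Ioo 0 π, ∀ R, 0 < R → R ≤ π →
    |θ - φ| ≤ R → ∀ k ≤ 2, ∀ l ≤ 2, ∀ (c : ℕ → ℝ) (A : ℝ),
    (∀ n : ℕ, |c n| ≤ A * ((1 + R * n) ^ Q)⁻¹) →
    Summable (fun n : ℕ => c n * (fj P k n θ * fj P l n φ)) ∧
    jV α β θ R * (R ^ (k + l) * |∑' n : ℕ, c n * (fj P k n θ * fj P l n φ)|) ≤ C * A := by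
  obtain ⟨Q, C, hC, H⟩ := S.sumB
  have hD : 0 < (2 : ℝ) ^ jD α β := Real.rpow_pos_of_pos (by positivity) _
  set D := (2 : ℝ) ^ jD α β
  refine ⟨Q, C * (1 + D), by positivity, ?_⟩
  intro θ hθ φ hφ R hR hRπ hd k hk l hl c A hc
  have hA : 0 ≤ A := by
    have := (abs_nonneg _).trans (hc 0)
    simpa using this
  obtain ⟨s1, t1⟩ := H θ hθ R hR hRπ k hk
  obtain ⟨s2, t2⟩ := H φ hφ R hR hRπ l hl
  have hV := jV_pos α β hθ hR
  have hVφ := jV_pos α β hφ hR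
  have hnear : jV α β θ R ≤ D * jV α β φ R := jV_near hθ hφ hR hd
  set f := fun n : ℕ => ((1 + R * n) ^ Q)⁻¹ * fj P k n θ ^ 2 with hf
  set g := fun n : ℕ => ((1 + R * n) ^ Q)⁻¹ * fj P l n φ ^ 2 with hg
  have hpt : ∀ n, R ^ (k + l) * ‖c n * (fj P k n θ * fj P l n φ)‖ ≤ A * (R ^ (2 * k) * f n) + A * (R ^ (2 * l) * g n) := by
    intro n
    have e1 : |R ^ k * fj P k n θ * (R ^ l * fj P l n φ)| ≤ (R ^ k * fj P k n θ) ^ 2 + (R ^ l * fj P l n φ) ^ 2 := by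
      rw [abs_le]; constructor <;> nlinarith [sq_nonneg (R ^ k * fj P k n θ + (R ^ l * fj P l n φ)), sq_nonneg (R ^ k * fj P k n θ - (R ^ l * fj P l n φ)), sq_nonneg (R ^ k * fj P k n θ), sq_nonneg (R ^ l * fj P l n φ)]
    have hw : 0 ≤ ((1 + R * (n : ℝ)) ^ Q)⁻¹ := by positivity
    calc R ^ (k + l) * ‖c n * (fj P k n θ * fj P l n φ)‖
        = |c n| * |R ^ k * fj P k n θ * (R ^ l * fj P l n φ)| := by
          rw [Real.norm_eq_abs, abs_mul, ← abs_of_pos (pow_pos hR (k + l)), mul_left_comm, ← abs_mul, pow_add]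
          congr 2; ring
      _ ≤ (A * ((1 + R * n) ^ Q)⁻¹) * ((R ^ k * fj P k n θ) ^ 2 + (R ^ l * fj P l n φ) ^ 2) := by
          gcongr
          exact hc n
      _ = _ := by simp only [hf, hg]; ring
  have sR := ((s1.mul_left (R ^ (2 * k))).mul_left A).add ((s2.mul_left (R ^ (2 * l))).mul_left A)
  have hRkl : 0 < R ^ (k + l) := by positivity
  have sN : Summable fun n => R ^ (k + l) * ‖c n * (fj P k n θ * fj P l n φ)‖ :=
    Summable.of_nonneg_of_le (fun n => by positivity) hpt sR
  have sN' : Summable fun n => ‖c n * (fj P k n θ * fj P l n φ)‖ := by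
    rwa [summable_mul_left_iff hRkl.ne'] at sN
  refine ⟨sN'.of_norm, ?_⟩
  have h3 : R ^ (k + l) * |∑' n : ℕ, c n * (fj P k n θ * fj P l n φ)| ≤
      A * (R ^ (2 * k) * ∑' n, f n) + A * (R ^ (2 * l) * ∑' n, g n) := by
    calc _ ≤ R ^ (k + l) * ∑' n : ℕ, ‖c n * (fj P k n θ * fj P l n φ)‖ := by
          gcongr; exact norm_tsum_le_tsum_norm sN'
      _ = ∑' n : ℕ, R ^ (k + l) * ‖c n * (fj P k n θ * fj P l n φ)‖ := by rw [tsum_mul_left]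
      _ ≤ ∑' n, (A * (R ^ (2 * k) * f n) + A * (R ^ (2 * l) * g n)) := sN.tsum_le_tsum hpt sR
      _ = _ := by
        rw [Summable.tsum_add ((s1.mul_left _).mul_left _) ((s2.mul_left _).mul_left _)]
        simp only [tsum_mul_left]
  have hg0 : 0 ≤ R ^ (2 * l) * ∑' n, g n := mul_nonneg (by positivity) (tsum_nonneg fun n => by simp only [hg]; positivity)
  calc _ ≤ jV α β θ R * (A * (R ^ (2 * k) * ∑' n, f n) + A * (R ^ (2 * l) * ∑' n, g n)) := by gcongr
    _ = A * (jV α β θ R * (R ^ (2 * k) * ∑' n, f n)) + A * (jV α β θ R * (R ^ (2 * l) * ∑' n, g n)) := by ring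
    _ ≤ A * C + A * (D * jV α β φ R * (R ^ (2 * l) * ∑' n, g n)) := by gcongr
    _ = A * C + A * D * (jV α β φ R * (R ^ (2 * l) * ∑' n, g n)) := by ring
    _ ≤ A * C + A * D * C := by gcongr
    _ = _ := by ring

lemma poly_bound (S : JSys α β P) : ∃ Q : ℕ, ∃ C > 0, ∀ θ ∈ Ioo 0 π, ∀ k ≤ 2, ∀ n : ℕ,
    |fj P k n θ| ≤ C * (1 + (n : ℝ)) ^ Q := by
  obtain ⟨Q, C, hC, H⟩ := S.sumB
  obtain ⟨c, hc, hl⟩ := jV_lower α β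
  refine ⟨Q, 1 + C / c, by positivity, ?_⟩
  intro θ hθ k hk n
  obtain ⟨s1, t1⟩ := H θ hθ 1 one_pos (by linarith [Real.pi_gt_three]) k hk
  have hv := hl θ hθ 1 one_pos (by linarith [Real.pi_gt_three])
  rw [Real.one_rpow, mul_one] at hv
  have h1 := s1.le_tsum n fun m _ => by positivity
  simp only [one_mul, one_pow] at h1 t1
  have hs0 : 0 ≤ ∑' n : ℕ, ((1 + (n : ℝ)) ^ Q)⁻¹ * fj P k n θ ^ 2 := tsum_nonneg fun n => by positivity
  have h2 : ∑' n : ℕ, ((1 + (n : ℝ)) ^ Q)⁻¹ * fj P k n θ ^ 2 ≤ C / c := by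
    rw [le_div_iff₀ hc]
    nlinarith
  have hx : (1 : ℝ) ≤ (1 + (n : ℝ)) ^ Q := one_le_pow₀ (by have : (0 : ℝ) ≤ n := Nat.cast_nonneg n
                                                           linarith)
  have h3 : fj P k n θ ^ 2 ≤ C / c * (1 + (n : ℝ)) ^ Q := by
    have := h1.trans h2
    rwa [inv_mul_eq_div, div_le_iff₀ (by positivity)] at this
  have hq : 0 < C / c := by positivity
  refine abs_le_of_sq_le_sq ?_ (by positivity)
  have : C / c * (1 + (n : ℝ)) ^ Q ≤ (1 + C / c) ^ 2 * ((1 + (n : ℝ)) ^ Q) ^ 2 := by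
    have : C / c ≤ (1 + C / c) ^ 2 := by nlinarith
    have : (1 + (n : ℝ)) ^ Q ≤ ((1 + (n : ℝ)) ^ Q) ^ 2 := by nlinarith
    gcongr
  rw [mul_pow]; linarith
end JSys

/-! ### Finite propagation speed -/

lemma jW_deriv_int {α β : ℝ} (hα : -1 < α) (hβ : -1 < β) {G G' : ℝ → ℝ → ℝ}
    (hG : ∀ s, Continuous (G s)) (hG' : Continuous (Function.uncurry G'))
    (hd : ∀ s θ, HasDerivAt (fun s => G s θ) (G' s θ) s) (s₀ : ℝ) :
    HasDerivAt (fun s => ∫ θ in 0..π, jW α β θ * G s θ)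
      (∫ θ in 0..π, jW α β θ * G' s₀ θ) s₀ := by
  have hG's : ∀ s, Continuous (G' s) := fun s => hG'.comp (by fun_prop : Continuous fun θ => (s, θ))
  obtain ⟨C, hC⟩ := ((isCompact_Icc (a := s₀ - 1) (b := s₀ + 1)).prod
    (isCompact_Icc (a := (0 : ℝ)) (b := π))).exists_bound_of_continuousOn hG'.continuousOn
  have hnb : Icc (s₀ - 1) (s₀ + 1) ∈ nhds s₀ := Icc_mem_nhds (by linarith) (by linarith)
  refine (intervalIntegral.hasDerivAt_integral_of_dominated_loc_of_deriv_le
    (F := fun s θ => jW α β θ * G s θ) (F' := fun s θ => jW α β θ * G' s θ)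
    (bound := fun θ => jW α β θ * C) hnb ?_ (jW_mul_int hα hβ (hG s₀)) ?_ ?_ ?_ ?_).2
  · exact Filter.Eventually.of_forall fun s =>
      ((jW_measurable α β).mul (hG s).measurable).aestronglyMeasurable
  · exact ((jW_measurable α β).mul (hG's s₀).measurable).aestronglyMeasurable
  · refine Filter.Eventually.of_forall fun θ hθ s hs => ?_
    rw [uIoc_of_le Real.pi_pos.le] at hθ
    have hθ' : θ ∈ Icc 0 π := ⟨hθ.1.le, hθ.2⟩
    rw [norm_mul, Real.norm_eq_abs, abs_of_nonneg (jW_nonneg α β hθ')]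
    exact mul_le_mul_of_nonneg_left (hC (s, θ) ⟨hs, hθ'⟩) (jW_nonneg α β hθ')
  · exact (jW_int hα hβ).mul_const C
  · exact Filter.Eventually.of_forall fun θ _ s _ => (hd s θ).const_mul _

/-- truncated square -/
def tsq (x : ℝ) : ℝ := max 0 x ^ 2

lemma tsq_hasDerivAt (x : ℝ) : HasDerivAt tsq (2 * max 0 x) x := by
  rcases lt_trichotomy x 0 with h | h | h
  · have : tsq =ᶠ[nhds x] fun _ => 0 := by
      filter_upwards [Iio_mem_nhds h] with y hy
      simp [tsq, max_eq_left (le_of_lt (mem_Iio.1 hy))]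
    rw [max_eq_left h.le, mul_zero]
    exact (hasDerivAt_const x (0 : ℝ)).congr_of_eventuallyEq this
  · subst h
    simp only [max_self, mul_zero]
    rw [hasDerivAt_iff_isLittleO]
    simp only [sub_zero, smul_eq_mul, mul_zero]
    have h1 : (fun x => tsq x - tsq 0) =O[nhds 0] fun x : ℝ => x ^ 2 := by
      refine Asymptotics.IsBigO.of_bound 1 (Filter.Eventually.of_forall fun y => ?_)
      simp only [tsq, max_self, Real.norm_eq_abs, one_mul]
      rw [show ((0:ℝ)^2) = 0 by norm_num, sub_zero, abs_of_nonneg (sq_nonneg _),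
        abs_of_nonneg (sq_nonneg _)]
      rcases le_total 0 y with hy | hy
      · rw [max_eq_right hy]
      · rw [max_eq_left hy]; nlinarith
    refine h1.trans_isLittleO ?_
    exact Asymptotics.isLittleO_pow_id (by norm_num)
  · have : tsq =ᶠ[nhds x] fun y => y ^ 2 := by
      filter_upwards [Ioi_mem_nhds h] with y hy
      simp [tsq, max_eq_right (le_of_lt (mem_Ioi.1 hy))]
    rw [max_eq_right h.le]
    refine ((hasDerivAt_pow 2 x).congr_of_eventuallyEq this).congr_deriv ?_
    simp

lemma tsq_continuous : Continuous tsq := by unfold tsq; fun_prop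
lemma tsq_nonneg (x : ℝ) : 0 ≤ tsq x := sq_nonneg _

/-- `sin (s x) / x` -/
def sg (x s : ℝ) : ℝ := if x = 0 then s else Real.sin (s * x) / x

lemma sg_hasDerivAt (x s : ℝ) : HasDerivAt (sg x) (Real.cos (s * x)) s := by
  by_cases h : x = 0
  · subst h
    have : sg 0 = fun s => s := by funext s; simp [sg]
    rw [this]; simpa using hasDerivAt_id' s
  · have : sg x = fun s => Real.sin (s * x) / x := by funext s; simp [sg, h]
    rw [this]
    refine (((hasDerivAt_id s).mul_const x).sin.div_const x).congr_deriv ?_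
    simp only [id]
    field_simp

lemma sg_continuous (x : ℝ) : Continuous (sg x) :=
  continuous_iff_continuousAt.2 fun s => (sg_hasDerivAt x s).continuousAt

lemma cosx_hasDerivAt (x s : ℝ) :
    HasDerivAt (fun s => Real.cos (s * x)) (-(x ^ 2 * sg x s)) s := by
  refine (((hasDerivAt_id s).mul_const x).cos).congr_deriv ?_
  by_cases h : x = 0
  · simp [h]
  · simp only [sg, h, if_false, id]
    field_simp

lemma sg_zero (x : ℝ) : sg x 0 = 0 := by simp [sg]

namespace JSys
variable {α β : ℝ} {P : ℕ → Polynomial ℝ}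

lemma energy (S : JSys α β P) {x : ℕ → ℝ} {l₀ : ℝ} (hl₀ : 0 ≤ l₀)
    (hx : ∀ n, x n ^ 2 = jl α β n + l₀) (F : Finset ℕ) (a : ℕ → ℝ) (b : ℝ) {s : ℝ} (hs : 0 ≤ s) :
    ∫ θ in 0..π, jW α β θ * (tsq (b - s - θ) * (∑ n ∈ F, a n * Real.cos (s * x n) * pj P n θ) ^ 2) ≤
    ∫ θ in 0..π, jW α β θ * (tsq (b - θ) * (∑ n ∈ F, a n * pj P n θ) ^ 2) := by
  set u : ℝ → ℝ → ℝ := fun s θ => ∑ n ∈ F, a n * sg (x n) s * pj P n θ with hu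
  set v : ℝ → ℝ → ℝ := fun s θ => ∑ n ∈ F, a n * Real.cos (s * x n) * pj P n θ with hv
  set w : ℝ → ℝ → ℝ := fun s θ => ∑ n ∈ F, a n * sg (x n) s * dj P n θ with hw
  set y : ℝ → ℝ → ℝ := fun s θ => ∑ n ∈ F, a n * Real.cos (s * x n) * dj P n θ with hy
  set L : ℝ → ℝ → ℝ := fun s θ => ∑ n ∈ F, a n * sg (x n) s * (jl α β n * pj P n θ) with hL
  have cp := fun n => pj_continuous P n
  have cd := fun n => dj_continuous P n
  have cs := fun n => sg_continuous (x n)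
  have cu : Continuous (Function.uncurry u) := by
    refine continuous_finsetSum _ fun n _ => ?_
    exact ((continuous_const.mul ((cs n).comp continuous_fst)).mul ((cp n).comp continuous_snd))
  have cw : Continuous (Function.uncurry w) := by
    refine continuous_finsetSum _ fun n _ => ?_
    exact ((continuous_const.mul ((cs n).comp continuous_fst)).mul ((cd n).comp continuous_snd))
  have cL : Continuous (Function.uncurry L) := by
    refine continuous_finsetSum _ fun n _ => ?_
    exact ((continuous_const.mul ((cs n).comp continuous_fst)).mul
      (continuous_const.mul ((cp n).comp continuous_snd)))
  have cc : ∀ n, Continuous fun s => Real.cos (s * x n) := fun n => by fun_prop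
  have cv : Continuous (Function.uncurry v) := by
    refine continuous_finsetSum _ fun n _ => ?_
    exact ((continuous_const.mul ((cc n).comp continuous_fst)).mul ((cp n).comp continuous_snd))
  have cy : Continuous (Function.uncurry y) := by
    refine continuous_finsetSum _ fun n _ => ?_
    exact ((continuous_const.mul ((cc n).comp continuous_fst)).mul ((cd n).comp continuous_snd))
  have du : ∀ s θ, HasDerivAt (fun s => u s θ) (v s θ) s := fun s θ =>
    HasDerivAt.fun_sum fun n _ => ((sg_hasDerivAt (x n) s).const_mul _).mul_const _
  have dw : ∀ s θ, HasDerivAt (fun s => w s θ) (y s θ) s := fun s θ =>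
    HasDerivAt.fun_sum fun n _ => ((sg_hasDerivAt (x n) s).const_mul _).mul_const _
  have dv : ∀ s θ, HasDerivAt (fun s => v s θ) (-L s θ - l₀ * u s θ) s := fun s θ => by
    have : HasDerivAt (fun s => v s θ) (∑ n ∈ F, a n * (-(x n ^ 2 * sg (x n) s)) * pj P n θ) s :=
      HasDerivAt.fun_sum fun n _ => ((cosx_hasDerivAt (x n) s).const_mul _).mul_const _
    refine this.congr_deriv ?_
    simp only [hL, hu, Finset.mul_sum, ← Finset.sum_neg_distrib, ← Finset.sum_sub_distrib]
    refine Finset.sum_congr rfl fun n _ => ?_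
    rw [hx]; ring
  have dvθ : ∀ s θ, HasDerivAt (v s) (y s θ) θ := fun s θ =>
    HasDerivAt.fun_sum fun n _ => (pj_hasDerivAt P n θ).const_mul _
  set G : ℝ → ℝ → ℝ := fun s θ => tsq (b - s - θ) * (v s θ ^ 2 + w s θ ^ 2 + l₀ * u s θ ^ 2) with hG
  set k : ℝ → ℝ → ℝ := fun s θ => 2 * max 0 (b - s - θ) with hk
  set G' : ℝ → ℝ → ℝ := fun s θ => -k s θ * (v s θ ^ 2 + w s θ ^ 2 + l₀ * u s θ ^ 2) +
    tsq (b - s - θ) * (-2 * v s θ * L s θ + 2 * w s θ * y s θ) with hG'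
  have ck : Continuous (Function.uncurry k) := by
    simp only [hk, Function.uncurry_def]; fun_prop
  have ct' : Continuous (Function.uncurry fun s θ => tsq (b - s - θ)) := by
    exact tsq_continuous.comp (by fun_prop : Continuous fun p : ℝ × ℝ => b - p.1 - p.2)
  have cG : Continuous (Function.uncurry G) :=
    ct'.mul (((cv.pow 2).add (cw.pow 2)).add (continuous_const.mul (cu.pow 2)))
  have cG' : Continuous (Function.uncurry G') :=
    (ck.neg.mul (((cv.pow 2).add (cw.pow 2)).add (continuous_const.mul (cu.pow 2)))).add
      (ct'.mul (((continuous_const.mul cv).mul cL).add ((continuous_const.mul cw).mul cy)))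
  have sl : ∀ {f : ℝ → ℝ → ℝ}, Continuous (Function.uncurry f) → ∀ s, Continuous (f s) :=
    fun hf s => hf.comp (by fun_prop : Continuous fun θ => (s, θ))
  have dG : ∀ s θ, HasDerivAt (fun s => G s θ) (G' s θ) s := fun s θ => by
    have h1 : HasDerivAt (fun s => b - s - θ) (-1) s := by
      simpa using ((hasDerivAt_id s).const_sub b).sub_const θ
    have h2 := (tsq_hasDerivAt (b - s - θ)).comp s h1
    have h3 := (((dv s θ).pow 2).add ((dw s θ).pow 2)).add (((du s θ).pow 2).const_mul l₀)
    refine (h2.mul h3).congr_deriv ?_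
    simp only [hG', hk, Function.comp, Pi.add_apply, Pi.pow_apply]
    push_cast
    ring
  have hE := jW_deriv_int S.hα S.hβ (sl cG) cG' dG
  have hneg : ∀ s, ∫ θ in 0..π, jW α β θ * G' s θ ≤ 0 := by
    intro s
    have hqd : ∀ θ, HasDerivAt (fun θ => tsq (b - s - θ) * v s θ)
        (-k s θ * v s θ + tsq (b - s - θ) * y s θ) θ := fun θ => by
      have h1 : HasDerivAt (fun θ => b - s - θ) (-1) θ := by
        simpa using ((hasDerivAt_id θ).const_sub (b - s))
      refine (((tsq_hasDerivAt (b - s - θ)).comp θ h1).mul (dvθ s θ)).congr_deriv ?_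
      simp only [hk, Function.comp]; ring
    have cq' : Continuous fun θ => -k s θ * v s θ + tsq (b - s - θ) * y s θ :=
      ((sl ck s).neg.mul (sl cv s)).add ((sl ct' s).mul (sl cy s))
    have cq : Continuous fun θ => tsq (b - s - θ) * v s θ := (sl ct' s).mul (sl cv s)
    have key : ∫ θ in 0..π, jW α β θ * (tsq (b - s - θ) * v s θ * L s θ) =
        ∫ θ in 0..π, jW α β θ * (w s θ * (-k s θ * v s θ + tsq (b - s - θ) * y s θ)) := by
      have e1 : ∀ θ, jW α β θ * (tsq (b - s - θ) * v s θ * L s θ) =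
          ∑ n ∈ F, a n * sg (x n) s *
            (jW α β θ * (jl α β n * pj P n θ * (tsq (b - s - θ) * v s θ))) := fun θ => by
        simp only [hL, Finset.mul_sum]
        exact Finset.sum_congr rfl fun n _ => by ring
      have e2 : ∀ θ, jW α β θ * (w s θ * (-k s θ * v s θ + tsq (b - s - θ) * y s θ)) =
          ∑ n ∈ F, a n * sg (x n) s *
            (jW α β θ * (dj P n θ * (-k s θ * v s θ + tsq (b - s - θ) * y s θ))) := fun θ => by
        simp only [hw, Finset.mul_sum, Finset.sum_mul]
        exact Finset.sum_congr rfl fun n _ => by ring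
      simp only [e1, e2]
      rw [intervalIntegral.integral_finsetSum, intervalIntegral.integral_finsetSum]
      · refine Finset.sum_congr rfl fun n _ => ?_
        rw [intervalIntegral.integral_const_mul, intervalIntegral.integral_const_mul,
          S.green n hqd cq']
      · exact fun n _ => (jW_mul_int S.hα S.hβ ((cd n).mul cq')).const_mul _
      · exact fun n _ => (jW_mul_int S.hα S.hβ ((continuous_const.mul (cp n)).mul cq)).const_mul _
    have cA : Continuous fun θ => tsq (b - s - θ) * v s θ * L s θ := cq.mul (sl cL s)
    have cB : Continuous fun θ => w s θ * (-k s θ * v s θ + tsq (b - s - θ) * y s θ) :=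
      (sl cw s).mul cq'
    have cD : Continuous fun θ => k s θ * ((v s θ - w s θ) ^ 2 + l₀ * u s θ ^ 2) :=
      (sl ck s).mul ((((sl cv s).sub (sl cw s)).pow 2).add (continuous_const.mul ((sl cu s).pow 2)))
    have e3 : ∀ θ, jW α β θ * G' s θ = 2 * (jW α β θ *
        (w s θ * (-k s θ * v s θ + tsq (b - s - θ) * y s θ))) -
        2 * (jW α β θ * (tsq (b - s - θ) * v s θ * L s θ)) -
        jW α β θ * (k s θ * ((v s θ - w s θ) ^ 2 + l₀ * u s θ ^ 2)) := fun θ => by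
      simp only [hG']; ring
    simp only [e3]
    have iA := (jW_mul_int S.hα S.hβ cA).const_mul 2
    have iB := (jW_mul_int S.hα S.hβ cB).const_mul 2
    rw [intervalIntegral.integral_sub (iB.sub iA) (jW_mul_int S.hα S.hβ cD),
      intervalIntegral.integral_sub iB iA, intervalIntegral.integral_const_mul,
      intervalIntegral.integral_const_mul, key, sub_self, zero_sub, neg_nonpos]
    have := jW_integral_mono S.hα S.hβ (f := fun _ => 0) continuous_const cD ?_
    · simpa using this
    · intro θ _
      have : 0 ≤ k s θ := by simp [hk]
      positivity
  have hanti : Antitone fun s => ∫ θ in 0..π, jW α β θ * G s θ :=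
    antitone_of_hasDerivAt_nonpos hE hneg
  refine le_trans ?_ ((hanti hs).trans_eq ?_)
  · refine jW_integral_mono S.hα S.hβ ((sl ct' s).mul ((sl cv s).pow 2)) (sl cG s) ?_
    intro θ _
    refine mul_le_mul_of_nonneg_left ?_ (tsq_nonneg _)
    nlinarith [sq_nonneg (w s θ), mul_nonneg hl₀ (sq_nonneg (u s θ))]
  · simp [hG, hu, hv, hw, sg_zero]
end JSys

/-- Rapidly decreasing sequences. -/
def Rapid (F : ℕ → ℝ) : Prop := ∀ Q : ℕ, ∃ B : ℝ, ∀ n : ℕ, |F n| * (1 + (n : ℝ)) ^ Q ≤ B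

lemma summable_inv_sq : Summable fun n : ℕ => ((1 + (n : ℝ)) ^ 2)⁻¹ := by
  have := (summable_nat_add_iff 1).2 (Real.summable_nat_pow_inv.2 (by norm_num : 1 < 2))
  refine this.congr fun n => ?_
  push_cast
  rw [add_comm]

lemma Rapid.summable {F : ℕ → ℝ} (h : Rapid F) (Q : ℕ) :
    Summable fun n : ℕ => |F n| * (1 + (n : ℝ)) ^ Q := by
  obtain ⟨B, hB⟩ := h (Q + 2)
  refine Summable.of_nonneg_of_le (fun n => by positivity) (fun n => ?_)
    (summable_inv_sq.mul_left B)
  have hp : (0 : ℝ) < (1 + (n : ℝ)) ^ 2 := by positivity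
  rw [← div_eq_mul_inv, le_div_iff₀ hp, mul_assoc, ← pow_add]
  exact hB n

lemma Rapid.mul_poly {F g : ℕ → ℝ} (h : Rapid F) {C : ℝ} {Q : ℕ}
    (hg : ∀ n : ℕ, |g n| ≤ C * (1 + (n : ℝ)) ^ Q) : Rapid fun n => F n * g n := by
  intro R
  obtain ⟨B, hB⟩ := h (Q + R)
  refine ⟨C * B, fun n => ?_⟩
  have hp : (0 : ℝ) < (1 + (n : ℝ)) ^ Q := by positivity
  have hC : 0 ≤ C := by
    by_contra hc
    have := (abs_nonneg _).trans (hg n)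
    nlinarith
  calc |F n * g n| * (1 + (n : ℝ)) ^ R = |g n| * (|F n| * (1 + (n : ℝ)) ^ R) := by
        rw [abs_mul]; ring
    _ ≤ (C * (1 + (n : ℝ)) ^ Q) * (|F n| * (1 + (n : ℝ)) ^ R) :=
        mul_le_mul_of_nonneg_right (hg n) (by positivity)
    _ = C * (|F n| * (1 + (n : ℝ)) ^ (Q + R)) := by rw [pow_add]; ring
    _ ≤ C * B := mul_le_mul_of_nonneg_left (hB n) hC

/-- Jacobi coefficients. -/
def jc (α β : ℝ) (P : ℕ → Polynomial ℝ) (f : ℝ → ℝ) (n : ℕ) : ℝ :=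
  ∫ θ in 0..π, jW α β θ * (f θ * pj P n θ)

namespace JSys
variable {α β : ℝ} {P : ℕ → Polynomial ℝ}

lemma pj_bound (S : JSys α β P) : ∃ Q : ℕ, ∃ C > 0, ∀ (θ : ℝ) (n : ℕ),
    |pj P n θ| ≤ C * (1 + (n : ℝ)) ^ Q := by
  obtain ⟨Q, C, hC, H⟩ := S.poly_bound
  refine ⟨Q, C, hC, fun θ n => ?_⟩
  have hcl : IsClosed {θ | |pj P n θ| ≤ C * (1 + (n : ℝ)) ^ Q} :=
    isClosed_le (pj_continuous P n).abs continuous_const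
  have hsub : Icc 0 π ⊆ {θ | |pj P n θ| ≤ C * (1 + (n : ℝ)) ^ Q} := by
    rw [← closure_Ioo Real.pi_pos.ne]
    refine closure_minimal (fun θ hθ => ?_) hcl
    have := H θ hθ 0 (by norm_num) n
    rwa [fj_zero] at this
  have : pj P n θ = pj P n (Real.arccos (Real.cos θ)) := by
    unfold pj
    rw [Real.cos_arccos (Real.neg_one_le_cos θ) (Real.cos_le_one θ)]
  rw [this]
  exact hsub ⟨Real.arccos_nonneg _, Real.arccos_le_pi _⟩

lemma span (S : JSys α β P) : ∀ (N : ℕ) (p : Polynomial ℝ), p.degree < N →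
    ∃ b : ℕ → ℝ, p = ∑ n ∈ Finset.range N, Polynomial.C (b n) * P n := by
  intro N
  induction N with
  | zero =>
    intro p hp
    refine ⟨0, ?_⟩
    have : p.degree = ⊥ := by simpa [Nat.WithBot.lt_zero_iff] using hp
    simpa using this
  | succ N ih =>
    intro p hp
    have hlc : (P N).coeff N ≠ 0 := by
      have hnd : (P N).natDegree = N := Polynomial.natDegree_eq_of_degree_eq_some (S.deg N)
      have h0 : P N ≠ 0 := by
        intro h; have := S.deg N; rw [h] at this; simp at this
      have := Polynomial.leadingCoeff_ne_zero.2 h0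
      rwa [Polynomial.leadingCoeff, hnd] at this
    have hd : (p - Polynomial.C (p.coeff N / (P N).coeff N) * P N).degree < N := by
      rw [Polynomial.degree_lt_iff_coeff_zero] at hp ⊢
      intro m hm
      rw [Polynomial.coeff_sub, Polynomial.coeff_C_mul]
      rcases Nat.eq_or_lt_of_le hm with h | h
      · subst h; field_simp; ring
      · have h0 : (P N).coeff m = 0 := by
          apply Polynomial.coeff_eq_zero_of_degree_lt
          rw [S.deg]; exact_mod_cast h
        rw [hp m h, h0]; ring
    obtain ⟨b, hb⟩ := ih _ hd
    refine ⟨fun n => if n = N then p.coeff N / (P N).coeff N else b n, ?_⟩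
    rw [Finset.sum_range_succ]
    simp only [if_pos]
    rw [sub_eq_iff_eq_add] at hb
    conv_lhs => rw [hb]
    congr 1
    refine Finset.sum_congr rfl fun n hn => ?_
    rw [if_neg (Finset.mem_range.1 hn).ne]

lemma best (S : JSys α β P) {f : ℝ → ℝ} (hf : Continuous f) (F : Finset ℕ) (b : ℕ → ℝ) :
    ∫ θ in 0..π, jW α β θ * (f θ - ∑ n ∈ F, b n * pj P n θ) ^ 2 =
    (∫ θ in 0..π, jW α β θ * f θ ^ 2) - ∑ n ∈ F, jc α β P f n ^ 2 +
      ∑ n ∈ F, (jc α β P f n - b n) ^ 2 := by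
  have cp := fun n => pj_continuous P n
  have e : ∀ θ, jW α β θ * (f θ - ∑ n ∈ F, b n * pj P n θ) ^ 2 =
      jW α β θ * f θ ^ 2 + jW α β θ * (∑ n ∈ F, b n * pj P n θ) ^ 2 -
      ∑ n ∈ F, 2 * b n * (jW α β θ * (f θ * pj P n θ)) := fun θ => by
    have : ∑ n ∈ F, 2 * b n * (jW α β θ * (f θ * pj P n θ)) =
        2 * jW α β θ * f θ * ∑ n ∈ F, b n * pj P n θ := by
      rw [Finset.mul_sum]; exact Finset.sum_congr rfl fun n _ => by ring
    rw [this]; ring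
  have i1 := jW_mul_int S.hα S.hβ (g := fun θ => f θ ^ 2) (hf.pow 2)
  have i2 := jW_mul_int S.hα S.hβ (g := fun θ => (∑ n ∈ F, b n * pj P n θ) ^ 2)
    ((continuous_finsetSum _ fun n _ => (cp n).const_mul (b n)).pow 2)
  have i3 : ∀ n ∈ F, IntervalIntegrable (fun θ => 2 * b n * (jW α β θ * (f θ * pj P n θ)))
      volume 0 π := fun n _ => (jW_mul_int S.hα S.hβ (hf.mul (cp n))).const_mul _
  have i4 : IntervalIntegrable (fun θ => ∑ n ∈ F, 2 * b n * (jW α β θ * (f θ * pj P n θ)))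
      volume 0 π := by
    have := jW_mul_int S.hα S.hβ (g := fun θ => ∑ n ∈ F, 2 * b n * (f θ * pj P n θ))
      (continuous_finsetSum _ fun n _ => continuous_const.mul (hf.mul (cp n)))
    refine this.congr fun θ _ => ?_
    simp only [Finset.mul_sum]
    exact Finset.sum_congr rfl fun n _ => by ring
  simp only [e]
  rw [intervalIntegral.integral_sub (i1.add i2) i4, intervalIntegral.integral_add i1 i2,
    intervalIntegral.integral_finsetSum i3, S.parseval]
  simp only [intervalIntegral.integral_const_mul]
  have : ∑ n ∈ F, (jc α β P f n - b n) ^ 2 = ∑ n ∈ F, jc α β P f n ^ 2 + ∑ n ∈ F, b n ^ 2 -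
      ∑ n ∈ F, 2 * b n * jc α β P f n := by
    rw [← Finset.sum_add_distrib, ← Finset.sum_sub_distrib]
    exact Finset.sum_congr rfl fun n _ => by ring
  rw [this]
  simp only [jc]
  ring

lemma jW_int_nonneg (S : JSys α β P) {g : ℝ → ℝ} (hg : Continuous g) (h : ∀ θ ∈ Ioo 0 π, 0 ≤ g θ) :
    0 ≤ ∫ θ in 0..π, jW α β θ * g θ := by
  simpa using jW_integral_mono S.hα S.hβ (f := fun _ => 0) continuous_const hg h

lemma bessel (S : JSys α β P) {f : ℝ → ℝ} (hf : Continuous f) (F : Finset ℕ) :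
    ∑ n ∈ F, jc α β P f n ^ 2 ≤ ∫ θ in 0..π, jW α β θ * f θ ^ 2 := by
  have h := S.best hf F (jc α β P f)
  have := S.jW_int_nonneg (g := fun θ => (f θ - ∑ n ∈ F, jc α β P f n * pj P n θ) ^ 2)
    ((hf.sub (continuous_finsetSum _ fun n _ => (pj_continuous P n).const_mul _)).pow 2)
    (fun θ _ => sq_nonneg _)
  simp at h
  linarith

lemma jc_sq_summable (S : JSys α β P) {f : ℝ → ℝ} (hf : Continuous f) :
    Summable fun n => jc α β P f n ^ 2 :=
  summable_of_sum_le (fun n => sq_nonneg _) (S.bessel hf)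

lemma jc_bound (S : JSys α β P) {f : ℝ → ℝ} (hf : Continuous f) :
    ∃ C : ℝ, ∀ n, |jc α β P f n| ≤ C := by
  refine ⟨1 + ∫ θ in 0..π, jW α β θ * f θ ^ 2, fun n => ?_⟩
  have := S.bessel hf {n}
  rw [Finset.sum_singleton, ← sq_abs] at this
  nlinarith [sq_nonneg (|jc α β P f n| - 1), abs_nonneg (jc α β P f n)]

lemma jc_mul_summable (S : JSys α β P) {f h : ℝ → ℝ} (hf : Continuous f) (hh : Continuous h) :
    Summable fun n => |jc α β P f n * jc α β P h n| := by
  refine Summable.of_nonneg_of_le (fun n => abs_nonneg _) (fun n => ?_)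
    ((S.jc_sq_summable hf).add (S.jc_sq_summable hh))
  rw [abs_mul]
  nlinarith [sq_nonneg (|jc α β P f n| - |jc α β P h n|), sq_abs (jc α β P f n),
    sq_abs (jc α β P h n), mul_nonneg (abs_nonneg (jc α β P f n)) (abs_nonneg (jc α β P h n))]

/-- Completeness in `L²`. -/
lemma complete (S : JSys α β P) {f : ℝ → ℝ} (hf : Continuous f) {ε : ℝ} (hε : 0 < ε) :
    ∃ T₀ : ℕ, ∀ T ≥ T₀,
      ∫ θ in 0..π, jW α β θ * (f θ - ∑ n ∈ Finset.range T, jc α β P f n * pj P n θ) ^ 2 ≤ ε := by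
  set m := ∫ θ in 0..π, jW α β θ with hm
  have hm0 : 0 ≤ m := by
    have := S.jW_int_nonneg (g := fun _ => 1) continuous_const (fun _ _ => zero_le_one)
    simpa using this
  set η := ε / (1 + m) with hη
  have hη0 : 0 < η := by positivity
  obtain ⟨p, hp⟩ := exists_polynomial_near_of_continuousOn (-1) 1 (fun x => f (Real.arccos x))
    (hf.comp Real.continuous_arccos).continuousOn (Real.sqrt η) (Real.sqrt_pos.2 hη0)
  obtain ⟨b, hb⟩ := S.span (p.natDegree + 1) p
    ((Polynomial.degree_le_natDegree).trans_lt (by exact_mod_cast Nat.lt_succ_self _))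
  refine ⟨p.natDegree + 1, fun T hT => ?_⟩
  set b' : ℕ → ℝ := fun n => if n < p.natDegree + 1 then b n else 0 with hb'
  have hpe : ∀ θ, ∑ n ∈ Finset.range T, b' n * pj P n θ = p.eval (Real.cos θ) := by
    intro θ
    conv_rhs => rw [hb]
    rw [Polynomial.eval_finsetSum]
    have hsub : Finset.range (p.natDegree + 1) ⊆ Finset.range T := Finset.range_mono hT
    rw [← Finset.sum_subset hsub]
    · refine Finset.sum_congr rfl fun n hn => ?_
      simp only [hb', if_pos (Finset.mem_range.1 hn), pj, Polynomial.eval_mul, Polynomial.eval_C]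
    · intro n _ hn
      rw [Finset.mem_range] at hn
      simp only [hb', if_neg hn, zero_mul]
  have h1 := S.best hf (Finset.range T) (jc α β P f)
  have h2 := S.best hf (Finset.range T) b'
  have h3 : 0 ≤ ∑ n ∈ Finset.range T, (jc α β P f n - b' n) ^ 2 :=
    Finset.sum_nonneg fun n _ => sq_nonneg _
  have h4 : ∫ θ in 0..π, jW α β θ * (f θ - ∑ n ∈ Finset.range T, b' n * pj P n θ) ^ 2 ≤
      ∫ θ in 0..π, jW α β θ * η := by
    refine jW_integral_mono S.hα S.hβ ?_ continuous_const ?_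
    · exact (hf.sub (continuous_finsetSum _ fun n _ => (pj_continuous P n).const_mul _)).pow 2
    · intro θ hθ
      have := hp (Real.cos θ) ⟨Real.neg_one_le_cos θ, Real.cos_le_one θ⟩
      rw [Real.arccos_cos hθ.1.le hθ.2.le] at this
      rw [hpe, ← sq_abs, abs_sub_comm]
      calc |p.eval (Real.cos θ) - f θ| ^ 2 ≤ Real.sqrt η ^ 2 :=
            pow_le_pow_left₀ (abs_nonneg _) this.le 2
        _ = η := Real.sq_sqrt hη0.le
  rw [intervalIntegral.integral_mul_const, ← hm] at h4
  have h5 : m * η ≤ ε := by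
    rw [hη, ← mul_div_assoc, div_le_iff₀ (by positivity)]
    nlinarith
  simp only [sub_self, ne_eq, OfNat.ofNat_ne_zero, not_false_eq_true, zero_pow,
    Finset.sum_const_zero, add_zero] at h1
  linarith

/-- Finite propagation speed, weak form. -/
lemma propag (S : JSys α β P) {x : ℕ → ℝ} {l₀ : ℝ} (hl₀ : 0 ≤ l₀)
    (hx : ∀ n, x n ^ 2 = jl α β n + l₀) {f h : ℝ → ℝ} (hf : Continuous f) (hh : Continuous h)
    {b c s : ℝ} (hfb : ∀ θ, θ ≤ b → f θ = 0) (hhc : ∀ θ, c ≤ θ → h θ = 0) (hs : |s| < b - c) :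
    HasSum (fun n => Real.cos (s * x n) * (jc α β P f n * jc α β P h n)) 0 := by
  wlog hs0 : 0 ≤ s generalizing s with H
  · have := H (s := -s) (by rwa [abs_neg]) (by linarith)
    simpa using this
  rw [abs_of_nonneg hs0] at hs
  have hsum : Summable (fun n => Real.cos (s * x n) * (jc α β P f n * jc α β P h n)) := by
    refine Summable.of_norm_bounded (S.jc_mul_summable hf hh) fun n => ?_
    rw [norm_mul, Real.norm_eq_abs, Real.norm_eq_abs]
    exact mul_le_of_le_one_left (abs_nonneg _) (Real.abs_cos_le_one _)
  have hT := hsum.hasSum.tendsto_sum_nat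
  suffices hlim : Filter.Tendsto (fun T => ∑ n ∈ Finset.range T,
      Real.cos (s * x n) * (jc α β P f n * jc α β P h n)) Filter.atTop (nhds 0) by
    have := tendsto_nhds_unique hT hlim
    rw [← this]; exact hsum.hasSum
  rw [Metric.tendsto_atTop]
  intro δ' hδ'
  set δ := δ' / 2 with hδdef
  have hδ : 0 < δ := by positivity
  set κ := (b - c - s) ^ 2 with hκ
  have hκ0 : 0 < κ := by have : 0 < b - c - s := by linarith
                         positivity
  set Kh := ∫ θ in 0..π, jW α β θ * h θ ^ 2 with hKh
  have hKh0 : 0 ≤ Kh := S.jW_int_nonneg (hh.pow 2) fun θ _ => sq_nonneg _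
  set ε := δ * κ / (Kh + 1) with hεd
  have hε : 0 < ε := by positivity
  set η := δ * ε / (b ^ 2 + 1) with hηd
  have hη : 0 < η := by positivity
  obtain ⟨T₀, hT₀⟩ := S.complete hf hη
  refine ⟨T₀, fun T hTT => ?_⟩
  set v : ℝ → ℝ := fun θ => ∑ n ∈ Finset.range T, jc α β P f n * Real.cos (s * x n) * pj P n θ with hv
  have cv : Continuous v := continuous_finsetSum _ fun n _ => (pj_continuous P n).const_mul _
  have hvh : ∑ n ∈ Finset.range T, Real.cos (s * x n) * (jc α β P f n * jc α β P h n) =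
      ∫ θ in 0..π, jW α β θ * (v θ * h θ) := by
    have e : ∀ θ, jW α β θ * (v θ * h θ) = ∑ n ∈ Finset.range T,
        jc α β P f n * Real.cos (s * x n) * (jW α β θ * (h θ * pj P n θ)) := fun θ => by
      simp only [hv, Finset.sum_mul, Finset.mul_sum]
      exact Finset.sum_congr rfl fun n _ => by ring
    simp only [e]
    rw [intervalIntegral.integral_finsetSum]
    · refine Finset.sum_congr rfl fun n _ => ?_
      rw [intervalIntegral.integral_const_mul, ← jc]; ring
    · exact fun n _ => (jW_mul_int S.hα S.hβ (hh.mul (pj_continuous P n))).const_mul _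
  have ctq : Continuous fun θ => tsq (b - s - θ) := tsq_continuous.comp (by fun_prop)
  have ctq0 : Continuous fun θ => tsq (b - θ) := tsq_continuous.comp (by fun_prop)
  have cfT : Continuous fun θ => ∑ n ∈ Finset.range T, jc α β P f n * pj P n θ :=
    continuous_finsetSum _ fun n _ => (pj_continuous P n).const_mul _
  have hE := S.energy hl₀ hx (Finset.range T) (jc α β P f) b hs0
  have hE0 : ∫ θ in 0..π, jW α β θ *
      (tsq (b - θ) * (∑ n ∈ Finset.range T, jc α β P f n * pj P n θ) ^ 2) ≤ b ^ 2 * η := by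
    refine le_trans ?_ (mul_le_mul_of_nonneg_left (hT₀ T hTT) (sq_nonneg b))
    rw [← intervalIntegral.integral_const_mul]
    have : ∀ θ, b ^ 2 * (jW α β θ * (f θ - ∑ n ∈ Finset.range T, jc α β P f n * pj P n θ) ^ 2) =
      jW α β θ * (b ^ 2 * (f θ - ∑ n ∈ Finset.range T, jc α β P f n * pj P n θ) ^ 2) :=
      fun θ => by ring
    simp only [this]
    refine jW_integral_mono S.hα S.hβ (ctq0.mul (cfT.pow 2))
      (continuous_const.mul ((hf.sub cfT).pow 2)) ?_
    intro θ hθ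
    rcases le_total θ b with h1 | h1
    · rw [hfb θ h1, zero_sub, neg_sq]
      refine mul_le_mul_of_nonneg_right ?_ (sq_nonneg _)
      rw [tsq, max_eq_right (by linarith)]
      exact pow_le_pow_left₀ (by linarith) (by linarith [hθ.1]) 2
    · rw [tsq, max_eq_left (by linarith)]
      simp only [ne_eq, OfNat.ofNat_ne_zero, not_false_eq_true, zero_pow, zero_mul]
      positivity
  have hpt : ∀ θ ∈ Ioo 0 π, |v θ * h θ| ≤
      (1 / (2 * ε)) * (tsq (b - s - θ) * v θ ^ 2) + (ε / (2 * κ)) * h θ ^ 2 := by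
    intro θ hθ
    have ht := tsq_nonneg (b - s - θ)
    rcases le_total c θ with h1 | h1
    · rw [hhc θ h1]; simp only [mul_zero, abs_zero]; positivity
    · have hk : κ ≤ tsq (b - s - θ) := by
        rw [tsq, max_eq_right (by linarith), hκ]
        exact pow_le_pow_left₀ (by linarith) (by linarith) 2
      have hk2 : (1 / (2 * ε)) * (κ * v θ ^ 2) ≤ (1 / (2 * ε)) * (tsq (b - s - θ) * v θ ^ 2) :=
        mul_le_mul_of_nonneg_left (mul_le_mul_of_nonneg_right hk (sq_nonneg _)) (by positivity)
      refine le_trans ?_ (add_le_add_left hk2 _)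
      have : (1 / (2 * ε)) * (κ * v θ ^ 2) + (ε / (2 * κ)) * h θ ^ 2 - |v θ * h θ| =
          (κ * |v θ| - ε * |h θ|) ^ 2 / (2 * ε * κ) := by
        rw [abs_mul, ← sq_abs (v θ), ← sq_abs (h θ)]
        field_simp
        ring
      have h2 : 0 ≤ (κ * |v θ| - ε * |h θ|) ^ 2 / (2 * ε * κ) := by positivity
      linarith
  have cbd : Continuous fun θ =>
      (1 / (2 * ε)) * (tsq (b - s - θ) * v θ ^ 2) + (ε / (2 * κ)) * h θ ^ 2 :=
    (continuous_const.mul (ctq.mul (cv.pow 2))).add (continuous_const.mul (hh.pow 2))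
  have hup := jW_integral_mono S.hα S.hβ (cv.mul hh) cbd
    (fun θ hθ => (le_abs_self _).trans (hpt θ hθ))
  have hlo := jW_integral_mono S.hα S.hβ (cv.mul hh).neg cbd
    (fun θ hθ => (neg_le_abs _).trans (hpt θ hθ))
  have hbd : ∫ θ in 0..π, jW α β θ *
      ((1 / (2 * ε)) * (tsq (b - s - θ) * v θ ^ 2) + (ε / (2 * κ)) * h θ ^ 2) ≤ δ := by
    have e : ∀ θ, jW α β θ *
      ((1 / (2 * ε)) * (tsq (b - s - θ) * v θ ^ 2) + (ε / (2 * κ)) * h θ ^ 2) =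
      (1 / (2 * ε)) * (jW α β θ * (tsq (b - s - θ) * v θ ^ 2)) + (ε / (2 * κ)) *
        (jW α β θ * h θ ^ 2) := fun θ => by ring
    simp only [e]
    rw [intervalIntegral.integral_add
      ((jW_mul_int S.hα S.hβ (g := fun θ => tsq (b - s - θ) * v θ ^ 2)
        (ctq.mul (cv.pow 2))).const_mul _)
      ((jW_mul_int S.hα S.hβ (g := fun θ => h θ ^ 2) (hh.pow 2)).const_mul _), intervalIntegral.integral_const_mul,
      intervalIntegral.integral_const_mul, ← hKh]
    have h1 : (1 / (2 * ε)) * ∫ θ in 0..π, jW α β θ * (tsq (b - s - θ) * v θ ^ 2) ≤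
        (1 / (2 * ε)) * (b ^ 2 * η) :=
      mul_le_mul_of_nonneg_left (hE.trans hE0) (by positivity)
    have h2 : (1 / (2 * ε)) * (b ^ 2 * η) ≤ δ / 2 := by
      rw [hηd]
      have : (1 / (2 * ε)) * (b ^ 2 * (δ * ε / (b ^ 2 + 1))) = δ / 2 * (b ^ 2 / (b ^ 2 + 1)) := by
        field_simp
      rw [this]
      refine mul_le_of_le_one_right (by positivity) ?_
      rw [div_le_one (by positivity)]; linarith
    have h3 : ε / (2 * κ) * Kh ≤ δ / 2 := by
      rw [hεd]
      have : δ * κ / (Kh + 1) / (2 * κ) * Kh = δ / 2 * (Kh / (Kh + 1)) := by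
        field_simp
      rw [this]
      refine mul_le_of_le_one_right (by positivity) ?_
      rw [div_le_one (by positivity)]; linarith
    linarith
  have hneg : ∫ θ in 0..π, jW α β θ * (-(v * h)) θ = -∫ θ in 0..π, jW α β θ * (v θ * h θ) := by
    rw [← intervalIntegral.integral_neg]
    congr 1; funext θ; simp
  rw [hvh, Real.dist_eq, sub_zero, abs_lt]
  have hup' : ∫ θ in 0..π, jW α β θ * (v θ * h θ) ≤ _ := hup
  have hlo' : ∫ θ in 0..π, jW α β θ * (-(v * h)) θ ≤ _ := hlo
  rw [hneg] at hlo'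
  constructor <;> linarith
end JSys

namespace JSys
variable {α β : ℝ} {P : ℕ → Polynomial ℝ}

lemma propag_int (S : JSys α β P) {x : ℕ → ℝ} {l₀ : ℝ} (hl₀ : 0 ≤ l₀)
    (hx : ∀ n, x n ^ 2 = jl α β n + l₀) {f h g : ℝ → ℝ} (hf : Continuous f) (hh : Continuous h)
    (hg : Continuous g) {A b c : ℝ} (hA : 0 ≤ A)
    (hfb : ∀ θ, θ ≤ b → f θ = 0) (hhc : ∀ θ, c ≤ θ → h θ = 0) (hs : A < b - c) :
    HasSum (fun n => (∫ s in -A..A, g s * Real.cos (s * x n)) * (jc α β P f n * jc α β P h n)) 0 := by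
  have hsm := S.jc_mul_summable hf hh
  have key := intervalIntegral.hasSum_integral_of_dominated_convergence (μ := volume) (a := -A) (b := A)
    (F := fun n s => g s * Real.cos (s * x n) * (jc α β P f n * jc α β P h n))
    (f := fun _ => (0 : ℝ))
    (fun n s => |g s| * |jc α β P f n * jc α β P h n|) ?_ ?_ ?_ ?_ ?_
  · simpa [intervalIntegral.integral_mul_const] using key
  · intro n
    exact (by fun_prop : Continuous fun s =>
      g s * Real.cos (s * x n) * (jc α β P f n * jc α β P h n)).aestronglyMeasurable
  · intro n
    refine Filter.Eventually.of_forall fun s _ => ?_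
    rw [norm_mul, norm_mul, Real.norm_eq_abs, Real.norm_eq_abs, Real.norm_eq_abs]
    refine mul_le_mul_of_nonneg_right ?_ (abs_nonneg _)
    exact mul_le_of_le_one_right (abs_nonneg _) (Real.abs_cos_le_one _)
  · exact Filter.Eventually.of_forall fun s _ => hsm.mul_left _
  · simp only [tsum_mul_left]
    exact (hg.abs.mul continuous_const).intervalIntegrable _ _
  · refine Filter.Eventually.of_forall fun s hsA => ?_
    rw [uIoc_of_le (by linarith)] at hsA
    have := (S.propag hl₀ hx hf hh hfb hhc (s := s)
      ((abs_le.2 ⟨hsA.1.le, hsA.2⟩).trans_lt hs)).mul_left (g s)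
    simpa [mul_assoc] using this

lemma series_continuous (S : JSys α β P) {e : ℕ → ℝ} (he : Rapid e) :
    Continuous fun θ => ∑' n, e n * pj P n θ := by
  obtain ⟨Q, C, hC, H⟩ := S.pj_bound
  refine continuous_tsum (u := fun n : ℕ => C * (|e n| * (1 + (n : ℝ)) ^ Q))
    (fun n => (pj_continuous P n).const_mul _) ((he.summable Q).mul_left C) fun n θ => ?_
  rw [norm_mul, Real.norm_eq_abs, Real.norm_eq_abs]
  calc |e n| * |pj P n θ| ≤ |e n| * (C * (1 + (n : ℝ)) ^ Q) :=
        mul_le_mul_of_nonneg_left (H θ n) (abs_nonneg _)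
    _ = _ := by ring

lemma series_summable (S : JSys α β P) {e : ℕ → ℝ} (he : Rapid e) (θ : ℝ) :
    Summable fun n => e n * pj P n θ := by
  obtain ⟨Q, C, hC, H⟩ := S.pj_bound
  refine Summable.of_norm_bounded ((he.summable Q).mul_left C) fun n => ?_
  rw [norm_mul, Real.norm_eq_abs, Real.norm_eq_abs]
  calc |e n| * |pj P n θ| ≤ |e n| * (C * (1 + (n : ℝ)) ^ Q) :=
        mul_le_mul_of_nonneg_left (H θ n) (abs_nonneg _)
    _ = _ := by ring

lemma vanish (S : JSys α β P) {e : ℕ → ℝ} (he : Rapid e) {w : ℝ → ℝ} (hw : Continuous w)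
    (hw0 : ∀ θ, 0 ≤ w θ)
    (H0 : HasSum (fun n => e n * jc α β P (fun θ => w θ * ∑' m, e m * pj P m θ) n) 0) :
    ∀ θ ∈ Ioo 0 π, w θ * (∑' m, e m * pj P m θ) ^ 2 = 0 := by
  set k : ℝ → ℝ := fun θ => ∑' m, e m * pj P m θ with hk
  have ck : Continuous k := S.series_continuous he
  obtain ⟨Q, C, hC, H⟩ := S.pj_bound
  have hsm := (he.summable Q).mul_left C
  have key := intervalIntegral.hasSum_integral_of_dominated_convergence (μ := volume) (a := 0) (b := π)
    (F := fun n θ => e n * (jW α β θ * (w θ * k θ * pj P n θ)))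
    (f := fun θ => jW α β θ * (w θ * k θ ^ 2))
    (fun n θ => (jW α β θ * |w θ * k θ|) * (C * (|e n| * (1 + (n : ℝ)) ^ Q))) ?_ ?_ ?_ ?_ ?_
  · simp only [intervalIntegral.integral_const_mul, ← show ∀ n, jc α β P (fun θ => w θ * k θ) n =
      ∫ θ in 0..π, jW α β θ * (w θ * k θ * pj P n θ) from fun n => rfl] at key
    have h0 := key.unique H0
    have cwk : Continuous fun θ => w θ * k θ ^ 2 := hw.mul (ck.pow 2)
    have hIntg := jW_mul_int S.hα S.hβ cwk
    rw [intervalIntegral.integral_of_le Real.pi_pos.le, integral_Ioc_eq_integral_Ioo] at h0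
    have hIntg' : IntegrableOn (fun θ => jW α β θ * (w θ * k θ ^ 2)) (Ioo 0 π) :=
      (hIntg.1).mono_set Ioo_subset_Ioc_self
    rw [setIntegral_eq_zero_iff_of_nonneg_ae] at h0
    · have h1 : (fun θ => w θ * k θ ^ 2) =ᵐ[volume.restrict (Ioo 0 π)] fun _ => 0 := by
        filter_upwards [h0, ae_restrict_mem measurableSet_Ioo] with θ h1 h2
        have := (jW_pos α β h2).ne'
        simpa [this] using h1
      exact Measure.eqOn_open_of_ae_eq h1 isOpen_Ioo cwk.continuousOn continuousOn_const
    · filter_upwards [ae_restrict_mem measurableSet_Ioo] with θ h2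
      have := (jW_pos α β h2).le
      have := hw0 θ
      simp only [Pi.zero_apply]
      positivity
    · exact hIntg'
  · intro n
    have := (jW_measurable α β).mul ((hw.mul ck).mul (pj_continuous P n)).measurable
    exact (this.const_mul (e n)).aestronglyMeasurable
  · intro n
    refine Filter.Eventually.of_forall fun θ hθ => ?_
    rw [uIoc_of_le Real.pi_pos.le] at hθ
    have h1 := jW_nonneg α β ⟨hθ.1.le, hθ.2⟩
    rw [norm_mul, norm_mul, norm_mul (w θ * k θ)]
    simp only [Real.norm_eq_abs]
    rw [abs_of_nonneg h1]
    calc |e n| * (jW α β θ * (|w θ * k θ| * |pj P n θ|))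
        = (jW α β θ * |w θ * k θ|) * (|e n| * |pj P n θ|) := by ring
      _ ≤ (jW α β θ * |w θ * k θ|) * (|e n| * (C * (1 + (n : ℝ)) ^ Q)) :=
          mul_le_mul_of_nonneg_left (mul_le_mul_of_nonneg_left (H θ n) (abs_nonneg _))
            (by positivity)
      _ = _ := by ring
  · exact Filter.Eventually.of_forall fun θ _ => hsm.mul_left _
  · simp only [tsum_mul_left]
    exact (jW_mul_int S.hα S.hβ (hw.mul ck).abs).mul_const _
  · refine Filter.Eventually.of_forall fun θ _ => ?_
    have := (S.series_summable he θ).hasSum.mul_left (jW α β θ * (w θ * k θ))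
    have e1 : (fun n => e n * (jW α β θ * (w θ * k θ * pj P n θ))) =
        fun n => jW α β θ * (w θ * k θ) * (e n * pj P n θ) := by funext n; ring
    have e2 : jW α β θ * (w θ * k θ ^ 2) = jW α β θ * (w θ * k θ) * ∑' n, e n * pj P n θ := by
      rw [← show k θ = ∑' n, e n * pj P n θ from rfl]; ring
    rw [e2]
    simp only [e1]
    exact this

/-- Finite propagation speed, pointwise form. -/
lemma kernel_zero (S : JSys α β P) {x : ℕ → ℝ} {l₀ : ℝ} (hl₀ : 0 ≤ l₀)
    (hx : ∀ n, x n ^ 2 = jl α β n + l₀) {g : ℝ → ℝ} (hg : Continuous g) {A : ℝ} (hA : 0 ≤ A)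
    (hF : Rapid fun n => ∫ s in -A..A, g s * Real.cos (s * x n)) {θ φ : ℝ} (hθ : θ ∈ Ioo 0 π)
    (hφ : φ ∈ Ioo 0 π) (hd : A < |θ - φ|) :
    ∑' n, (∫ s in -A..A, g s * Real.cos (s * x n)) * (pj P n θ * pj P n φ) = 0 := by
  wlog hlt : φ < θ generalizing θ φ with H
  · have := H hφ hθ (by rwa [abs_sub_comm]) (by
      rcases eq_or_lt_of_le (not_lt.1 hlt) with h | h
      · rw [h] at hd; simp at hd; linarith
      · exact h)
    rw [← this]
    exact tsum_congr fun n => by ring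
  set F : ℕ → ℝ := fun n => ∫ s in -A..A, g s * Real.cos (s * x n) with hFd
  rw [abs_of_pos (by linarith)] at hd
  set η := (θ - φ - A) / 3 with hη
  have hη0 : 0 < η := by rw [hη]; linarith
  set b := θ - η with hb
  set c := φ + η with hc
  have hbc : A < b - c := by rw [hb, hc]; linarith
  obtain ⟨Q, C, hC, Hp⟩ := S.pj_bound
  have step1 : ∀ h : ℝ → ℝ, Continuous h → (∀ θ, c ≤ θ → h θ = 0) →
      ∑' n, F n * jc α β P h n * pj P n θ = 0 := by
    intro h hh hhc
    obtain ⟨B, hB⟩ := S.jc_bound hh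
    have he : Rapid fun n => F n * jc α β P h n :=
      hF.mul_poly (C := B) (Q := 0) fun n => by simpa using hB n
    have hwc : Continuous fun θ : ℝ => max 0 (θ - b) := by fun_prop
    have := S.vanish he hwc (fun θ => le_max_left _ _) ?_ θ hθ
    · have h2 : max 0 (θ - b) ≠ 0 := by
        rw [max_eq_right (by rw [hb]; linarith)]; rw [hb]; intro h; linarith
      have h3 := (mul_eq_zero.1 this).resolve_left h2
      exact pow_eq_zero_iff (two_ne_zero) |>.1 h3
    · have h1 := S.propag_int hl₀ hx (f := fun θ => max 0 (θ - b) * ∑' m, F m * jc α β P h m * pj P m θ)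
        (hwc.mul (S.series_continuous he)) hh hg hA (b := b) (c := c)
        (fun θ hθ => by rw [max_eq_left (by linarith), zero_mul]) hhc hbc
      convert h1 using 2
      ring
  have he2 : Rapid fun n => F n * pj P n θ := hF.mul_poly fun n => Hp θ n
  have hwc : Continuous fun φ : ℝ => max 0 (c - φ) := by fun_prop
  have h4 := step1 (fun φ => max 0 (c - φ) * ∑' m, F m * pj P m θ * pj P m φ)
    (hwc.mul (S.series_continuous he2)) (fun φ hφ => by rw [max_eq_left (by linarith), zero_mul])
  have := S.vanish he2 hwc (fun θ => le_max_left _ _) ?_ φ hφ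
  · have h2 : max 0 (c - φ) ≠ 0 := by
      rw [max_eq_right (by rw [hc]; linarith)]; rw [hc]; intro h; linarith
    have h3 := pow_eq_zero_iff (two_ne_zero) |>.1 ((mul_eq_zero.1 this).resolve_left h2)
    rw [← h3]
    exact tsum_congr fun n => by ring
  · have hs : Summable fun n => F n * pj P n θ *
        jc α β P (fun φ => max 0 (c - φ) * ∑' m, F m * pj P m θ * pj P m φ) n := by
      obtain ⟨B, hB⟩ := S.jc_bound (hwc.mul (S.series_continuous he2))
      have := he2.mul_poly (C := B) (Q := 0) fun n => by simpa using hB n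
      have := (this.summable 0)
      simp only [pow_zero, mul_one] at this
      exact this.of_abs
    have hh := hs.hasSum
    rwa [show (∑' n, F n * pj P n θ *
        jc α β P (fun φ => max 0 (c - φ) * ∑' m, F m * pj P m θ * pj P m φ) n) = 0 by
      refine Eq.trans ?_ h4; exact tsum_congr fun n => mul_right_comm _ _ _] at hh
end JSys

/-! ### Part E: Fourier decomposition of the symbol -/

lemma pow_exp_int (k : ℕ) {τ : ℝ} (hτ : 0 < τ) :
    IntegrableOn (fun x : ℝ => x ^ k * exp (-τ * x)) (Ioi 0) := by
  have h := integrableOn_rpow_mul_exp_neg_mul_rpow (s := k) (p := 1) (b := τ)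
    (by have : (0 : ℝ) ≤ k := Nat.cast_nonneg k
        linarith) one_pos hτ
  refine h.congr_fun (fun x hx => ?_) measurableSet_Ioi
  simp [Real.rpow_natCast]

lemma pow_cexp_int (k : ℕ) {a : ℂ} (ha : 0 < a.re) :
    IntegrableOn (fun x : ℝ => (x : ℂ) ^ k * Complex.exp (-a * x)) (Ioi 0) := by
  have h := pow_exp_int k ha
  refine Integrable.mono h ?_ ?_
  · exact Continuous.aestronglyMeasurable (by fun_prop)
  · refine Filter.Eventually.of_forall fun x => ?_
    rw [norm_mul, norm_mul, norm_pow, Complex.norm_exp, Complex.norm_real, norm_pow,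
      Real.norm_eq_abs (exp _), abs_of_pos (exp_pos _)]
    simp

lemma laplace_pow (k : ℕ) {a : ℂ} (ha : 0 < a.re) :
    ∫ x : ℝ in Ioi 0, (x : ℂ) ^ k * Complex.exp (-a * x) = (k.factorial : ℂ) * (a ^ (k + 1))⁻¹ := by
  have ha0 : a ≠ 0 := fun h => by simp [h] at ha
  have hexp : ∀ x : ℝ, HasDerivAt (fun x : ℝ => Complex.exp (-a * x))
      (-a * Complex.exp (-a * x)) x := by
    intro x
    have h1 : HasDerivAt (fun x : ℝ => -a * (x : ℂ)) (-a) x := by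
      simpa using (Complex.ofRealCLM.hasDerivAt (x := x)).const_mul (-a)
    have := h1.cexp
    rwa [mul_comm] at this
  have htend : ∀ k : ℕ, Filter.Tendsto (fun x : ℝ => (x : ℂ) ^ k * Complex.exp (-a * x))
      Filter.atTop (nhds 0) := by
    intro k
    rw [tendsto_zero_iff_norm_tendsto_zero]
    have h := tendsto_rpow_mul_exp_neg_mul_atTop_nhds_zero k a.re ha
    refine h.congr' ?_
    filter_upwards [Filter.eventually_ge_atTop (0 : ℝ)] with x hx
    rw [norm_mul, norm_pow, Complex.norm_exp, Complex.norm_real, Real.norm_of_nonneg hx,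
      Real.rpow_natCast]
    simp
  induction k with
  | zero =>
    have h := integral_Ioi_of_hasDerivAt_of_tendsto' (a := 0) (m := 0)
      (f := fun x : ℝ => Complex.exp (-a * x)) (f' := fun x : ℝ => -a * Complex.exp (-a * x))
      (fun x _ => hexp x)
      (by have := (pow_cexp_int 0 ha).const_mul (-a)
          refine Integrable.congr this (Filter.Eventually.of_forall fun x => ?_)
          simp) (by simpa using htend 0)
    rw [integral_const_mul] at h
    simp only [pow_zero, one_mul, Nat.factorial_zero, Nat.cast_one, zero_add, pow_one]
    simp at h
    apply eq_inv_of_mul_eq_one_left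
    simp only [neg_mul]
    linear_combination h
  | succ k ih =>
    have hd : ∀ x : ℝ, HasDerivAt (fun x : ℝ => (x : ℂ) ^ (k + 1) * Complex.exp (-a * x))
        (((k : ℂ) + 1) * ((x : ℂ) ^ k * Complex.exp (-a * x)) - a * ((x : ℂ) ^ (k + 1) *
          Complex.exp (-a * x))) x := by
      intro x
      have h1 : HasDerivAt (fun x : ℝ => (x : ℂ) ^ (k + 1)) (((k : ℂ) + 1) * (x : ℂ) ^ k) x := by
        have := (Complex.ofRealCLM.hasDerivAt (x := x)).pow (k + 1)
        refine (this.congr_deriv ?_)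
        simp
      have := h1.mul (hexp x)
      refine this.congr_deriv ?_
      ring
    have h := integral_Ioi_of_hasDerivAt_of_tendsto' (a := 0) (m := 0) (fun x _ => hd x)
      (((pow_cexp_int k ha).const_mul _).sub ((pow_cexp_int (k + 1) ha).const_mul _)) (htend (k + 1))
    rw [integral_sub ((pow_cexp_int k ha).const_mul _) ((pow_cexp_int (k + 1) ha).const_mul _),
      integral_const_mul, integral_const_mul, ih] at h
    simp only [Complex.ofReal_zero, ne_eq, Nat.add_eq_zero_iff, one_ne_zero, and_false,
      not_false_eq_true, zero_pow, zero_mul, sub_zero] at h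
    rw [Nat.factorial_succ]
    push_cast
    have h2 : a * ∫ x : ℝ in Ioi 0, (x : ℂ) ^ (k + 1) * Complex.exp (-a * x) =
        ((k : ℂ) + 1) * (k.factorial * (a ^ (k + 1))⁻¹) := by linear_combination -h
    apply mul_left_cancel₀ ha0
    rw [h2, pow_succ a (k + 1)]
    field_simp

/-- The explicit Fourier integral. -/
def FI (k : ℝ → ℂ) (x : ℝ) : ℂ := ∫ v : ℝ, Complex.exp (↑(-2 * π * v * x) * Complex.I) * k v

lemma FI_eq (k : ℝ → ℂ) (x : ℝ) : FourierTransform.fourier k x = FI k x := by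
  rw [Real.fourier_real_eq_integral_exp_smul]
  rfl

lemma FI_norm_exp (v x : ℝ) : ‖Complex.exp (↑(-2 * π * v * x) * Complex.I)‖ = 1 :=
  Complex.norm_exp_ofReal_mul_I _

lemma FI_int {k : ℝ → ℂ} (hk : Integrable k) (x : ℝ) :
    Integrable fun v : ℝ => Complex.exp (↑(-2 * π * v * x) * Complex.I) * k v := by
  refine hk.bdd_mul (c := 1) (Continuous.aestronglyMeasurable (by fun_prop)) ?_
  exact Filter.Eventually.of_forall fun v => (FI_norm_exp v x).le

lemma FI_le {k : ℝ → ℂ} (x : ℝ) : ‖FI k x‖ ≤ ∫ v, ‖k v‖ := by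
  refine (norm_integral_le_integral_norm _).trans (le_of_eq ?_)
  refine integral_congr_ae (Filter.Eventually.of_forall fun v => ?_)
  simp only
  rw [norm_mul, FI_norm_exp, one_mul]

lemma FI_sub {f g : ℝ → ℂ} (hf : Integrable f) (hg : Integrable g) (c : ℂ) (x : ℝ) :
    FI (fun v => f v - c * g v) x = FI f x - c * FI g x := by
  unfold FI
  rw [← integral_const_mul, ← integral_sub (FI_int hf x) ((FI_int hg x).const_mul c)]
  congr 1
  ext v
  ring

/-- The class of cutoffs. -/
def PsiC (ψ : ℝ → ℝ) : Prop := ContDiff ℝ (⊤ : ℕ∞) ψ ∧ (∀ ξ, |ξ| < 1 / 20 → ψ ξ = 0) ∧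
  ∃ c, ∀ ξ, 1 / 10 < |ξ| → ψ ξ = c

lemma PsiC.deriv {ψ : ℝ → ℝ} (h : PsiC ψ) : PsiC (deriv ψ) := by
  obtain ⟨h1, h2, c, h3⟩ := h
  refine ⟨?_, ?_, 0, ?_⟩
  · exact (contDiff_infty_iff_deriv.1 h1).2
  · intro ξ hξ
    have : ψ =ᶠ[nhds ξ] fun _ => 0 := by
      filter_upwards [(isOpen_lt continuous_abs continuous_const).mem_nhds hξ] with y hy
      exact h2 y hy
    rw [this.deriv_eq]
    simp
  · intro ξ hξ
    have : ψ =ᶠ[nhds ξ] fun _ => c := by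
      filter_upwards [(isOpen_lt continuous_const continuous_abs).mem_nhds hξ] with y hy
      exact h3 y hy
    rw [this.deriv_eq]
    simp

lemma PsiC.bdd {ψ : ℝ → ℝ} (h : PsiC ψ) : ∃ B : ℝ, B > 0 ∧ ∀ ξ, |ψ ξ| ≤ B := by
  obtain ⟨h1, h2, c, h3⟩ := h
  obtain ⟨B, hB⟩ := isCompact_Icc.exists_bound_of_continuousOn (s := Icc (-(1 / 10) : ℝ) (1 / 10))
    h1.continuous.continuousOn
  refine ⟨|B| + |c| + 1, by positivity, fun ξ => ?_⟩
  by_cases hξ : 1 / 10 < |ξ|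
  · rw [h3 ξ hξ]
    linarith [abs_nonneg B]
  · have := hB ξ (abs_le.1 (not_lt.1 hξ))
    rw [Real.norm_eq_abs] at this
    linarith [le_abs_self B, abs_nonneg c]

/-- The kernel `ψ(ξ)(τ+2πiξ)^{-m}`. -/
def kf (ψ : ℝ → ℝ) (τ : ℝ) (m : ℕ) (ξ : ℝ) : ℂ :=
  (ψ ξ : ℂ) * (((τ : ℂ) + 2 * π * Complex.I * ξ) ^ m)⁻¹

lemma kf_re (τ ξ : ℝ) : ((τ : ℂ) + 2 * π * Complex.I * ξ).re = τ := by simp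
lemma kf_im (τ ξ : ℝ) : ((τ : ℂ) + 2 * π * Complex.I * ξ).im = 2 * π * ξ := by simp

lemma kf_ne {τ : ℝ} (hτ : 0 < τ) (ξ : ℝ) : ((τ : ℂ) + 2 * π * Complex.I * ξ) ≠ 0 := by
  intro h
  have := congrArg Complex.re h
  rw [kf_re] at this
  simp at this
  exact hτ.ne' this

lemma kf_norm_lower (τ ξ : ℝ) : 6 * |ξ| ≤ ‖(τ : ℂ) + 2 * π * Complex.I * ξ‖ := by
  refine le_trans ?_ (Complex.abs_im_le_norm _)
  rw [kf_im, abs_mul, abs_of_pos (by positivity : (0 : ℝ) < 2 * π)]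
  have := pi_gt_three
  nlinarith [abs_nonneg ξ]

lemma kf_continuous {ψ : ℝ → ℝ} (hψ : Continuous ψ) {τ : ℝ} (hτ : 0 < τ) (m : ℕ) :
    Continuous (kf ψ τ m) := by
  unfold kf
  refine Continuous.mul (by fun_prop) (Continuous.inv₀ (by fun_prop) fun ξ => ?_)
  exact pow_ne_zero _ (kf_ne hτ ξ)

lemma kf_bound {ψ : ℝ → ℝ} (h : PsiC ψ) (k : ℕ) : ∃ C : ℝ, C > 0 ∧ ∀ τ > 0, ∀ ξ,
    ‖kf ψ τ (k + 2) ξ‖ ≤ C * (1 + ξ ^ 2)⁻¹ := by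
  obtain ⟨B, hB, hB'⟩ := h.bdd
  refine ⟨B * (((3 / 10 : ℝ) ^ k) * (36 / 401))⁻¹, by positivity, fun τ hτ ξ => ?_⟩
  by_cases hξ : |ξ| < 1 / 20
  · rw [kf, h.2.1 ξ hξ]
    simp
    positivity
  push Not at hξ
  rw [kf, norm_mul, Complex.norm_real, Real.norm_eq_abs, norm_inv, norm_pow,
    mul_assoc B, ← mul_inv]
  gcongr
  · exact hB' ξ
  have h1 := kf_norm_lower τ ξ
  calc (3 / 10 : ℝ) ^ k * (36 / 401) * (1 + ξ ^ 2) ≤ (6 * |ξ|) ^ k * (6 * |ξ|) ^ 2 := by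
        rw [mul_assoc]
        gcongr
        · linarith
        · rw [mul_pow, sq_abs]
          nlinarith [sq_abs ξ]
    _ = (6 * |ξ|) ^ (k + 2) := by rw [pow_add]
    _ ≤ _ := by gcongr

lemma kf_int {ψ : ℝ → ℝ} (h : PsiC ψ) (k : ℕ) {τ : ℝ} (hτ : 0 < τ) :
    Integrable (kf ψ τ (k + 2)) := by
  obtain ⟨C, hC, hC'⟩ := kf_bound h k
  refine (integrable_inv_one_add_sq.const_mul C).mono'
    (kf_continuous h.1.continuous hτ _).aestronglyMeasurable ?_
  exact Filter.Eventually.of_forall fun ξ => hC' τ hτ ξ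

lemma kf_hasDerivAt {ψ : ℝ → ℝ} (h : PsiC ψ) (m : ℕ) {τ : ℝ} (hτ : 0 < τ) (ξ : ℝ) :
    HasDerivAt (kf ψ τ m) (kf (deriv ψ) τ m ξ - (2 * π * Complex.I * m) * kf ψ τ (m + 1) ξ) ξ := by
  have h1 : HasDerivAt (fun ξ : ℝ => (ψ ξ : ℂ)) ((_root_.deriv ψ ξ : ℝ) : ℂ) ξ := by
    have := ((h.1.differentiable (by simp)) ξ).hasDerivAt
    exact this.ofReal_comp
  have h2 : HasDerivAt (fun ξ : ℝ => (τ : ℂ) + 2 * π * Complex.I * ξ) (2 * π * Complex.I) ξ := by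
    simpa using ((Complex.ofRealCLM.hasDerivAt (x := ξ)).const_mul (2 * π * Complex.I)).const_add (τ : ℂ)
  have h3 := (h2.pow m).inv (pow_ne_zero m (kf_ne hτ ξ))
  have h4 := h1.mul h3
  refine h4.congr_deriv ?_
  unfold kf
  have hne := kf_ne hτ ξ
  rcases m with _ | m
  · simp
  · simp only [Pi.pow_apply, Nat.add_sub_cancel, Pi.inv_apply]
    field_simp
    ring

lemma kf_decay (Q : ℕ) : ∀ ψ : ℝ → ℝ, PsiC ψ → ∀ k : ℕ, ∃ C : ℝ, C > 0 ∧ ∀ τ > 0, ∀ x : ℝ,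
    |x| ^ Q * ‖FI (kf ψ τ (k + 2)) x‖ ≤ C := by
  induction Q with
  | zero =>
    intro ψ h k
    obtain ⟨C, hC, hC'⟩ := kf_bound h k
    refine ⟨C * ∫ ξ : ℝ, (1 + ξ ^ 2)⁻¹, ?_, fun τ hτ x => ?_⟩
    · rw [integral_univ_inv_one_add_sq]
      have := pi_pos
      positivity
    · rw [pow_zero, one_mul, ← integral_const_mul]
      refine (FI_le x).trans (integral_mono (kf_int h k hτ).norm
        (integrable_inv_one_add_sq.const_mul C) fun ξ => hC' τ hτ ξ)
  | succ Q ih =>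
    intro ψ h k
    obtain ⟨C₁, hC₁, h₁⟩ := ih _ h.deriv k
    obtain ⟨C₂, hC₂, h₂⟩ := ih _ h (k + 1)
    refine ⟨C₁ + 2 * π * (k + 2) * C₂, by have := pi_pos; positivity, fun τ hτ x => ?_⟩
    have hd : deriv (kf ψ τ (k + 2)) = fun ξ => kf (deriv ψ) τ (k + 2) ξ -
        (2 * π * Complex.I * (k + 2 : ℕ)) * kf ψ τ (k + 1 + 2) ξ :=
      funext fun ξ => (kf_hasDerivAt h (k + 2) hτ ξ).deriv
    have i1 := kf_int h.deriv k hτ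
    have i2 := kf_int h (k + 1) hτ
    have h3 := Real.fourier_deriv (kf_int h k hτ)
      (fun ξ => (kf_hasDerivAt h (k + 2) hτ ξ).differentiableAt)
      (by rw [hd]; exact i1.sub (i2.const_mul _))
    have h4 := congrFun h3 x
    simp only [FI_eq] at h4
    rw [hd, FI_sub i1 i2] at h4
    have h5 : ‖(2 * π * Complex.I * x) • FI (kf ψ τ (k + 2)) x‖ =
        2 * π * (|x| * ‖FI (kf ψ τ (k + 2)) x‖) := by
      rw [norm_smul]
      simp [abs_of_pos pi_pos]
      ring
    have h6 : ‖FI (kf (deriv ψ) τ (k + 2)) x - 2 * π * Complex.I * (k + 2 : ℕ) *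
        FI (kf ψ τ (k + 1 + 2)) x‖ ≤ ‖FI (kf (deriv ψ) τ (k + 2)) x‖ + 2 * π * (k + 2) *
          ‖FI (kf ψ τ (k + 1 + 2)) x‖ := by
      refine (norm_sub_le _ _).trans (le_of_eq ?_)
      rw [norm_mul]
      congr 2
      rw [norm_mul, Complex.norm_natCast]
      simp [abs_of_pos pi_pos]
    rw [h4, h5] at h6
    have h7 := h₁ τ hτ x
    have h8 := h₂ τ hτ x
    have hpi := pi_gt_three
    have hx : 0 ≤ |x| ^ Q := by positivity
    calc |x| ^ (Q + 1) * ‖FI (kf ψ τ (k + 2)) x‖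
        ≤ |x| ^ Q * (2 * π * (|x| * ‖FI (kf ψ τ (k + 2)) x‖)) := by
          rw [pow_succ, mul_assoc]
          refine mul_le_mul_of_nonneg_left ?_ hx
          have : 0 ≤ |x| * ‖FI (kf ψ τ (k + 2)) x‖ := by positivity
          nlinarith
      _ ≤ |x| ^ Q * (‖FI (kf (deriv ψ) τ (k + 2)) x‖ + 2 * π * (k + 2) *
          ‖FI (kf ψ τ (k + 1 + 2)) x‖) := mul_le_mul_of_nonneg_left h6 hx
      _ = |x| ^ Q * ‖FI (kf (deriv ψ) τ (k + 2)) x‖ + 2 * π * (k + 2) *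
          (|x| ^ Q * ‖FI (kf ψ τ (k + 1 + 2)) x‖) := by ring
      _ ≤ _ := by gcongr

/-- One-sided symbol. -/
def fsym (M : ℕ) (τ x : ℝ) : ℂ := (((max 0 x) ^ M * exp (-τ * x) : ℝ) : ℂ)

lemma fsym_continuous (M : ℕ) (τ : ℝ) : Continuous (fsym M τ) := by
  unfold fsym
  fun_prop

lemma fsym_ind {M : ℕ} (hM : 1 ≤ M) (τ : ℝ) :
    fsym M τ = (Ioi 0).indicator fun x : ℝ => ((x ^ M * exp (-τ * x) : ℝ) : ℂ) := by
  ext x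
  by_cases hx : 0 < x
  · rw [indicator_of_mem (mem_Ioi.2 hx), fsym, max_eq_right hx.le]
  · rw [indicator_of_notMem (by simpa using hx), fsym, max_eq_left (not_lt.1 hx)]
    have : M ≠ 0 := by omega
    simp [this]

lemma fsym_int {M : ℕ} (hM : 1 ≤ M) {τ : ℝ} (hτ : 0 < τ) : Integrable (fsym M τ) := by
  rw [fsym_ind hM, integrable_indicator_iff measurableSet_Ioi]
  exact (pow_exp_int M hτ).ofReal

lemma fsym_FI {M : ℕ} (hM : 1 ≤ M) {τ : ℝ} (hτ : 0 < τ) (ξ : ℝ) :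
    FI (fsym M τ) ξ = (M.factorial : ℂ) * kf (fun _ => 1) τ (M + 1) ξ := by
  unfold FI kf
  rw [Complex.ofReal_one, one_mul, ← laplace_pow M (by rw [kf_re]; exact hτ), fsym_ind hM,
    ← integral_indicator measurableSet_Ioi]
  congr 1
  ext x
  by_cases hx : 0 < x
  · rw [indicator_of_mem (mem_Ioi.2 hx), indicator_of_mem (mem_Ioi.2 hx)]
    push_cast
    rw [mul_comm, mul_assoc, ← Complex.exp_add]
    congr 2
    ring
  · rw [indicator_of_notMem (by simpa using hx), indicator_of_notMem (by simpa using hx), mul_zero]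

/-- A fixed bump. -/
def bmp : ContDiffBump (0 : ℝ) := ⟨1 / 20, 1 / 10, by norm_num, by norm_num⟩

lemma psiC_bmp : PsiC fun ξ => 1 - bmp ξ := by
  refine ⟨contDiff_const.sub bmp.contDiff, fun ξ hξ => ?_, 1, fun ξ hξ => ?_⟩
  · show 1 - bmp ξ = 0
    rw [bmp.one_of_mem_closedBall, sub_self]
    rw [Metric.mem_closedBall, Real.dist_eq, sub_zero]
    exact hξ.le
  · show 1 - bmp ξ = 1
    rw [bmp.zero_of_le_dist, sub_zero]
    rw [Real.dist_eq, sub_zero]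
    exact hξ.le

lemma bmp_int {τ : ℝ} (hτ : 0 < τ) (m : ℕ) : Integrable (kf bmp τ m) := by
  refine (kf_continuous bmp.continuous hτ m).integrable_of_hasCompactSupport ?_
  refine HasCompactSupport.intro (isCompact_Icc (a := -(1 / 10 : ℝ)) (b := 1 / 10)) fun x hx => ?_
  rw [kf, bmp.zero_of_le_dist]
  · simp
  · rw [Real.dist_eq, sub_zero]
    by_contra hlt
    push Not at hlt
    exact hx (abs_le.1 hlt.le)

lemma kf_one_split (τ : ℝ) (m : ℕ) : kf (fun _ => 1) τ m =
    fun ξ => kf bmp τ m ξ - (-1) * kf (fun ξ => 1 - bmp ξ) τ m ξ := by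
  ext ξ
  unfold kf
  push_cast
  ring

lemma fsym_inv {M : ℕ} (hM : 1 ≤ M) {τ : ℝ} (hτ : 0 < τ) (x : ℝ) :
    fsym M τ x = (M.factorial : ℂ) * (FI (kf bmp τ (M + 1)) (-x) +
      FI (kf (fun ξ => 1 - bmp ξ) τ (M + 1)) (-x)) := by
  obtain ⟨k, rfl⟩ := Nat.exists_eq_add_of_le' hM
  have i1 := bmp_int hτ (k + 1 + 1)
  have i2 := kf_int psiC_bmp k hτ
  have i3 : Integrable (kf (fun _ => 1) τ (k + 1 + 1)) := by
    rw [kf_one_split]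
    exact i1.sub (i2.const_mul _)
  have h0 : FourierTransform.fourier (fsym (k + 1) τ) =
      fun ξ => ((k + 1).factorial : ℂ) * kf (fun _ => 1) τ (k + 1 + 1) ξ := by
    ext ξ
    rw [FI_eq, fsym_FI hM hτ]
  have h1 := congrFun (Continuous.fourierInv_fourier_eq (fsym_continuous (k + 1) τ)
    (fsym_int hM hτ) (by rw [h0]; exact i3.const_mul _)) x
  rw [Real.fourierInv_eq_fourier_neg, h0, FI_eq] at h1
  rw [← h1]
  have h2 := FI_sub i1 i2 (-1) (-x)
  rw [← kf_one_split] at h2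
  have h3 : FI (fun ξ => ((k + 1).factorial : ℂ) * kf (fun _ => 1) τ (k + 1 + 1) ξ) (-x) =
      ((k + 1).factorial : ℂ) * FI (kf (fun _ => 1) τ (k + 1 + 1)) (-x) := by
    unfold FI
    rw [← integral_const_mul]
    congr 1
    ext v
    ring
  rw [h3, h2]
  ring

lemma bmp_FI {τ : ℝ} (hτ : 0 < τ) (m : ℕ) (x : ℝ) :
    (FI (kf bmp τ m) x + FI (kf bmp τ m) (-x)).re =
      ∫ ξ in (-(1 / 10 : ℝ))..(1 / 10), 2 * (kf bmp τ m ξ).re * cos (2 * π * ξ * x) := by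
  have i1 := bmp_int hτ m
  unfold FI
  rw [← integral_add (FI_int i1 x) (FI_int i1 (-x))]
  have h1 := integral_re ((FI_int i1 x).add (FI_int i1 (-x)))
  have h2 : (∫ a, (Complex.exp (↑(-2 * π * a * x) * Complex.I) * kf bmp τ m a +
      Complex.exp (↑(-2 * π * a * -x) * Complex.I) * kf bmp τ m a)).re =
      ∫ ξ, 2 * (kf bmp τ m ξ).re * cos (2 * π * ξ * x) := by
    refine Eq.trans h1.symm ?_
    congr 1
    ext a
    simp only [Pi.add_apply]
    rw [← add_mul]
    have : Complex.exp (↑(-2 * π * a * x) * Complex.I) + Complex.exp (↑(-2 * π * a * -x) * Complex.I)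
        = ((2 * cos (2 * π * a * x) : ℝ) : ℂ) := by
      push_cast
      rw [Complex.two_cos, add_comm]
      congr 2 <;> ring
    rw [this]
    refine (Complex.re_ofReal_mul _ _).trans ?_
    ring
  rw [h2, intervalIntegral.integral_of_le (by norm_num), ← integral_indicator measurableSet_Ioc]
  congr 1
  ext ξ
  by_cases h : ξ ∈ Ioc (-(1 / 10 : ℝ)) (1 / 10)
  · rw [indicator_of_mem h]
  · rw [indicator_of_notMem h, kf, bmp.zero_of_le_dist]
    · simp
    · rw [Real.dist_eq, sub_zero]
      by_contra hlt
      have h3 : |ξ| < 1 / 10 := not_le.1 hlt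
      rw [abs_lt] at h3
      exact h ⟨h3.1, h3.2.le⟩

lemma one_add_pow_le (Q : ℕ) {x : ℝ} (hx : 0 ≤ x) : (1 + x) ^ Q ≤ 2 ^ Q * (1 + x ^ Q) := by
  have hq : 0 ≤ x ^ Q := by positivity
  rcases le_total x 1 with h | h
  · calc (1 + x) ^ Q ≤ 2 ^ Q := by gcongr; linarith
      _ ≤ _ := by nlinarith [pow_pos (two_pos : (0 : ℝ) < 2) Q]
  · calc (1 + x) ^ Q ≤ (2 * x) ^ Q := by gcongr; linarith
      _ = 2 ^ Q * x ^ Q := mul_pow _ _ _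
      _ ≤ _ := by gcongr; linarith

lemma symbol_split {M : ℕ} (hM : 1 ≤ M) : ∃ g : ℝ → ℝ → ℝ, (∀ τ > 0, Continuous (g τ)) ∧
    ∀ Q : ℕ, ∃ C : ℝ, C > 0 ∧ ∀ τ > 0, ∀ x ≥ 0, |x ^ M * exp (-τ * x) -
      ∫ ξ in (-(1 / 10 : ℝ))..(1 / 10), g τ ξ * cos (2 * π * ξ * x)| * (1 + x) ^ Q ≤ C := by
  refine ⟨fun τ ξ => M.factorial * (2 * (kf bmp τ (M + 1) ξ).re), fun τ hτ => ?_, fun Q => ?_⟩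
  · have := kf_continuous bmp.continuous hτ (M + 1)
    exact continuous_const.mul (continuous_const.mul (Complex.continuous_re.comp this))
  obtain ⟨k, rfl⟩ := Nat.exists_eq_add_of_le' hM
  obtain ⟨C₀, hC₀, h₀⟩ := kf_decay 0 _ psiC_bmp k
  obtain ⟨C₁, hC₁, h₁⟩ := kf_decay Q _ psiC_bmp k
  refine ⟨(k + 1).factorial * (2 * 2 ^ Q * (C₀ + C₁)), by positivity, fun τ hτ x hx => ?_⟩
  set K := kf (fun ξ => 1 - bmp ξ) τ (k + 1 + 1) with hK
  have e1 : x ^ (k + 1) * exp (-τ * x) = (fsym (k + 1) τ x + fsym (k + 1) τ (-x)).re := by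
    rw [Complex.add_re, fsym, fsym, Complex.ofReal_re, Complex.ofReal_re, max_eq_right hx,
      max_eq_left (by linarith)]
    simp
  have e2 : x ^ (k + 1) * exp (-τ * x) - ∫ ξ in (-(1 / 10 : ℝ))..(1 / 10),
      (k + 1).factorial * (2 * (kf bmp τ (k + 1 + 1) ξ).re) * cos (2 * π * ξ * x) =
      (((k + 1).factorial : ℂ) * (FI K x + FI K (-x))).re := by
    have : (∫ ξ in (-(1 / 10 : ℝ))..(1 / 10),
      (k + 1).factorial * (2 * (kf bmp τ (k + 1 + 1) ξ).re) * cos (2 * π * ξ * x)) =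
      (((k + 1).factorial : ℂ) * (FI (kf bmp τ (k + 1 + 1)) x + FI (kf bmp τ (k + 1 + 1)) (-x))).re := by
      rw [← Complex.ofReal_natCast, Complex.re_ofReal_mul, bmp_FI hτ,
        ← intervalIntegral.integral_const_mul]
      congr 1
      ext ξ
      ring
    rw [e1, this, ← Complex.sub_re, fsym_inv hM hτ, fsym_inv hM hτ, neg_neg]
    congr 1
    ring
  have b0 : ∀ y : ℝ, ‖FI K y‖ ≤ C₀ := fun y => by simpa using h₀ τ hτ y
  have b1 : ∀ y : ℝ, |y| ^ Q * ‖FI K y‖ ≤ C₁ := fun y => h₁ τ hτ y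
  have b2 : ∀ y : ℝ, |y| = x → (1 + x) ^ Q * ‖FI K y‖ ≤ 2 ^ Q * (C₀ + C₁) := by
    intro y hy
    have := b1 y
    rw [hy] at this
    calc (1 + x) ^ Q * ‖FI K y‖ ≤ 2 ^ Q * (1 + x ^ Q) * ‖FI K y‖ := by
          gcongr; exact one_add_pow_le Q hx
      _ = 2 ^ Q * (‖FI K y‖ + x ^ Q * ‖FI K y‖) := by ring
      _ ≤ _ := by gcongr; exact b0 y
  rw [e2]
  calc |(((k + 1).factorial : ℂ) * (FI K x + FI K (-x))).re| * (1 + x) ^ Q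
      ≤ ((k + 1).factorial * (‖FI K x‖ + ‖FI K (-x)‖)) * (1 + x) ^ Q := by
        gcongr
        refine (Complex.abs_re_le_norm _).trans ?_
        rw [norm_mul, Complex.norm_natCast]
        gcongr
        exact norm_add_le _ _
    _ = (k + 1).factorial * ((1 + x) ^ Q * ‖FI K x‖ + (1 + x) ^ Q * ‖FI K (-x)‖) := by ring
    _ ≤ (k + 1).factorial * (2 ^ Q * (C₀ + C₁) + 2 ^ Q * (C₀ + C₁)) := by
        refine mul_le_mul_of_nonneg_left (add_le_add ?_ ?_) (by positivity)
        · exact b2 x (abs_of_nonneg hx)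
        · exact b2 (-x) (by rw [abs_neg, abs_of_nonneg hx])
    _ = _ := by ring

lemma symbol_split_scaled {M : ℕ} (hM : 1 ≤ M) : ∃ h : ℝ → ℝ → ℝ → ℝ,
    (∀ d > 0, ∀ t > 0, Continuous (h d t)) ∧
    ∀ Q : ℕ, ∃ C : ℝ, C > 0 ∧ ∀ d > 0, ∀ t > 0, ∀ x ≥ 0, |x ^ M * exp (-t * x) -
      ∫ s in (-(π / 5 * d))..(π / 5 * d), h d t s * cos (s * x)| ≤
        C * (d ^ M)⁻¹ * ((1 + d * x) ^ Q)⁻¹ := by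
  obtain ⟨g, hg, hg'⟩ := symbol_split hM
  refine ⟨fun d t s => (d ^ M)⁻¹ * (2 * π * d)⁻¹ * g (t / d) (s / (2 * π * d)),
    fun d hd t ht => ?_, fun Q => ?_⟩
  · have := hg (t / d) (by positivity)
    fun_prop
  obtain ⟨C, hC, h⟩ := hg' Q
  refine ⟨C, hC, fun d hd t ht x hx => ?_⟩
  have h1 := h (t / d) (by positivity) (d * x) (by positivity)
  have hpi := pi_pos
  have hc : 2 * π * d ≠ 0 := by positivity
  have h2 : (∫ s in (-(π / 5 * d))..(π / 5 * d), (d ^ M)⁻¹ * (2 * π * d)⁻¹ *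
      g (t / d) (s / (2 * π * d)) * cos (s * x)) = (d ^ M)⁻¹ *
      ∫ ξ in (-(1 / 10 : ℝ))..(1 / 10), g (t / d) ξ * cos (2 * π * ξ * (d * x)) := by
    have h3 := intervalIntegral.integral_comp_div (a := -(π / 5 * d)) (b := π / 5 * d)
      (fun ξ => (d ^ M)⁻¹ * (2 * π * d)⁻¹ * (g (t / d) ξ * cos (2 * π * ξ * (d * x)))) hc
    have e1 : -(π / 5 * d) / (2 * π * d) = -(1 / 10) := by field_simp; norm_num
    have e2 : (π / 5 * d) / (2 * π * d) = 1 / 10 := by field_simp; norm_num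
    rw [e1, e2] at h3
    refine Eq.trans ?_ (h3.trans ?_)
    · congr 1
      ext s
      have : 2 * π * (s / (2 * π * d)) * (d * x) = s * x := by field_simp
      rw [this]
      ring
    · rw [smul_eq_mul, intervalIntegral.integral_const_mul, ← mul_assoc]
      congr 1
      field_simp
  rw [h2]
  have h4 : x ^ M * exp (-t * x) = (d ^ M)⁻¹ * ((d * x) ^ M * exp (-(t / d) * (d * x))) := by
    have : -(t / d) * (d * x) = -t * x := by field_simp
    rw [this, mul_pow]
    field_simp
  rw [h4, ← mul_sub, abs_mul, abs_of_pos (by positivity : 0 < (d ^ M)⁻¹), mul_comm C, mul_assoc]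
  refine mul_le_mul_of_nonneg_left ?_ (by positivity)
  rw [← div_eq_mul_inv, le_div_iff₀ (by positivity)]
  exact h1

/-! ### Part A: the Jacobi polynomials form a `JSys` -/

def aJ (α β : ℝ) (n m : ℕ) : ℝ := if n = 0 then 1 else
  (Real.Gamma (α + n + 1) * Real.Gamma (α + β + n + m + 1)) /
      ((m.factorial : ℝ) * ((n - m).factorial : ℝ) * Real.Gamma (α + β + n + 1) *
        Real.Gamma (α + m + 1))

def qJ (α β : ℝ) (n : ℕ) : Polynomial ℝ :=
  ∑ m ∈ Finset.range (n + 1), Polynomial.C (aJ α β n m) * Polynomial.X ^ m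

def bJ (α β : ℝ) (n m : ℕ) : ℝ := if m < n + 1 then aJ α β n m else 0

lemma qJ_coeff (α β : ℝ) (n m : ℕ) : (qJ α β n).coeff m = bJ α β n m := by
  unfold qJ bJ
  rw [Polynomial.finsetSum_coeff]
  simp only [Polynomial.coeff_C_mul_X_pow]
  simp [Finset.sum_ite_eq]

lemma aJ_ne {α β : ℝ} (hα : -1 < α) (hβ : -1 < β) (n : ℕ) : aJ α β n n ≠ 0 := by
  unfold aJ
  split_ifs with h
  · exact one_ne_zero
  have hn : (1 : ℝ) ≤ n := by exact_mod_cast Nat.one_le_iff_ne_zero.2 h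
  have h1 : 0 < Real.Gamma (α + n + 1) := Real.Gamma_pos_of_pos (by linarith)
  have h2 : 0 < Real.Gamma (α + β + n + n + 1) := Real.Gamma_pos_of_pos (by linarith)
  have h3 : 0 < Real.Gamma (α + β + n + 1) := Real.Gamma_pos_of_pos (by linarith)
  positivity

lemma bJ_rec {α β : ℝ} (hα : -1 < α) (hβ : -1 < β) (n m : ℕ) :
    ((m : ℝ) + 1) * (m + 1 + α) * bJ α β n (m + 1) = (n - m) * (n + m + α + β + 1) * bJ α β n m := by
  unfold bJ
  rcases lt_trichotomy m n with h | h | h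
  · rw [if_pos (by omega), if_pos (by omega)]
    have hn0 : n ≠ 0 := by omega
    unfold aJ
    rw [if_neg hn0, if_neg hn0]
    obtain ⟨k, rfl⟩ := Nat.exists_eq_add_of_lt h
    have hm0 : (0 : ℝ) ≤ m := Nat.cast_nonneg m
    have hk0 : (0 : ℝ) ≤ k := Nat.cast_nonneg k
    have e1 : m + k + 1 - m = k + 1 := by omega
    have e2 : m + k + 1 - (m + 1) = k := by omega
    rw [e1, e2, Nat.factorial_succ, Nat.factorial_succ]
    push_cast
    have g1 : Real.Gamma (α + β + (m + k + 1) + (m + 1) + 1) =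
        (α + β + (m + k + 1) + m + 1) * Real.Gamma (α + β + (m + k + 1) + m + 1) := by
      rw [← Real.Gamma_add_one (by linarith)]
      congr 1; ring
    have g2 : Real.Gamma (α + (m + 1) + 1) = (α + m + 1) * Real.Gamma (α + m + 1) := by
      rw [← Real.Gamma_add_one (by linarith)]
      congr 1; ring
    rw [g1, g2]
    have h3 : 0 < Real.Gamma (α + β + (m + k + 1) + 1) := Real.Gamma_pos_of_pos (by linarith)
    have h4 : 0 < Real.Gamma (α + m + 1) := Real.Gamma_pos_of_pos (by linarith)
    have h5 : α + m + 1 ≠ 0 := by linarith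
    field_simp
    ring
  · subst h
    simp
  · rw [if_neg (by omega), if_neg (by omega)]
    simp

lemma qJ_degree {α β : ℝ} (hα : -1 < α) (hβ : -1 < β) (n : ℕ) : (qJ α β n).natDegree = n := by
  refine Polynomial.natDegree_eq_of_le_of_coeff_ne_zero ?_ ?_
  · rw [Polynomial.natDegree_le_iff_coeff_eq_zero]
    intro m hm
    rw [qJ_coeff, bJ, if_neg (by omega)]
  · rw [qJ_coeff, bJ, if_pos (by omega)]
    exact aJ_ne hα hβ n

open Polynomial in
lemma qJ_ode {α β : ℝ} (hα : -1 < α) (hβ : -1 < β) (n : ℕ) :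
    X * derivative (derivative (qJ α β n)) + X * (X * derivative (derivative (qJ α β n))) +
      C (α + 1) * derivative (qJ α β n) + C (α + β + 2) * (X * derivative (qJ α β n)) =
      C (jl α β n) * qJ α β n := by
  ext m
  have h := bJ_rec hα hβ n m
  unfold jl
  rcases m with _ | _ | m
  · simp [coeff_derivative, qJ_coeff] at h ⊢
    linarith
  · have hz : (X * derivative (derivative (qJ α β n))).coeff 0 = 0 := by simp
    simp only [zero_add, coeff_add, coeff_C_mul] at h ⊢
    have e1 := coeff_X_mul (derivative (derivative (qJ α β n))) 0
    have e2 := coeff_X_mul (X * derivative (derivative (qJ α β n))) 0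
    have e3 := coeff_X_mul (derivative (qJ α β n)) 0
    simp only [zero_add] at e1 e2 e3
    rw [e1, e2, e3, hz]
    simp only [coeff_derivative, qJ_coeff, zero_add] at h ⊢
    push_cast at h ⊢
    norm_num at h ⊢
    linarith
  · simp only [coeff_add, coeff_C_mul, coeff_X_mul, coeff_derivative, qJ_coeff] at h ⊢
    push_cast at h ⊢
    linarith

open Polynomial in
def jJ (α β : ℝ) (n : ℕ) : Polynomial ℝ := (qJ α β n).comp (C (1 / 2) * (X - 1))

open Polynomial in
lemma jJ_eval (α β : ℝ) (n : ℕ) (x : ℝ) : (jJ α β n).eval x = (qJ α β n).eval ((x - 1) / 2) := by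
  unfold jJ
  rw [eval_comp]
  congr 1
  simp
  ring

open Polynomial in
lemma jJ_degree {α β : ℝ} (hα : -1 < α) (hβ : -1 < β) (n : ℕ) : (jJ α β n).natDegree = n := by
  unfold jJ
  rw [natDegree_comp, qJ_degree hα hβ, natDegree_C_mul (by norm_num)]
  have : (X - 1 : Polynomial ℝ) = X - C 1 := by simp
  rw [this, natDegree_X_sub_C, mul_one]

lemma jJ_ne {α β : ℝ} (hα : -1 < α) (hβ : -1 < β) (n : ℕ) : jJ α β n ≠ 0 := by
  rcases Nat.eq_zero_or_pos n with h | h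
  · subst h
    intro h0
    have : (jJ α β 0).eval 1 = 1 := by
      rw [jJ_eval]
      simp [qJ, aJ]
    rw [h0] at this
    simp at this
  · intro h0
    have := jJ_degree hα hβ n
    rw [h0] at this
    simp at this
    omega

open Polynomial in
lemma jJ_ode {α β : ℝ} (hα : -1 < α) (hβ : -1 < β) (n : ℕ) (x : ℝ) :
    (1 - x ^ 2) * (jJ α β n).derivative.derivative.eval x +
    (β - α - (α + β + 2) * x) * (jJ α β n).derivative.eval x + jl α β n * (jJ α β n).eval x = 0 := by
  have h := congrArg (eval ((x - 1) / 2)) (qJ_ode hα hβ n)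
  have e : C (1 / 2 : ℝ) * (X - 1) = (C (1 / 2) * (X - 1) : Polynomial ℝ) := rfl
  have hd : derivative (C (1 / 2 : ℝ) * (X - 1)) = C (1 / 2) := by simp
  have hy : eval x (C (1 / 2 : ℝ) * (X - 1)) = (x - 1) / 2 := by
    simp
    ring
  have h1 : (jJ α β n).derivative = C (1 / 2) * (qJ α β n).derivative.comp (C (1 / 2) * (X - 1)) := by
    unfold jJ
    rw [derivative_comp, hd]
  have h2 : (jJ α β n).derivative.derivative =
      C (1 / 2) * (C (1 / 2) * (qJ α β n).derivative.derivative.comp (C (1 / 2) * (X - 1))) := by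
    rw [h1, derivative_C_mul, derivative_comp, hd]
  rw [h2, h1, jJ_eval, eval_C_mul, eval_C_mul, eval_comp, hy, eval_C_mul, eval_comp, hy]
  simp only [eval_add, eval_mul, eval_X, eval_C] at h ⊢
  linear_combination -h

def iJ (α β : ℝ) (n : ℕ) : ℝ := ∫ θ in 0..π, jW α β θ * ((jJ α β n).eval (cos θ)) ^ 2

lemma iJ_pos {α β : ℝ} (hα : -1 < α) (hβ : -1 < β) (n : ℕ) : 0 < iJ α β n := by
  unfold iJ
  have hc : Continuous fun θ : ℝ => (jJ α β n).eval (cos θ) :=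
    (jJ α β n).continuous.comp continuous_cos
  have hnn : ∀ θ ∈ Ioo 0 π, 0 ≤ jW α β θ * ((jJ α β n).eval (cos θ)) ^ 2 := fun θ hθ =>
    mul_nonneg (jW_pos α β hθ).le (sq_nonneg _)
  have hpos : 0 ≤ᵐ[volume.restrict (Ioc 0 π)] fun θ => jW α β θ * ((jJ α β n).eval (cos θ)) ^ 2 := by
    rw [← restrict_Ioo_eq_restrict_Ioc]
    exact (ae_restrict_iff' measurableSet_Ioo).2 (Filter.Eventually.of_forall hnn)
  rw [intervalIntegral.integral_pos_iff_support_of_nonneg_ae' (by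
    rw [uIoc_of_le pi_pos.le]; exact hpos) (jW_mul_int hα hβ (g := fun θ => (jJ α β n).eval (cos θ) ^ 2) (hc.pow 2))]
  refine ⟨pi_pos, ?_⟩
  have hopen : IsOpen ({θ : ℝ | (jJ α β n).eval (cos θ) ≠ 0} ∩ Ioo 0 π) :=
    (isOpen_ne_fun hc continuous_const).inter isOpen_Ioo
  have hne : ({θ : ℝ | (jJ α β n).eval (cos θ) ≠ 0} ∩ Ioo 0 π).Nonempty := by
    by_contra hemp
    rw [not_nonempty_iff_eq_empty] at hemp
    apply jJ_ne hα hβ n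
    refine Polynomial.eq_zero_of_infinite_isRoot _ ((Ioo_infinite (by norm_num : (-1 : ℝ) < 1)).mono ?_)
    intro x hx
    by_contra hr
    have : arccos x ∈ ({θ : ℝ | (jJ α β n).eval (cos θ) ≠ 0} ∩ Ioo 0 π) := by
      refine ⟨?_, arccos_pos.2 hx.2, ?_⟩
      · show (jJ α β n).eval (cos (arccos x)) ≠ 0
        rw [cos_arccos hx.1.le hx.2.le]
        exact hr
      · refine lt_of_le_of_ne (arccos_le_pi x) fun h => ?_
        rw [arccos_eq_pi] at h
        exact absurd hx.1 (not_lt.2 h)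
    rw [hemp] at this
    exact this
  refine lt_of_lt_of_le (hopen.measure_pos volume hne) (measure_mono ?_)
  rintro θ ⟨h1, h2⟩
  refine ⟨?_, h2.1, h2.2.le⟩
  exact mul_ne_zero (jW_pos α β h2).ne' (pow_ne_zero 2 h1)

def PJ (α β : ℝ) (n : ℕ) : Polynomial ℝ :=
  Polynomial.C ((iJ α β n) ^ (-(1 / 2) : ℝ)) * jJ α β n

lemma JSys_PJ {α β : ℝ} (hα : -1 < α) (hβ : -1 < β) : JSys α β (PJ α β) := by
  have hk : ∀ n, 0 < (iJ α β n) ^ (-(1 / 2) : ℝ) := fun n => Real.rpow_pos_of_pos (iJ_pos hα hβ n) _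
  refine ⟨hα, hβ, fun n => ?_, fun n x => ?_, fun n => ?_⟩
  · unfold PJ
    rw [Polynomial.degree_C_mul (hk n).ne', Polynomial.degree_eq_natDegree (jJ_ne hα hβ n),
      jJ_degree hα hβ]
  · unfold PJ
    have := jJ_ode hα hβ n x
    simp only [Polynomial.derivative_C_mul, Polynomial.eval_C_mul]
    linear_combination (iJ α β n) ^ (-(1 / 2) : ℝ) * this
  · have h1 : ∀ θ : ℝ, jW α β θ * (pj (PJ α β) n θ) ^ 2 = (iJ α β n)⁻¹ *
        (jW α β θ * ((jJ α β n).eval (cos θ)) ^ 2) := by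
      intro θ
      unfold pj PJ
      have : ((iJ α β n) ^ (-(1 / 2) : ℝ)) ^ 2 = (iJ α β n)⁻¹ := by
        rw [← Real.rpow_natCast, ← Real.rpow_mul (iJ_pos hα hβ n).le]
        norm_num
        exact Real.rpow_neg_one _
      rw [Polynomial.eval_C_mul, mul_pow, this]
      ring
    simp only [h1]
    rw [intervalIntegral.integral_const_mul]
    exact inv_mul_cancel₀ (ne_of_gt (iJ_pos hα hβ n))

/-- Correction factor for the degenerate case `n = 0`, `α+β+1 = 0`. -/
def qn (α β : ℝ) (n : ℕ) : ℝ := if n = 0 ∧ α + β + 1 = 0 then 0 else 1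

lemma jacobiP_eq {α β : ℝ} (hα : -1 < α) (hβ : -1 < β) (n : ℕ) (x : ℝ) :
    jacobiP α β n x = qn α β n * (jJ α β n).eval x := by
  rw [jJ_eval, qJ, Polynomial.eval_finsetSum]
  simp only [Polynomial.eval_C_mul, Polynomial.eval_pow, Polynomial.eval_X]
  unfold jacobiP qn aJ
  by_cases hn : n = 0
  · subst hn
    by_cases h : α + β + 1 = 0
    · simp [h]
    · have h1 : Real.Gamma (α + β + 1) ≠ 0 := by
        refine Real.Gamma_ne_zero fun m hm => ?_
        rcases Nat.eq_zero_or_pos m with h0 | h0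
        · subst h0
          simp at hm
          exact h hm
        · have : (1 : ℝ) ≤ m := by exact_mod_cast h0
          linarith
      have h2 : Real.Gamma (α + 1) ≠ 0 := (Real.Gamma_pos_of_pos (by linarith)).ne'
      simp [h]
      field_simp
  · simp [hn]

lemma measurePlus_integral {α β : ℝ} (f : ℝ → ℝ) :
    ∫ θ, f θ ∂(jacobiMeasurePlus α β) = ∫ θ in 0..π, jW α β θ * f θ := by
  rw [jacobiMeasurePlus_eq, integral_withDensity_eq_integral_toReal_smul₀
    ((jW_measurable α β).ennreal_ofReal.aemeasurable) (by simp),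
    intervalIntegral.integral_of_le pi_pos.le, integral_Ioc_eq_integral_Ioo]
  refine setIntegral_congr_fun measurableSet_Ioo fun θ hθ => ?_
  rw [ENNReal.toReal_ofReal (jW_pos α β hθ).le, smul_eq_mul]

lemma trigP_eq {α β : ℝ} (hα : -1 < α) (hβ : -1 < β) (n : ℕ) (θ : ℝ) :
    trigP α β n θ = qn α β n * pj (PJ α β) n θ := by
  unfold trigP
  by_cases h : n = 0 ∧ α + β + 1 = 0
  · rw [jacobiP_eq hα hβ]
    simp [qn, h]
  · have hq : qn α β n = 1 := by simp only [qn, if_neg h]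
    have : cJ α β n = (iJ α β n) ^ (-(1 / 2) : ℝ) := by
      unfold cJ
      rw [measurePlus_integral]
      unfold iJ
      simp only [jacobiP_eq hα hβ, hq, one_mul]
    rw [this, jacobiP_eq hα hβ, hq, one_mul, one_mul, pj, PJ, Polynomial.eval_C_mul]

/-! ### Part F: term-by-term differentiation -/

/-- `ct θ * sin θ`. -/
def kap (α β θ : ℝ) : ℝ := (α - β) + (α + β + 1) * cos θ

lemma kap_le (α β θ : ℝ) : |kap α β θ| ≤ jA α β := by
  unfold kap jA
  refine (abs_add_le _ _).trans ?_
  rw [abs_mul]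
  have := abs_cos_le_one θ
  have h2 := abs_nonneg (α + β + 1)
  nlinarith

lemma ct_mul_dj (α β : ℝ) (P : ℕ → Polynomial ℝ) (n : ℕ) {θ : ℝ} (hθ : θ ∈ Ioo 0 π) :
    ct α β θ * dj P n θ = -kap α β θ * ej P n θ := by
  have := ct_mul_sin α β hθ
  unfold dj kap
  linear_combination (-ej P n θ) * this

lemma jl_poly {α β : ℝ} (hα : -1 < α) (hβ : -1 < β) (n : ℕ) :
    |jl α β n| ≤ jK α β * (1 + (n : ℝ)) ^ 2 := by
  rw [abs_of_nonneg (jl_nonneg hα hβ n)]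
  refine (jl_le α β n).trans ?_
  have := jK_pos α β
  have hn : (0 : ℝ) ≤ n := Nat.cast_nonneg n
  gcongr
  linarith

namespace JSys
variable {α β : ℝ} {P : ℕ → Polynomial ℝ}

lemma rapid_fj (S : JSys α β P) {b : ℕ → ℝ} (hb : Rapid b) {θ : ℝ} (hθ : θ ∈ Ioo 0 π) {k : ℕ}
    (hk : k ≤ 2) : Rapid fun n => b n * fj P k n θ := by
  obtain ⟨Q, C, hC, h⟩ := S.poly_bound
  exact hb.mul_poly (h θ hθ k hk)

lemma rapid_jl (S : JSys α β P) {b : ℕ → ℝ} (hb : Rapid b) : Rapid fun n => b n * jl α β n :=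
  hb.mul_poly (jl_poly S.hα S.hβ)

lemma rapid_jl_pow (S : JSys α β P) {b : ℕ → ℝ} (hb : Rapid b) (p : ℕ) :
    Rapid fun n => b n * jl α β n ^ p := by
  induction p with
  | zero => simpa using hb
  | succ p ih =>
    have := S.rapid_jl ih
    simpa [pow_succ, mul_assoc] using this

end JSys

lemma Rapid.sum {b : ℕ → ℝ} (hb : Rapid b) : Summable b := by
  have := hb.summable 0
  simp only [pow_zero, mul_one] at this
  exact this.of_abs

namespace JSys
variable {α β : ℝ} {P : ℕ → Polynomial ℝ}

lemma hasDeriv0 (S : JSys α β P) {b : ℕ → ℝ} (hb : Rapid b) {θ : ℝ} (hθ : θ ∈ Ioo 0 π) :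
    HasDerivAt (fun θ => ∑' n, b n * fj P 0 n θ) (∑' n, b n * fj P 1 n θ) θ := by
  obtain ⟨Q, C, hC, h⟩ := S.poly_bound
  refine hasDerivAt_tsum_of_isPreconnected (u := fun n : ℕ => C * (|b n| * (1 + (n : ℝ)) ^ Q))
    (t := Ioo 0 π) (y₀ := θ) (g := fun n y => b n * fj P 0 n y) (g' := fun n y => b n * fj P 1 n y)
    ((hb.summable Q).mul_left C) isOpen_Ioo isPreconnected_Ioo ?_ ?_ hθ
    (S.rapid_fj hb hθ (by norm_num)).sum hθ
  · intro n y hy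
    simp only [fj_zero, fj_one]
    exact (pj_hasDerivAt P n y).const_mul _
  · intro n y hy
    rw [Real.norm_eq_abs, abs_mul]
    have := h y hy 1 (by norm_num) n
    calc |b n| * |fj P 1 n y| ≤ |b n| * (C * (1 + (n : ℝ)) ^ Q) := by gcongr
      _ = _ := by ring

lemma hasDeriv1 (S : JSys α β P) {b : ℕ → ℝ} (hb : Rapid b) {θ : ℝ} (hθ : θ ∈ Ioo 0 π) :
    HasDerivAt (fun θ => ∑' n, b n * fj P 1 n θ)
      (-(∑' n, (b n * jl α β n) * fj P 0 n θ) + kap α β θ * ∑' n, b n * fj P 2 n θ) θ := by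
  obtain ⟨Q, C, hC, h⟩ := S.poly_bound
  have hjl := S.rapid_jl hb
  have key := hasDerivAt_tsum_of_isPreconnected
    (u := fun n : ℕ => C * (|b n * jl α β n| * (1 + (n : ℝ)) ^ Q) +
      jA α β * C * (|b n| * (1 + (n : ℝ)) ^ Q))
    (t := Ioo 0 π) (y₀ := θ) (g := fun n y => b n * fj P 1 n y)
    (g' := fun n y => -((b n * jl α β n) * fj P 0 n y) + kap α β y * (b n * fj P 2 n y))
    (((hjl.summable Q).mul_left C).add ((hb.summable Q).mul_left (jA α β * C)))
    isOpen_Ioo isPreconnected_Ioo ?_ ?_ hθ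
    (S.rapid_fj hb hθ (by norm_num)).sum hθ
  · refine key.congr_deriv ?_
    rw [Summable.tsum_add, tsum_neg, tsum_mul_left]
    · exact (S.rapid_fj hjl hθ (by norm_num)).sum.neg
    · exact (S.rapid_fj hb hθ (by norm_num)).sum.mul_left _
  · intro n y hy
    simp only [fj_zero, fj_one, fj_two]
    refine ((S.dj_hasDerivAt n hy).const_mul (b n)).congr_deriv ?_
    rw [ct_mul_dj α β P n hy]
    ring
  · intro n y hy
    rw [Real.norm_eq_abs]
    refine (abs_add_le _ _).trans ?_
    rw [abs_neg, abs_mul, abs_mul (kap α β y), abs_mul (b n) (fj P 2 n y)]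
    have h0 := h y hy 0 (by norm_num) n
    have h2 := h y hy 2 (by norm_num) n
    have h3 := kap_le α β y
    have h4 := jA_nonneg α β
    calc |b n * jl α β n| * |fj P 0 n y| + |kap α β y| * (|b n| * |fj P 2 n y|)
        ≤ |b n * jl α β n| * (C * (1 + (n : ℝ)) ^ Q) + jA α β * (|b n| * (C * (1 + (n : ℝ)) ^ Q)) := by
          gcongr
      _ = _ := by ring

/-- In terms of `ct`. -/
lemma hasDeriv1' (S : JSys α β P) {b : ℕ → ℝ} (hb : Rapid b) {θ : ℝ} (hθ : θ ∈ Ioo 0 π) :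
    kap α β θ * ∑' n, b n * fj P 2 n θ = -ct α β θ * ∑' n, b n * fj P 1 n θ := by
  rw [← tsum_mul_left, ← tsum_mul_left]
  refine tsum_congr fun n => ?_
  have := ct_mul_dj α β P n hθ
  rw [fj_one, fj_two]
  linear_combination (b n) * this

lemma deltaEven_series (S : JSys α β P) {b : ℕ → ℝ} (hb : Rapid b) (N : ℕ) :
    ∀ f : ℝ → ℝ, (∀ θ ∈ Ioo 0 π, f θ = ∑' n, b n * fj P 0 n θ) → ∀ θ ∈ Ioo 0 π,
    deltaEven α β N f θ = ∑' n, (b n * jl α β n ^ (N / 2)) * fj P (N % 2) n θ := by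
  intro f hf
  induction N with
  | zero =>
    intro θ hθ
    simpa [deltaEven] using hf θ hθ
  | succ N ih =>
    intro θ hθ
    have hbN := S.rapid_jl_pow hb (N / 2)
    have hev : deltaEven α β N f =ᶠ[nhds θ]
        fun θ => ∑' n, (b n * jl α β n ^ (N / 2)) * fj P (N % 2) n θ := by
      filter_upwards [isOpen_Ioo.mem_nhds hθ] with y hy using ih y hy
    rcases Nat.mod_two_eq_zero_or_one N with h | h
    · have e1 : (N + 1) % 2 = 1 := by omega
      have e2 : (N + 1) / 2 = N / 2 := by omega
      rw [e1, e2]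
      show (if N % 2 = 0 then deriv else delStar α β) (deltaEven α β N f) θ = _
      rw [if_pos h, hev.deriv_eq, h]
      exact (S.hasDeriv0 hbN hθ).deriv
    · have e1 : (N + 1) % 2 = 0 := by omega
      have e2 : (N + 1) / 2 = N / 2 + 1 := by omega
      rw [e1, e2]
      show (if N % 2 = 0 then deriv else delStar α β) (deltaEven α β N f) θ = _
      rw [if_neg (by omega)]
      unfold delStar
      rw [hev.deriv_eq, hev.eq_of_nhds, h, (S.hasDeriv1 hbN hθ).deriv, S.hasDeriv1' hbN hθ]
      have : ∀ n, b n * jl α β n ^ (N / 2 + 1) * fj P 0 n θ =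
          b n * jl α β n ^ (N / 2) * jl α β n * fj P 0 n θ := fun n => by ring
      simp only [this]
      unfold ct
      ring

/-- The vanishing property transfers to derivatives. -/
lemma zero_transfer (S : JSys α β P) {A : ℝ} {w : ℕ → ℝ} (hw : Rapid w)
    (hz : ∀ θ ∈ Ioo 0 π, ∀ φ ∈ Ioo 0 π, A < |θ - φ| →
      ∑' n, w n * (fj P 0 n θ * fj P 0 n φ) = 0) :
    (∀ θ ∈ Ioo 0 π, ∀ φ ∈ Ioo 0 π, A < |θ - φ| →
      ∑' n, (w n * jl α β n) * (fj P 0 n θ * fj P 0 n φ) = 0) ∧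
    ∀ θ ∈ Ioo 0 π, ∀ φ ∈ Ioo 0 π, A < |θ - φ| → ∀ k ≤ 2, ∀ l ≤ 2,
      ∑' n, w n * (fj P k n θ * fj P l n φ) = 0 := by
  have re1 : ∀ (k l : ℕ) (θ φ : ℝ), ∑' n, w n * (fj P k n θ * fj P l n φ) =
      ∑' n, (w n * fj P l n φ) * fj P k n θ := fun k l θ φ => tsum_congr fun n => by ring
  have re2 : ∀ (k l : ℕ) (θ φ : ℝ), ∑' n, w n * (fj P k n θ * fj P l n φ) =
      ∑' n, (w n * fj P k n θ) * fj P l n φ := fun k l θ φ => tsum_congr fun n => by ring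
  -- nearby points
  have near1 : ∀ θ ∈ Ioo 0 π, ∀ φ : ℝ, A < |θ - φ| →
      ∀ᶠ y in nhds θ, y ∈ Ioo 0 π ∧ A < |y - φ| := by
    intro θ hθ φ hd
    have ho : IsOpen {y : ℝ | A < |y - φ|} :=
      isOpen_lt continuous_const (continuous_id.sub continuous_const).abs
    filter_upwards [isOpen_Ioo.mem_nhds hθ, ho.mem_nhds hd] with y h1 h2 using ⟨h1, h2⟩
  have near2 : ∀ θ : ℝ, ∀ φ ∈ Ioo 0 π, A < |θ - φ| →
      ∀ᶠ y in nhds φ, y ∈ Ioo 0 π ∧ A < |θ - y| := by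
    intro θ φ hφ hd
    have ho : IsOpen {y : ℝ | A < |θ - y|} :=
      isOpen_lt continuous_const (continuous_const.sub continuous_id).abs
    filter_upwards [isOpen_Ioo.mem_nhds hφ, ho.mem_nhds hd] with y h1 h2 using ⟨h1, h2⟩
  have d1 : ∀ θ ∈ Ioo 0 π, ∀ φ ∈ Ioo 0 π, A < |θ - φ| →
      ∑' n, w n * (fj P 1 n θ * fj P 0 n φ) = 0 := by
    intro θ hθ φ hφ hd
    have hr := S.rapid_fj hw hφ (k := 0) (by norm_num)
    rw [re1, ← (S.hasDeriv0 hr hθ).deriv]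
    have : (fun θ => ∑' n, (w n * fj P 0 n φ) * fj P 0 n θ) =ᶠ[nhds θ] fun _ => 0 := by
      filter_upwards [near1 θ hθ φ hd] with y hy
      rw [← re1]
      exact hz y hy.1 φ hφ hy.2
    rw [this.deriv_eq, deriv_const]
  have d2 : ∀ θ ∈ Ioo 0 π, ∀ φ ∈ Ioo 0 π, A < |θ - φ| →
      ∑' n, w n * (fj P 2 n θ * fj P 0 n φ) = 0 := by
    intro θ hθ φ hφ hd
    have hs : sin θ ≠ 0 := (sin_pos_of_mem_Ioo hθ).ne'
    have h := d1 θ hθ φ hφ hd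
    have e : ∀ n, w n * (fj P 1 n θ * fj P 0 n φ) = -sin θ * (w n * (fj P 2 n θ * fj P 0 n φ)) := by
      intro n
      rw [fj_one, fj_two, dj]
      ring
    simp only [e] at h
    rw [tsum_mul_left] at h
    exact (mul_eq_zero.1 h).resolve_left (neg_ne_zero.2 hs)
  have dk : ∀ k ≤ 2, ∀ θ ∈ Ioo 0 π, ∀ φ ∈ Ioo 0 π, A < |θ - φ| →
      ∑' n, w n * (fj P k n θ * fj P 0 n φ) = 0 := by
    intro k hk
    interval_cases k
    · exact hz
    · exact d1
    · exact d2
  refine ⟨fun θ hθ φ hφ hd => ?_, fun θ hθ φ hφ hd k hk => ?_⟩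
  · have hr := S.rapid_fj hw hφ (k := 0) (by norm_num)
    have h1 := (S.hasDeriv1 hr hθ).deriv
    have : (fun θ => ∑' n, (w n * fj P 0 n φ) * fj P 1 n θ) =ᶠ[nhds θ] fun _ => 0 := by
      filter_upwards [near1 θ hθ φ hd] with y hy
      rw [← re1]
      exact d1 y hy.1 φ hφ hy.2
    rw [this.deriv_eq, deriv_const, ← re1, d2 θ hθ φ hφ hd, mul_zero, add_zero] at h1
    refine Eq.trans (tsum_congr fun n => ?_) (neg_eq_zero.1 h1.symm)
    ring
  · have l1 : ∀ φ ∈ Ioo 0 π, A < |θ - φ| → ∑' n, w n * (fj P k n θ * fj P 1 n φ) = 0 := by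
      intro φ hφ hd
      have hr := S.rapid_fj hw hθ hk
      rw [re2, ← (S.hasDeriv0 hr hφ).deriv]
      have : (fun φ => ∑' n, (w n * fj P k n θ) * fj P 0 n φ) =ᶠ[nhds φ] fun _ => 0 := by
        filter_upwards [near2 θ φ hφ hd] with y hy
        rw [← re2]
        exact dk k hk θ hθ y hy.1 hy.2
      rw [this.deriv_eq, deriv_const]
    intro l hl
    interval_cases l
    · exact dk k hk θ hθ φ hφ hd
    · exact l1 φ hφ hd
    · have hs : sin φ ≠ 0 := (sin_pos_of_mem_Ioo hφ).ne'
      have h := l1 φ hφ hd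
      have e : ∀ n, w n * (fj P k n θ * fj P 1 n φ) = -sin φ * (w n * (fj P k n θ * fj P 2 n φ)) := by
        intro n
        rw [fj_one, fj_two, dj]
        ring
      simp only [e] at h
      rw [tsum_mul_left] at h
      exact (mul_eq_zero.1 h).resolve_left (neg_ne_zero.2 hs)

lemma zero_all (S : JSys α β P) {A : ℝ} {w : ℕ → ℝ} (hw : Rapid w)
    (hz : ∀ θ ∈ Ioo 0 π, ∀ φ ∈ Ioo 0 π, A < |θ - φ| →
      ∑' n, w n * (fj P 0 n θ * fj P 0 n φ) = 0) (p : ℕ) {θ φ : ℝ} (hθ : θ ∈ Ioo 0 π)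
    (hφ : φ ∈ Ioo 0 π) (hd : A < |θ - φ|) {k l : ℕ} (hk : k ≤ 2) (hl : l ≤ 2) :
      ∑' n, (w n * jl α β n ^ p) * (fj P k n θ * fj P l n φ) = 0 := by
  have h : ∀ p : ℕ, ∀ θ ∈ Ioo 0 π, ∀ φ ∈ Ioo 0 π, A < |θ - φ| →
      ∑' n, (w n * jl α β n ^ p) * (fj P 0 n θ * fj P 0 n φ) = 0 := by
    intro p
    induction p with
    | zero => simpa using hz
    | succ p ih =>
      have := (S.zero_transfer (S.rapid_jl_pow hw p) ih).1
      simpa only [pow_succ, mul_assoc] using this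
  exact (S.zero_transfer (S.rapid_jl_pow hw p) (h p)).2 θ hθ φ hφ hd k hk l hl

end JSys

/-! ### Part F2: the kernels as series -/

/-- `√λ_n`. -/
def xJ (α β : ℝ) (n : ℕ) : ℝ := Real.sqrt (jLam α β n)

lemma xJ_eq (α β : ℝ) (n : ℕ) : xJ α β n = |(n : ℝ) + (α + β + 1) / 2| := by
  unfold xJ jLam
  rw [Real.sqrt_sq_eq_abs]

lemma xJ_nonneg (α β : ℝ) (n : ℕ) : 0 ≤ xJ α β n := Real.sqrt_nonneg _

lemma xJ_sq (α β : ℝ) (n : ℕ) : xJ α β n ^ 2 = jl α β n + ((α + β + 1) / 2) ^ 2 := by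
  rw [xJ_eq, sq_abs]
  unfold jl
  ring

lemma jl_le_xJ (α β : ℝ) (n : ℕ) : jl α β n ≤ xJ α β n ^ 2 := by
  rw [xJ_sq]
  nlinarith [sq_nonneg ((α + β + 1) / 2)]

lemma xJ_ge {α β : ℝ} (hα : -1 < α) (hβ : -1 < β) (n : ℕ) : (n : ℝ) / 2 ≤ xJ α β n := by
  rcases Nat.eq_zero_or_pos n with h | h
  · subst h
    simpa using xJ_nonneg α β 0
  · have : (1 : ℝ) ≤ n := by exact_mod_cast h
    rw [xJ_eq]
    exact le_trans (by linarith) (le_abs_self _)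

lemma xJ_le (α β : ℝ) (n : ℕ) :
    |xJ α β n| ≤ (1 + |(α + β + 1) / 2|) * (1 + (n : ℝ)) ^ 1 := by
  rw [abs_of_nonneg (xJ_nonneg α β n), xJ_eq, pow_one]
  refine (abs_add_le _ _).trans ?_
  have hn : (0 : ℝ) ≤ n := Nat.cast_nonneg n
  rw [abs_of_nonneg hn]
  nlinarith [abs_nonneg ((α + β + 1) / 2)]

lemma xJ_gap {α β : ℝ} (hα : -1 < α) (hβ : -1 < β) :
    ∃ c : ℝ, 0 < c ∧ ∀ n, xJ α β n ≠ 0 → c ≤ xJ α β n := by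
  by_cases h : (α + β + 1) / 2 = 0
  · refine ⟨1 / 2, by norm_num, fun n hn => ?_⟩
    have : n ≠ 0 := by
      rintro rfl
      apply hn
      rw [xJ_eq, h]
      simp
    have : (1 : ℝ) ≤ n := by exact_mod_cast Nat.one_le_iff_ne_zero.2 this
    exact le_trans (by linarith) (xJ_ge hα hβ n)
  · refine ⟨min (1 / 2) |(α + β + 1) / 2|, lt_min (by norm_num) (abs_pos.2 h), fun n _ => ?_⟩
    rcases Nat.eq_zero_or_pos n with h0 | h0
    · subst h0
      rw [xJ_eq]
      simp
    · have : (1 : ℝ) ≤ n := by exact_mod_cast h0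
      refine (min_le_left _ _).trans (le_trans (by linarith) (xJ_ge hα hβ n))

lemma rapid_exp {α β : ℝ} (hα : -1 < α) (hβ : -1 < β) {t : ℝ} (ht : 0 < t) :
    Rapid fun n => Real.exp (-t * xJ α β n) := by
  intro Q
  refine ⟨Q.factorial * (2 / t) ^ Q * Real.exp (t / 2), fun n => ?_⟩
  have hn : (0 : ℝ) ≤ n := Nat.cast_nonneg n
  have h1 := Real.pow_div_factorial_le_exp (t / 2 * (1 + n)) (by positivity) Q
  have hf : (0 : ℝ) < Q.factorial := by positivity
  rw [div_le_iff₀ hf, mul_pow] at h1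
  have h2 : (1 + (n : ℝ)) ^ Q ≤ (2 / t) ^ Q * (Real.exp (t / 2 * (1 + n)) * Q.factorial) := by
    calc (1 + (n : ℝ)) ^ Q = (2 / t) ^ Q * ((t / 2) ^ Q * (1 + (n : ℝ)) ^ Q) := by
          rw [← mul_assoc, ← mul_pow]
          have : 2 / t * (t / 2) = 1 := by field_simp
          rw [this]; simp
      _ ≤ _ := by gcongr
  rw [abs_of_pos (Real.exp_pos _)]
  have h3 : Real.exp (-t * xJ α β n) ≤ Real.exp (-(t / 2 * n)) := by
    apply Real.exp_le_exp.2
    nlinarith [xJ_ge hα hβ n]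
  calc Real.exp (-t * xJ α β n) * (1 + (n : ℝ)) ^ Q
      ≤ Real.exp (-(t / 2 * n)) * ((2 / t) ^ Q * (Real.exp (t / 2 * (1 + n)) * Q.factorial)) := by
        gcongr
    _ = Q.factorial * (2 / t) ^ Q * (Real.exp (-(t / 2 * n)) * Real.exp (t / 2 * (1 + n))) := by
        ring
    _ = _ := by
        rw [← Real.exp_add]
        congr 2
        ring

/-- Polynomially bounded sequences. -/
def PolyB (w : ℕ → ℝ) : Prop := ∃ Q : ℕ, ∃ C : ℝ, ∀ n : ℕ, |w n| ≤ C * (1 + (n : ℝ)) ^ Q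

lemma PolyB.mul {v w : ℕ → ℝ} (hv : PolyB v) (hw : PolyB w) : PolyB fun n => v n * w n := by
  obtain ⟨Q, C, h⟩ := hv
  obtain ⟨Q', C', h'⟩ := hw
  refine ⟨Q + Q', C * C', fun n => ?_⟩
  rw [abs_mul, pow_add]
  calc |v n| * |w n| ≤ (C * (1 + (n : ℝ)) ^ Q) * (C' * (1 + (n : ℝ)) ^ Q') :=
        mul_le_mul (h n) (h' n) (abs_nonneg _) ((abs_nonneg _).trans (h n))
    _ = _ := by ring

lemma PolyB.const (c : ℝ) : PolyB fun _ => c := ⟨0, |c|, fun n => by simp⟩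

lemma PolyB.pow {v : ℕ → ℝ} (hv : PolyB v) (p : ℕ) : PolyB fun n => v n ^ p := by
  induction p with
  | zero => simpa using PolyB.const 1
  | succ p ih => simpa [pow_succ] using ih.mul hv

lemma PolyB.neg {v : ℕ → ℝ} (hv : PolyB v) : PolyB fun n => -v n := by
  simpa using (PolyB.const (-1)).mul hv

lemma Rapid.mulP {F g : ℕ → ℝ} (h : Rapid F) (hg : PolyB g) : Rapid fun n => F n * g n := by
  obtain ⟨Q, C, hg⟩ := hg
  exact h.mul_poly hg

lemma polyB_xJ (α β : ℝ) : PolyB (xJ α β) := ⟨1, _, xJ_le α β⟩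

lemma polyB_jl {α β : ℝ} (hα : -1 < α) (hβ : -1 < β) : PolyB (jl α β) := ⟨2, _, jl_poly hα hβ⟩

lemma polyB_qn (α β : ℝ) : PolyB (qn α β) := ⟨0, 1, fun n => by unfold qn; split_ifs <;> simp⟩

lemma JSys.polyB_fj {α β : ℝ} {P : ℕ → Polynomial ℝ} (S : JSys α β P) {θ : ℝ} (hθ : θ ∈ Ioo 0 π)
    {k : ℕ} (hk : k ≤ 2) : PolyB fun n => fj P k n θ := by
  obtain ⟨Q, C, -, h⟩ := S.poly_bound
  exact ⟨Q, C, h θ hθ k hk⟩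

lemma hasDerivAt_expSeries {α β : ℝ} (hα : -1 < α) (hβ : -1 < β) {w : ℕ → ℝ} (hw : PolyB w)
    {t : ℝ} (ht : 0 < t) :
    HasDerivAt (fun s => ∑' n, w n * Real.exp (-s * xJ α β n))
      (∑' n, (w n * -xJ α β n) * Real.exp (-t * xJ α β n)) t := by
  have hr := (rapid_exp hα hβ (half_pos ht)).mulP (hw.mul (polyB_xJ α β))
  have hs := hr.summable 0
  simp only [pow_zero, mul_one] at hs
  refine hasDerivAt_tsum_of_isPreconnected
    (u := fun n : ℕ => |Real.exp (-(t / 2) * xJ α β n) * (w n * xJ α β n)|)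
    (t := Ioi (t / 2)) (y₀ := t) (g := fun n s => w n * Real.exp (-s * xJ α β n))
    (g' := fun n s => (w n * -xJ α β n) * Real.exp (-s * xJ α β n))
    hs isOpen_Ioi isPreconnected_Ioi ?_ ?_ (by simp [ht]) ?_ (by simp [ht])
  · intro n y hy
    have : HasDerivAt (fun s => -s * xJ α β n) (-1 * xJ α β n) y :=
      (hasDerivAt_id y).neg.mul_const _
    refine (this.exp.const_mul (w n)).congr_deriv ?_
    ring
  · intro n y hy
    have hy' : t / 2 < y := hy
    have hx := xJ_nonneg α β n
    rw [Real.norm_eq_abs, abs_mul, abs_mul, abs_mul, abs_mul, abs_neg, abs_of_pos (Real.exp_pos _),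
      abs_of_pos (Real.exp_pos _), mul_comm]
    gcongr
  · exact ((rapid_exp hα hβ ht).mulP hw).sum.congr fun n => by ring

lemma iter_deriv_expSeries {α β : ℝ} (hα : -1 < α) (hβ : -1 < β) (M : ℕ) :
    ∀ (w : ℕ → ℝ) (_ : PolyB w) (f : ℝ → ℝ)
    (_ : ∀ s > 0, f s = ∑' n, w n * Real.exp (-s * xJ α β n)) (t : ℝ), 0 < t →
    deriv^[M] f t = ∑' n, (w n * (-xJ α β n) ^ M) * Real.exp (-t * xJ α β n) := by
  induction M with
  | zero =>
    intro w hw f hf t ht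
    simpa using hf t ht
  | succ M ih =>
    intro w hw f hf t ht
    rw [Function.iterate_succ_apply]
    rw [ih (fun n => w n * -xJ α β n) (hw.mul (polyB_xJ α β).neg) (deriv f) ?_ t ht]
    · refine tsum_congr fun n => ?_
      rw [pow_succ]; ring
    · intro s hs
      have : f =ᶠ[nhds s] fun s => ∑' n, w n * Real.exp (-s * xJ α β n) := by
        filter_upwards [isOpen_Ioi.mem_nhds (show s ∈ Ioi (0 : ℝ) from hs)] with y hy
        exact hf y hy
      rw [this.deriv_eq]
      exact (hasDerivAt_expSeries hα hβ hw hs).deriv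

/-- The basic series. -/
def TT (α β : ℝ) (P : ℕ → Polynomial ℝ) (p M k l : ℕ) (t θ φ : ℝ) : ℝ :=
  ∑' n, (jl α β n ^ p * xJ α β n ^ M * Real.exp (-t * xJ α β n)) * (fj P k n θ * fj P l n φ)

namespace JSys
variable {α β : ℝ} {P : ℕ → Polynomial ℝ}

lemma rapid_TT (S : JSys α β P) (p M : ℕ) {t : ℝ} (ht : 0 < t) :
    Rapid fun n => jl α β n ^ p * xJ α β n ^ M * Real.exp (-t * xJ α β n) := by
  have := (rapid_exp S.hα S.hβ ht).mulP (((polyB_jl S.hα S.hβ).pow p).mul ((polyB_xJ α β).pow M))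
  simpa only [mul_comm] using this

lemma TT_theta0 (S : JSys α β P) (p M l : ℕ) (hl : l ≤ 2) {t θ φ : ℝ} (ht : 0 < t)
    (hθ : θ ∈ Ioo 0 π) (hφ : φ ∈ Ioo 0 π) :
    HasDerivAt (fun θ => TT α β P p M 0 l t θ φ) (TT α β P p M 1 l t θ φ) θ := by
  have := S.hasDeriv0 (S.rapid_fj (S.rapid_TT p M ht) hφ hl) hθ
  unfold TT
  refine (this.congr_deriv ?_).congr_of_eventuallyEq (Filter.Eventually.of_forall fun y => ?_)
  · exact tsum_congr fun n => by ring
  · exact tsum_congr fun n => by ring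

lemma TT_phi0 (S : JSys α β P) (p M k : ℕ) (hk : k ≤ 2) {t θ φ : ℝ} (ht : 0 < t)
    (hθ : θ ∈ Ioo 0 π) (hφ : φ ∈ Ioo 0 π) :
    HasDerivAt (fun φ => TT α β P p M k 0 t θ φ) (TT α β P p M k 1 t θ φ) φ := by
  have := S.hasDeriv0 (S.rapid_fj (S.rapid_TT p M ht) hθ hk) hφ
  unfold TT
  refine (this.congr_deriv ?_).congr_of_eventuallyEq (Filter.Eventually.of_forall fun y => ?_)
  · exact tsum_congr fun n => by ring
  · exact tsum_congr fun n => by ring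

lemma TT_theta1 (S : JSys α β P) (p M l : ℕ) (hl : l ≤ 2) {t θ φ : ℝ} (ht : 0 < t)
    (hθ : θ ∈ Ioo 0 π) (hφ : φ ∈ Ioo 0 π) :
    HasDerivAt (fun θ => TT α β P p M 1 l t θ φ)
      (-TT α β P (p + 1) M 0 l t θ φ + kap α β θ * TT α β P p M 2 l t θ φ) θ := by
  have := S.hasDeriv1 (S.rapid_fj (S.rapid_TT p M ht) hφ hl) hθ
  unfold TT
  refine (this.congr_deriv ?_).congr_of_eventuallyEq (Filter.Eventually.of_forall fun y => ?_)
  · congr 2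
    · exact tsum_congr fun n => by ring
    · exact tsum_congr fun n => by ring
  · exact tsum_congr fun n => by ring

lemma TT_time (S : JSys α β P) (p k l : ℕ) (hk : k ≤ 2) (hl : l ≤ 2) {t θ φ : ℝ} (ht : 0 < t)
    (hθ : θ ∈ Ioo 0 π) (hφ : φ ∈ Ioo 0 π) :
    HasDerivAt (fun t => TT α β P p 0 k l t θ φ) (-TT α β P p 1 k l t θ φ) t := by
  have := hasDerivAt_expSeries S.hα S.hβ (((polyB_jl S.hα S.hβ).pow p).mul
    ((S.polyB_fj hθ hk).mul (S.polyB_fj hφ hl))) ht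
  unfold TT
  refine (this.congr_deriv ?_).congr_of_eventuallyEq (Filter.Eventually.of_forall fun y => ?_)
  · rw [← tsum_neg]
    exact tsum_congr fun n => by ring
  · exact tsum_congr fun n => by ring

lemma fj_n0 (S : JSys α β P) {k : ℕ} (hk : 1 ≤ k) (θ : ℝ) : fj P k 0 θ = 0 := by
  have h : ej P 0 θ = 0 := by
    unfold ej
    have := S.deg 0
    rw [Polynomial.eq_C_of_natDegree_le_zero (Polynomial.natDegree_eq_of_degree_eq_some this).le]
    simp
  unfold fj
  rw [if_neg (by omega)]
  split_ifs
  · unfold dj; rw [h]; simp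
  · exact h

end JSys

lemma kernel_series {α β : ℝ} (hα : -1 < α) (hβ : -1 < β) (M N : ℕ) (hMN : 0 < M + N)
    {t θ φ : ℝ} (ht : 0 < t) (hθ : θ ∈ Ioo 0 π) (hφ : φ ∈ Ioo 0 π) :
    deriv^[M] (fun s => deltaEven α β N (fun θ' => jHker α β s θ' φ) θ) t =
      (1 / 2) * (-1) ^ M * TT α β (PJ α β) (N / 2) M (N % 2) 0 t θ φ := by
  have S := JSys_PJ hα hβ
  have hN2 : N % 2 ≤ 2 := by omega
  set P := PJ α β with hP
  have hφP := S.polyB_fj hφ (k := 0) (by norm_num)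
  have hb : ∀ s > 0, Rapid fun n => Real.exp (-s * xJ α β n) *
      ((1 / 2) * (qn α β n * fj P 0 n φ)) := fun s hs =>
    (rapid_exp hα hβ hs).mulP ((PolyB.const (1 / 2)).mul ((polyB_qn α β).mul hφP))
  have hq : ∀ n, qn α β n * qn α β n = qn α β n := fun n => by unfold qn; split_ifs <;> simp
  have h1 : ∀ s > 0, deltaEven α β N (fun θ' => jHker α β s θ' φ) θ =
      ∑' n, ((1 / 2) * (qn α β n * fj P 0 n φ) * (jl α β n ^ (N / 2) * fj P (N % 2) n θ)) *
        Real.exp (-s * xJ α β n) := by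
    intro s hs
    rw [S.deltaEven_series (hb s hs) N _ _ θ hθ]
    · exact tsum_congr fun n => by ring
    · intro θ' hθ'
      unfold jHker
      rw [← tsum_mul_left]
      refine tsum_congr fun n => ?_
      rw [trigP_eq hα hβ, trigP_eq hα hβ, fj_zero, fj_zero]
      unfold xJ
      linear_combination (1 / 2 * Real.exp (-s * Real.sqrt (jLam α β n)) * pj P n θ' * pj P n φ) * hq n
  rw [iter_deriv_expSeries hα hβ M _ (((PolyB.const (1 / 2)).mul ((polyB_qn α β).mul hφP)).mul
    (((polyB_jl hα hβ).pow _).mul (S.polyB_fj hθ hN2))) _ h1 t ht]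
  unfold TT
  rw [← tsum_mul_left]
  refine tsum_congr fun n => ?_
  rw [neg_pow (xJ α β n) M]
  by_cases hn : n = 0 ∧ α + β + 1 = 0
  · obtain ⟨rfl, h0⟩ := hn
    have e : jl α β 0 ^ (N / 2) * xJ α β 0 ^ M * fj P (N % 2) 0 θ = 0 := by
      have hx : xJ α β 0 = 0 := by rw [xJ_eq, h0]; simp
      have hj : jl α β 0 = 0 := by unfold jl; simp
      by_cases hM : M = 0
      · by_cases hN : N / 2 = 0
        · rw [S.fj_n0 (by omega)]; simp
        · rw [hj, zero_pow hN]; simp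
      · rw [hx, zero_pow hM]; simp
    have : qn α β 0 = 0 := by unfold qn; simp [h0]
    rw [this]
    linear_combination (-(1 / 2) * (-1) ^ M * Real.exp (-t * xJ α β 0) * fj P 0 0 φ) * e
  · have : qn α β n = 1 := by unfold qn; rw [if_neg hn]
    rw [this]
    ring

/-! ### Part G: pointwise bounds for the series -/

lemma Rapid.sub {F G : ℕ → ℝ} (hF : Rapid F) (hG : Rapid G) : Rapid fun n => F n - G n := by
  intro Q
  obtain ⟨B, hB⟩ := hF Q
  obtain ⟨B', hB'⟩ := hG Q
  refine ⟨B + B', fun n => ?_⟩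
  have h := abs_sub (F n) (G n)
  have hp : (0 : ℝ) ≤ (1 + (n : ℝ)) ^ Q := by positivity
  nlinarith [hB n, hB' n, mul_le_mul_of_nonneg_right h hp]

namespace JSys
variable {α β : ℝ} {P : ℕ → Polynomial ℝ}

lemma TT_small (S : JSys α β P) (p M k l : ℕ) (hM : 1 ≤ M) (hk : k ≤ 2) (hl : l ≤ 2) :
    ∃ C : ℝ, 0 < C ∧ ∀ θ ∈ Ioo 0 π, ∀ φ ∈ Ioo 0 π, θ ≠ φ → ∀ t > 0,
      jV α β θ |θ - φ| * |TT α β P p M k l t θ φ| ≤ C * (|θ - φ| ^ (2 * p + M + (k + l)))⁻¹ := by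
  obtain ⟨Q, C0, hC0, H⟩ := S.sumAB
  obtain ⟨h, hc, hh⟩ := symbol_split_scaled hM
  obtain ⟨C1, hC1, hb⟩ := hh (Q + 2 * p)
  refine ⟨C0 * (C1 * 2 ^ Q), by positivity, ?_⟩
  intro θ hθ φ hφ hne t ht
  have hd : 0 < |θ - φ| := abs_pos.2 (sub_ne_zero.2 hne)
  have hdπ : |θ - φ| ≤ π := by
    rw [abs_le]; constructor <;> linarith [hθ.1, hθ.2, hφ.1, hφ.2]
  set d := |θ - φ| with hdd
  set F1 : ℕ → ℝ := fun n => ∫ s in (-(π / 5 * d))..(π / 5 * d), h d t s * cos (s * xJ α β n)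
    with hF1
  set F2 : ℕ → ℝ := fun n => xJ α β n ^ M * exp (-t * xJ α β n) - F1 n with hF2
  have hF2r : Rapid F2 := by
    intro Q'
    obtain ⟨C2, hC2, hb2⟩ := hh Q'
    refine ⟨C2 * (d ^ M)⁻¹ * (1 + 2 / d) ^ Q', fun n => ?_⟩
    have hx := xJ_nonneg α β n
    have h1 := hb2 d hd t ht _ hx
    have h2 : 1 + (n : ℝ) ≤ (1 + 2 / d) * (1 + d * xJ α β n) := by
      have : (1 + 2 / d) * (1 + d * xJ α β n) = 1 + d * xJ α β n + 2 / d + 2 * xJ α β n := by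
        field_simp
        ring
      rw [this]
      have := xJ_ge S.hα S.hβ n
      have h3 : 0 ≤ d * xJ α β n := by positivity
      have h4 : 0 ≤ 2 / d := by positivity
      linarith
    calc |F2 n| * (1 + (n : ℝ)) ^ Q'
        ≤ (C2 * (d ^ M)⁻¹ * ((1 + d * xJ α β n) ^ Q')⁻¹) *
          ((1 + 2 / d) * (1 + d * xJ α β n)) ^ Q' := by
          apply mul_le_mul h1 _ (by positivity) (by positivity)
          gcongr
      _ = _ := by
          rw [mul_pow]
          have : (1 + d * xJ α β n) ^ Q' ≠ 0 := by positivity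
          field_simp
  have hxr : Rapid fun n => xJ α β n ^ M * exp (-t * xJ α β n) := by
    have := S.rapid_TT 0 M ht
    simpa using this
  have hF1r : Rapid F1 := by
    have := hxr.sub hF2r
    simpa [hF2] using this
  have hz : ∀ θ ∈ Ioo 0 π, ∀ φ ∈ Ioo 0 π, π / 5 * d < |θ - φ| →
      ∑' n, F1 n * (fj P 0 n θ * fj P 0 n φ) = 0 := by
    intro θ' hθ' φ' hφ' hd'
    simp only [fj_zero]
    exact S.kernel_zero (sq_nonneg ((α + β + 1) / 2)) (xJ_sq α β) (hc d hd t ht)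
      (by positivity) hF1r hθ' hφ' hd'
  have hAd : π / 5 * d < |θ - φ| := by
    rw [← hdd]
    have := Real.pi_lt_four
    nlinarith
  have hz1 := S.zero_all hF1r hz p hθ hφ hAd hk hl
  have hs1 : Summable fun n => (F1 n * jl α β n ^ p) * (fj P k n θ * fj P l n φ) := by
    have := (S.rapid_fj (S.rapid_fj (S.rapid_jl_pow hF1r p) hθ hk) hφ hl).sum
    exact this.congr fun n => by ring
  have hs2 : Summable fun n => (F2 n * jl α β n ^ p) * (fj P k n θ * fj P l n φ) := by
    have := (S.rapid_fj (S.rapid_fj (S.rapid_jl_pow hF2r p) hθ hk) hφ hl).sum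
    exact this.congr fun n => by ring
  have hT : TT α β P p M k l t θ φ =
      ∑' n, (F2 n * jl α β n ^ p) * (fj P k n θ * fj P l n φ) := by
    have : TT α β P p M k l t θ φ = ∑' n, (F1 n * jl α β n ^ p) * (fj P k n θ * fj P l n φ) +
        ∑' n, (F2 n * jl α β n ^ p) * (fj P k n θ * fj P l n φ) := by
      rw [← hs1.tsum_add hs2]
      unfold TT
      refine tsum_congr fun n => ?_
      simp only [hF2]
      ring
    rw [this, hz1, zero_add]
  have hcn : ∀ n : ℕ, |F2 n * jl α β n ^ p| ≤
      (C1 * 2 ^ Q * (d ^ (2 * p + M))⁻¹) * ((1 + d * n) ^ Q)⁻¹ := by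
    intro n
    have hx := xJ_nonneg α β n
    have h1 := hb d hd t ht _ hx
    have hj0 := jl_nonneg S.hα S.hβ n
    have hdx : 0 ≤ d * xJ α β n := by positivity
    have h2 : jl α β n ^ p ≤ (d ^ (2 * p))⁻¹ * (1 + d * xJ α β n) ^ (2 * p) := by
      calc jl α β n ^ p ≤ (xJ α β n ^ 2) ^ p := by gcongr; exact jl_le_xJ α β n
        _ = (d ^ (2 * p))⁻¹ * (d * xJ α β n) ^ (2 * p) := by
            rw [mul_pow, ← pow_mul]; field_simp
        _ ≤ _ := by gcongr; linarith
    have h3 : ((1 + d * xJ α β n) ^ Q)⁻¹ ≤ 2 ^ Q * ((1 + d * n) ^ Q)⁻¹ := by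
      rw [← div_eq_mul_inv, inv_le_iff_one_le_mul₀ (by positivity), div_mul_eq_mul_div,
        one_le_div (by positivity), ← mul_pow]
      gcongr
      nlinarith [xJ_ge S.hα S.hβ n]
    rw [abs_mul, abs_of_nonneg (pow_nonneg hj0 p)]
    calc |F2 n| * jl α β n ^ p
        ≤ (C1 * (d ^ M)⁻¹ * ((1 + d * xJ α β n) ^ (Q + 2 * p))⁻¹) *
          ((d ^ (2 * p))⁻¹ * (1 + d * xJ α β n) ^ (2 * p)) :=
          mul_le_mul h1 h2 (by positivity) (by positivity)
      _ = C1 * (d ^ (2 * p + M))⁻¹ * ((1 + d * xJ α β n) ^ Q)⁻¹ := by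
          have : (1 + d * xJ α β n) ≠ 0 := by positivity
          rw [pow_add, pow_add]
          field_simp
      _ ≤ C1 * (d ^ (2 * p + M))⁻¹ * (2 ^ Q * ((1 + d * n) ^ Q)⁻¹) :=
          mul_le_mul_of_nonneg_left h3 (by positivity)
      _ = _ := by ring
  have hfin := (H θ hθ φ hφ d hd hdπ le_rfl k hk l hl _ _ hcn).2
  rw [← hT] at hfin
  have hdk : 0 < d ^ (k + l) := by positivity
  calc jV α β θ d * |TT α β P p M k l t θ φ|
      = (jV α β θ d * (d ^ (k + l) * |TT α β P p M k l t θ φ|)) * (d ^ (k + l))⁻¹ := by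
        field_simp
    _ ≤ (C0 * (C1 * 2 ^ Q * (d ^ (2 * p + M))⁻¹)) * (d ^ (k + l))⁻¹ := by gcongr
    _ = _ := by rw [pow_add d (2 * p + M)]; field_simp

lemma jeps_le_one (α β : ℝ) : jeps α β ≤ 1 := by
  unfold jeps
  linarith [min_le_left 0 (min (2 * α + 1) (2 * β + 1))]

lemma TT_large (S : JSys α β P) (p M k l : ℕ) (hnd : 1 ≤ p + M + k) (hk : k ≤ 2) (hl : l ≤ 2) :
    ∃ C : ℝ, 0 < C ∧ ∀ θ ∈ Ioo 0 π, ∀ φ ∈ Ioo 0 π, θ ≠ φ → ∀ t, |θ - φ| ≤ t →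
      jV α β θ |θ - φ| * |TT α β P p M k l t θ φ| ≤
        C * ((t ^ (2 * p + M + (k + l)))⁻¹ * (|θ - φ| / t) ^ jeps α β) := by
  have hπ := Real.pi_pos
  obtain ⟨Q, C0, hC0, H⟩ := S.sumAB
  obtain ⟨c0, hc0, hgap⟩ := xJ_gap S.hα S.hβ
  set c2 := min 1 (c0 * π) with hc2d
  have hc2 : 0 < c2 := lt_min one_pos (by positivity)
  set a := 2 * p + M with ha
  set E := k + l + 1 with hE
  set C1 : ℝ := (a + (Q + E)).factorial * Real.exp 1 with hC1d
  have hC1 : 0 < C1 := by positivity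
  set D := (3 : ℝ) ^ jD α β with hDd
  have hD : 0 < D := Real.rpow_pos_of_pos (by norm_num) _
  refine ⟨D * (C0 * (C1 * 2 ^ Q * (c2 ^ E)⁻¹)), by positivity, ?_⟩
  intro θ hθ φ hφ hne t hdt
  have hd : 0 < |θ - φ| := abs_pos.2 (sub_ne_zero.2 hne)
  have hdπ : |θ - φ| ≤ π := by
    rw [abs_le]; constructor <;> linarith [hθ.1, hθ.2, hφ.1, hφ.2]
  set d := |θ - φ| with hdd
  have ht : 0 < t := by linarith
  set R := min t π with hR
  have hR0 : 0 < R := lt_min ht hπ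
  have hRt : R ≤ t := min_le_left _ _
  have hRπ : R ≤ π := min_le_right _ _
  have hdR : d ≤ R := le_min hdt hdπ
  set c : ℕ → ℝ := fun n => if xJ α β n = 0 then 0 else
    jl α β n ^ p * xJ α β n ^ M * Real.exp (-t * xJ α β n) with hc
  have hT : TT α β P p M k l t θ φ = ∑' n, c n * (fj P k n θ * fj P l n φ) := by
    unfold TT
    refine tsum_congr fun n => ?_
    simp only [hc]
    split_ifs with h0
    · have hn : n = 0 := by
        have := xJ_ge S.hα S.hβ n
        rw [h0] at this
        by_contra h
        have : (1 : ℝ) ≤ n := by exact_mod_cast Nat.one_le_iff_ne_zero.2 h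
        linarith
      subst hn
      have hj : jl α β 0 = 0 := by unfold jl; simp
      have e : jl α β 0 ^ p * xJ α β 0 ^ M * fj P k 0 θ = 0 := by
        by_cases hM : M = 0
        · by_cases hN : p = 0
          · rw [S.fj_n0 (by omega)]; simp
          · rw [hj, zero_pow hN]; simp
        · rw [h0, zero_pow hM]; simp
      linear_combination (Real.exp (-t * xJ α β 0) * fj P l 0 φ) * e
    · rfl
  have hcn : ∀ n : ℕ, |c n| ≤
      (C1 * 2 ^ Q * (c2 ^ E)⁻¹ * ((t ^ a)⁻¹ * (R / t) ^ E)) * ((1 + R * n) ^ Q)⁻¹ := by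
    intro n
    have hx := xJ_nonneg α β n
    have hj0 := jl_nonneg S.hα S.hβ n
    simp only [hc]
    split_ifs with h0
    · rw [abs_zero]; positivity
    rw [abs_of_nonneg (by positivity)]
    set x := xJ α β n with hxd
    set y := t * x with hy
    have hy0 : 0 ≤ y := by positivity
    have hxc := hgap n h0
    have k1 : c2 * t / R ≤ 1 + y := by
      rw [div_le_iff₀ hR0]
      rcases le_total t π with h | h
      · have : R = t := min_eq_left h
        rw [this]
        have : c2 ≤ 1 := min_le_left _ _
        nlinarith
      · have : R = π := min_eq_right h
        rw [this]
        have h1 : c2 ≤ c0 * π := min_le_right _ _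
        calc c2 * t ≤ c0 * π * t := by gcongr
          _ ≤ x * π * t := by gcongr
          _ ≤ (1 + y) * π := by rw [hy]; nlinarith
    have k2 : 1 + R * n ≤ 2 * (1 + y) := by
      have h1 := xJ_ge S.hα S.hβ n
      have : R * n ≤ t * (2 * x) := by
        apply mul_le_mul hRt _ (by positivity) ht.le
        linarith
      rw [hy]; linarith
    have k3 : jl α β n ^ p * x ^ M ≤ (t ^ a)⁻¹ * (1 + y) ^ a := by
      calc jl α β n ^ p * x ^ M ≤ (x ^ 2) ^ p * x ^ M := by gcongr; exact jl_le_xJ α β n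
        _ = (t ^ a)⁻¹ * y ^ a := by
            rw [hy, mul_pow, ← pow_mul, ← pow_add, ← ha]; field_simp
        _ ≤ _ := by gcongr; linarith
    have k4 : (1 + y) ^ (a + (Q + E)) * Real.exp (-y) ≤ C1 := by
      have h1 := Real.pow_div_factorial_le_exp (1 + y) (by positivity) (a + (Q + E))
      have hf : (0 : ℝ) < (a + (Q + E)).factorial := by positivity
      rw [div_le_iff₀ hf] at h1
      calc (1 + y) ^ (a + (Q + E)) * Real.exp (-y)
          ≤ (Real.exp (1 + y) * (a + (Q + E)).factorial) * Real.exp (-y) := by gcongr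
        _ = (a + (Q + E)).factorial * (Real.exp (1 + y) * Real.exp (-y)) := by ring
        _ = C1 := by rw [← Real.exp_add, hC1d]; congr 2; ring
    have hy1 : 0 < 1 + y := by positivity
    have k5 : (1 + y) ^ a * Real.exp (-y) ≤ C1 * (((1 + y) ^ Q)⁻¹ * ((1 + y) ^ E)⁻¹) := by
      rw [← mul_inv, ← div_eq_mul_inv, le_div_iff₀ (by positivity)]
      calc (1 + y) ^ a * Real.exp (-y) * ((1 + y) ^ Q * (1 + y) ^ E)
          = (1 + y) ^ (a + (Q + E)) * Real.exp (-y) := by rw [pow_add, pow_add]; ring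
        _ ≤ C1 := k4
    have k6 : ((1 + y) ^ Q)⁻¹ ≤ 2 ^ Q * ((1 + R * n) ^ Q)⁻¹ := by
      rw [← div_eq_mul_inv, inv_le_iff_one_le_mul₀ (by positivity), div_mul_eq_mul_div,
        one_le_div (by positivity), ← mul_pow]
      gcongr
    have k7 : ((1 + y) ^ E)⁻¹ ≤ (c2 ^ E)⁻¹ * (R / t) ^ E := by
      have : (c2 ^ E)⁻¹ * (R / t) ^ E = ((c2 * t / R) ^ E)⁻¹ := by
        rw [div_pow, div_pow, mul_pow]; field_simp
      rw [this]
      gcongr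
    have e1 : -t * x = -y := by rw [hy]; ring
    rw [e1]
    calc jl α β n ^ p * x ^ M * Real.exp (-y)
        ≤ ((t ^ a)⁻¹ * (1 + y) ^ a) * Real.exp (-y) := by gcongr
      _ = (t ^ a)⁻¹ * ((1 + y) ^ a * Real.exp (-y)) := by ring
      _ ≤ (t ^ a)⁻¹ * (C1 * (((1 + y) ^ Q)⁻¹ * ((1 + y) ^ E)⁻¹)) :=
          mul_le_mul_of_nonneg_left k5 (by positivity)
      _ ≤ (t ^ a)⁻¹ * (C1 * ((2 ^ Q * ((1 + R * n) ^ Q)⁻¹) * ((c2 ^ E)⁻¹ * (R / t) ^ E))) := by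
          refine mul_le_mul_of_nonneg_left (mul_le_mul_of_nonneg_left ?_ hC1.le) (by positivity)
          exact mul_le_mul k6 k7 (by positivity) (by positivity)
      _ = _ := by ring
  have hfin := (H θ hθ φ hφ R hR0 hRπ hdR k hk l hl _ _ hcn).2
  rw [← hT] at hfin
  have hrev := jV_reverse (α := α) (β := β) hθ hd hdR hRπ
  have he := jeps_pos S.hα S.hβ
  have hRd : 0 < (R / d) ^ jeps α β := Real.rpow_pos_of_pos (by positivity) _
  have hdR0 : 0 < (d / R) ^ jeps α β := Real.rpow_pos_of_pos (by positivity) _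
  have hprod : (R / d) ^ jeps α β * (d / R) ^ jeps α β = 1 := by
    rw [← Real.mul_rpow (by positivity) (by positivity)]
    have : R / d * (d / R) = 1 := by field_simp
    rw [this, Real.one_rpow]
  have hrho : (d / R) ^ jeps α β * (R / t) ≤ (d / t) ^ jeps α β := by
    have h1 : R / t ≤ (R / t) ^ jeps α β := by
      have := Real.rpow_le_rpow_of_exponent_ge (x := R / t) (by positivity)
        ((div_le_one ht).2 hRt) (jeps_le_one α β)
      rwa [Real.rpow_one] at this
    calc (d / R) ^ jeps α β * (R / t) ≤ (d / R) ^ jeps α β * (R / t) ^ jeps α β := by gcongr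
      _ = (d / R * (R / t)) ^ jeps α β := by
          rw [← Real.mul_rpow (by positivity) (by positivity)]
      _ = _ := by congr 1; field_simp
  set T := |TT α β P p M k l t θ φ| with hTd
  have hT0 : 0 ≤ T := abs_nonneg _
  have hRk : 0 < R ^ (k + l) := by positivity
  calc jV α β θ d * T
      = (jV α β θ d * (R / d) ^ jeps α β) * ((d / R) ^ jeps α β * T) := by
        linear_combination (-(jV α β θ d * T)) * hprod
    _ ≤ (D * jV α β θ R) * ((d / R) ^ jeps α β * T) := by gcongr
    _ = D * ((d / R) ^ jeps α β * (R ^ (k + l))⁻¹) * (jV α β θ R * (R ^ (k + l) * T)) := by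
        field_simp
    _ ≤ D * ((d / R) ^ jeps α β * (R ^ (k + l))⁻¹) *
        (C0 * (C1 * 2 ^ Q * (c2 ^ E)⁻¹ * ((t ^ a)⁻¹ * (R / t) ^ E))) := by gcongr
    _ = D * (C0 * (C1 * 2 ^ Q * (c2 ^ E)⁻¹)) * ((t ^ (a + (k + l)))⁻¹ *
        ((d / R) ^ jeps α β * (R / t))) := by
        rw [hE, pow_succ (R / t), pow_add t a, div_pow]
        field_simp
    _ ≤ _ := by gcongr

/-- The bounding function. -/
def bnd (α β : ℝ) (o : ℕ) (d t : ℝ) : ℝ :=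
  if t ≤ d then (d ^ o)⁻¹ else (t ^ o)⁻¹ * (d / t) ^ jeps α β

lemma TT_bound (S : JSys α β P) (p M k l : ℕ) (hnd : 1 ≤ p + M + k) (hk : k ≤ 2) (hl : l ≤ 2) :
    ∃ C : ℝ, 0 < C ∧ ∀ θ ∈ Ioo 0 π, ∀ φ ∈ Ioo 0 π, θ ≠ φ → ∀ t > 0,
      jV α β θ |θ - φ| * |TT α β P p M k l t θ φ| ≤
        C * bnd α β (2 * p + M + (k + l)) |θ - φ| t := by
  obtain ⟨C2, hC2, h2⟩ := S.TT_large p M k l hnd hk hl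
  rcases Nat.eq_zero_or_pos M with hM | hM
  · subst hM
    obtain ⟨C1, hC1, h1⟩ := S.TT_small p 1 k l le_rfl hk hl
    refine ⟨C1 + C2, by positivity, ?_⟩
    intro θ hθ φ hφ hne t ht
    have hd : 0 < |θ - φ| := abs_pos.2 (sub_ne_zero.2 hne)
    have H2 := h2 θ hθ φ hφ hne
    have H1 := h1 θ hθ φ hφ hne
    set d := |θ - φ| with hdd
    have hV := jV_pos α β hθ hd
    unfold bnd
    split_ifs with htd
    · have hder := Convex.norm_image_sub_le_of_norm_hasDerivWithin_le
        (f := fun t => TT α β P p 0 k l t θ φ) (f' := fun t => -TT α β P p 1 k l t θ φ)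
        (s := Ioi (0 : ℝ)) (x := d) (y := t)
        (C := C1 * (d ^ (2 * p + 1 + (k + l)))⁻¹ / jV α β θ d)
        (fun s hs => (S.TT_time p k l hk hl hs hθ hφ).hasDerivWithinAt)
        (fun s hs => by
          rw [norm_neg, Real.norm_eq_abs, le_div_iff₀ hV, mul_comm]
          exact H1 s hs) (convex_Ioi 0) hd ht
      rw [Real.norm_eq_abs, Real.norm_eq_abs] at hder
      have h3 : |t - d| ≤ d := by rw [abs_le]; constructor <;> linarith
      have h4 := H2 d le_rfl
      rw [div_self hd.ne', Real.one_rpow, mul_one] at h4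
      have h5 : |TT α β P p 0 k l t θ φ| ≤ |TT α β P p 0 k l d θ φ| +
          C1 * (d ^ (2 * p + 1 + (k + l)))⁻¹ / jV α β θ d * d := by
        have := abs_sub_abs_le_abs_sub (TT α β P p 0 k l t θ φ) (TT α β P p 0 k l d θ φ)
        have h6 : C1 * (d ^ (2 * p + 1 + (k + l)))⁻¹ / jV α β θ d * |t - d| ≤
          C1 * (d ^ (2 * p + 1 + (k + l)))⁻¹ / jV α β θ d * d :=
          mul_le_mul_of_nonneg_left h3 (by positivity)
        linarith
      calc jV α β θ d * |TT α β P p 0 k l t θ φ|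
          ≤ jV α β θ d * (|TT α β P p 0 k l d θ φ| +
          C1 * (d ^ (2 * p + 1 + (k + l)))⁻¹ / jV α β θ d * d) := by gcongr
        _ = jV α β θ d * |TT α β P p 0 k l d θ φ| + C1 * (d ^ (2 * p + 0 + (k + l)))⁻¹ := by
            have e : d ^ (2 * p + 1 + (k + l)) = d ^ (2 * p + 0 + (k + l)) * d := by
              rw [← pow_succ]; congr 1; omega
            rw [e]
            field_simp
        _ ≤ C2 * (d ^ (2 * p + 0 + (k + l)))⁻¹ + C1 * (d ^ (2 * p + 0 + (k + l)))⁻¹ := by gcongr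
        _ = _ := by ring
    · refine (H2 t (by linarith)).trans ?_
      have : 0 ≤ (d / t) ^ jeps α β := Real.rpow_nonneg (by positivity) _
      gcongr
      linarith
  · obtain ⟨C1, hC1, h1⟩ := S.TT_small p M k l hM hk hl
    refine ⟨C1 + C2, by positivity, ?_⟩
    intro θ hθ φ hφ hne t ht
    have hd : 0 < |θ - φ| := abs_pos.2 (sub_ne_zero.2 hne)
    unfold bnd
    split_ifs with htd
    · refine (h1 θ hθ φ hφ hne t ht).trans ?_
      gcongr
      linarith
    · refine (h2 θ hθ φ hφ hne t (by linarith)).trans ?_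
      have : 0 ≤ (|θ - φ| / t) ^ jeps α β := Real.rpow_nonneg (by positivity) _
      gcongr
      linarith

end JSys

/-! ### Part H: integration in `t` and conclusion -/

lemma lintegral_tail {e d : ℝ} (he : 0 < e) (hd : 0 < d) :
    ∫⁻ t in Ioi d, ENNReal.ofReal (d ^ (2 * e) * t ^ (-1 - 2 * e)) = ENNReal.ofReal (1 / (2 * e)) := by
  have hlt : -1 - 2 * e < -1 := by linarith
  have hi := (integrableOn_Ioi_rpow_of_lt hlt hd).const_mul (d ^ (2 * e))
  rw [← ofReal_integral_eq_lintegral_ofReal hi]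
  · congr 1
    rw [integral_const_mul, integral_Ioi_rpow_of_lt hlt hd]
    have e1 : -1 - 2 * e + 1 = -(2 * e) := by ring
    rw [e1, Real.rpow_neg hd.le]
    have : d ^ (2 * e) ≠ 0 := (Real.rpow_pos_of_pos hd _).ne'
    field_simp
  · filter_upwards [ae_restrict_mem measurableSet_Ioi] with t ht
    have : 0 < t := lt_trans hd ht
    positivity

lemma square_int {α β : ℝ} (hα : -1 < α) (hβ : -1 < β) (M N j : ℕ) (hm : 0 < M + N)
    {d V C : ℝ} (hd : 0 < d) (hV : 0 < V) (hC : 0 ≤ C) {G : ℝ → ℝ}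
    (hG : ∀ t > 0, V * |G t| ≤ C * JSys.bnd α β (M + N + j) d t) :
    (∫⁻ t in Ioi (0 : ℝ), ENNReal.ofReal (G t ^ 2 * t ^ (2 * M + 2 * N - 1))) ^ (1 / 2 : ℝ) ≤
      ENNReal.ofReal (C * Real.sqrt (1 + 1 / (2 * jeps α β)) / (d ^ j * V)) := by
  have he := jeps_pos hα hβ
  set e := jeps α β with hee
  set m := M + N with hmm
  have hmx : 2 * M + 2 * N - 1 + 1 = 2 * m := by omega
  set r := 2 * M + 2 * N - 1 with hr
  set K : ℝ := (C / (d ^ j * V)) ^ 2 with hK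
  have hK0 : 0 ≤ K := sq_nonneg _
  have hGs : ∀ t > 0, G t ^ 2 ≤ (C / V) ^ 2 * JSys.bnd α β (m + j) d t ^ 2 := by
    intro t ht
    have h1 := hG t ht
    have h2 : |G t| ≤ C / V * JSys.bnd α β (m + j) d t := by
      rw [div_mul_eq_mul_div, le_div_iff₀ hV]
      linarith
    calc G t ^ 2 = |G t| ^ 2 := (sq_abs _).symm
      _ ≤ (C / V * JSys.bnd α β (m + j) d t) ^ 2 := by gcongr
      _ = _ := by ring
  have hA : ∀ t ∈ Ioc 0 d, G t ^ 2 * t ^ r ≤ K * d⁻¹ := by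
    intro t ht
    have h1 := hGs t ht.1
    unfold JSys.bnd at h1
    rw [if_pos ht.2] at h1
    have h2 : t ^ r ≤ d ^ r := pow_le_pow_left₀ ht.1.le ht.2 r
    calc G t ^ 2 * t ^ r ≤ ((C / V) ^ 2 * ((d ^ (m + j))⁻¹) ^ 2) * d ^ r :=
          mul_le_mul h1 h2 (pow_nonneg ht.1.le _) (by positivity)
      _ = K * (d ^ (2 * m))⁻¹ * d ^ r := by
          rw [hK, pow_add]; field_simp; ring
      _ = K * d⁻¹ := by
          rw [← hmx, pow_succ]; field_simp
  have hB : ∀ t ∈ Ioi d, G t ^ 2 * t ^ r ≤ K * (d ^ (2 * e) * t ^ (-1 - 2 * e)) := by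
    intro t ht
    have htd : d < t := ht
    have ht0 : 0 < t := lt_trans hd ht
    have h1 := hGs t ht0
    unfold JSys.bnd at h1
    rw [if_neg (not_le.2 htd), ← hee] at h1
    have h3 : ((d / t) ^ e) ^ 2 = d ^ (2 * e) * t ^ (-(2 * e)) := by
      rw [← Real.rpow_natCast, ← Real.rpow_mul (by positivity), Real.div_rpow hd.le ht0.le,
        Real.rpow_neg ht0.le, div_eq_mul_inv]
      congr 2
      · push_cast; ring
      · push_cast; ring_nf
    have h4 : (-1 - 2 * e) = -1 + -(2 * e) := by ring
    rw [h4, Real.rpow_add ht0, Real.rpow_neg_one]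
    have h5 : (t ^ j)⁻¹ ≤ (d ^ j)⁻¹ := by gcongr
    have hp : 0 < d ^ (2 * e) * t ^ (-(2 * e)) := by positivity
    calc G t ^ 2 * t ^ r
        ≤ ((C / V) ^ 2 * ((t ^ (m + j))⁻¹ * (d / t) ^ e) ^ 2) * t ^ r := by gcongr
      _ = (C / V) ^ 2 * ((t ^ j)⁻¹) ^ 2 * ((t ^ (2 * m))⁻¹ * t ^ r) *
          (d ^ (2 * e) * t ^ (-(2 * e))) := by
          rw [mul_pow, h3, pow_add t m j]; field_simp; ring
      _ = (C / V) ^ 2 * ((t ^ j)⁻¹) ^ 2 * t⁻¹ * (d ^ (2 * e) * t ^ (-(2 * e))) := by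
          congr 2
          rw [← hmx, pow_succ]; field_simp
      _ ≤ (C / V) ^ 2 * ((d ^ j)⁻¹) ^ 2 * t⁻¹ * (d ^ (2 * e) * t ^ (-(2 * e))) := by gcongr
      _ = _ := by rw [hK]; field_simp
  have hI : ∫⁻ t in Ioi (0 : ℝ), ENNReal.ofReal (G t ^ 2 * t ^ r) ≤
      ENNReal.ofReal (K * (1 + 1 / (2 * e))) := by
    rw [← Ioc_union_Ioi_eq_Ioi hd.le]
    refine (lintegral_union_le _ _ _).trans ?_
    have i1 : ∫⁻ t in Ioc 0 d, ENNReal.ofReal (G t ^ 2 * t ^ r) ≤ ENNReal.ofReal K := by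
      calc ∫⁻ t in Ioc 0 d, ENNReal.ofReal (G t ^ 2 * t ^ r)
          ≤ ∫⁻ t in Ioc 0 d, ENNReal.ofReal (K * d⁻¹) :=
            setLIntegral_mono' measurableSet_Ioc fun t ht => ENNReal.ofReal_le_ofReal (hA t ht)
        _ = ENNReal.ofReal K := by
            rw [setLIntegral_const, Real.volume_Ioc, sub_zero, ← ENNReal.ofReal_mul (by positivity)]
            congr 1
            field_simp
    have i2 : ∫⁻ t in Ioi d, ENNReal.ofReal (G t ^ 2 * t ^ r) ≤
        ENNReal.ofReal K * ENNReal.ofReal (1 / (2 * e)) := by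
      calc ∫⁻ t in Ioi d, ENNReal.ofReal (G t ^ 2 * t ^ r)
          ≤ ∫⁻ t in Ioi d, ENNReal.ofReal K * ENNReal.ofReal (d ^ (2 * e) * t ^ (-1 - 2 * e)) :=
            setLIntegral_mono' measurableSet_Ioi fun t ht => by
              rw [← ENNReal.ofReal_mul hK0]
              exact ENNReal.ofReal_le_ofReal (hB t ht)
        _ = _ := by
            rw [lintegral_const_mul' _ _ ENNReal.ofReal_ne_top, lintegral_tail he hd]
    refine (add_le_add i1 i2).trans ?_
    rw [← ENNReal.ofReal_mul hK0, ← ENNReal.ofReal_add hK0 (by positivity)]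
    apply ENNReal.ofReal_le_ofReal
    linarith
  refine (ENNReal.rpow_le_rpow hI (by norm_num)).trans ?_
  rw [ENNReal.ofReal_rpow_of_nonneg (by positivity) (by norm_num), ← Real.sqrt_eq_rpow, hK,
    Real.sqrt_mul (sq_nonneg _), Real.sqrt_sq (by positivity)]
  apply ENNReal.ofReal_le_ofReal
  apply le_of_eq
  ring

lemma half_neg_pow_abs (M : ℕ) (x : ℝ) : |(1 / 2) * (-1) ^ M * x| ≤ |x| := by
  rw [abs_mul, abs_mul, abs_pow, abs_neg, abs_one, one_pow, abs_of_pos (by norm_num : (0 : ℝ) < 1 / 2)]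
  linarith [abs_nonneg x]

lemma main_bound0 {α β : ℝ} (hα : -1 < α) (hβ : -1 < β) (M N : ℕ) (hMN : 0 < M + N) :
    ∃ C : ℝ, 0 < C ∧ ∀ θ ∈ Ioo 0 π, ∀ φ ∈ Ioo 0 π, θ ≠ φ → ∀ t > 0,
      jV α β θ |θ - φ| *
        |deriv^[M] (fun s => deltaEven α β N (fun θ' => jHker α β s θ' φ) θ) t| ≤
        C * JSys.bnd α β (M + N + 0) |θ - φ| t := by
  have S := JSys_PJ hα hβ
  obtain ⟨C, hC, H⟩ := S.TT_bound (N / 2) M (N % 2) 0 (by omega) (by omega) (by omega)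
  refine ⟨C, hC, fun θ hθ φ hφ hne t ht => ?_⟩
  have hd : 0 < |θ - φ| := abs_pos.2 (sub_ne_zero.2 hne)
  have h := H θ hθ φ hφ hne t ht
  have e : 2 * (N / 2) + M + (N % 2 + 0) = M + N + 0 := by omega
  rw [e] at h
  rw [kernel_series hα hβ M N hMN ht hθ hφ]
  exact (mul_le_mul_of_nonneg_left (half_neg_pow_abs M _) (jV_pos α β hθ hd).le).trans h

lemma main_boundφ {α β : ℝ} (hα : -1 < α) (hβ : -1 < β) (M N : ℕ) (hMN : 0 < M + N) :
    ∃ C : ℝ, 0 < C ∧ ∀ θ ∈ Ioo 0 π, ∀ φ ∈ Ioo 0 π, θ ≠ φ → ∀ t > 0,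
      jV α β θ |θ - φ| * |deriv (fun φ' =>
        deriv^[M] (fun s => deltaEven α β N (fun θ' => jHker α β s θ' φ') θ) t) φ| ≤
        C * JSys.bnd α β (M + N + 1) |θ - φ| t := by
  have S := JSys_PJ hα hβ
  obtain ⟨C, hC, H⟩ := S.TT_bound (N / 2) M (N % 2) 1 (by omega) (by omega) (by omega)
  refine ⟨C, hC, fun θ hθ φ hφ hne t ht => ?_⟩
  have hd : 0 < |θ - φ| := abs_pos.2 (sub_ne_zero.2 hne)
  have h := H θ hθ φ hφ hne t ht
  have e : 2 * (N / 2) + M + (N % 2 + 1) = M + N + 1 := by omega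
  rw [e] at h
  have hev : (fun φ' => deriv^[M] (fun s => deltaEven α β N (fun θ' => jHker α β s θ' φ') θ) t)
      =ᶠ[nhds φ] fun φ' => (1 / 2) * (-1) ^ M * TT α β (PJ α β) (N / 2) M (N % 2) 0 t θ φ' := by
    filter_upwards [isOpen_Ioo.mem_nhds hφ] with y hy
    exact kernel_series hα hβ M N hMN ht hθ hy
  rw [hev.deriv_eq, ((S.TT_phi0 (N / 2) M (N % 2) (by omega) ht hθ hφ).const_mul _).deriv]
  exact (mul_le_mul_of_nonneg_left (half_neg_pow_abs M _) (jV_pos α β hθ hd).le).trans h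

lemma main_boundθ {α β : ℝ} (hα : -1 < α) (hβ : -1 < β) (M N : ℕ) (hMN : 0 < M + N) :
    ∃ C : ℝ, 0 < C ∧ ∀ θ ∈ Ioo 0 π, ∀ φ ∈ Ioo 0 π, θ ≠ φ → ∀ t > 0,
      jV α β θ |θ - φ| * |deriv (fun θ'' =>
        deriv^[M] (fun s => deltaEven α β N (fun θ' => jHker α β s θ' φ) θ'') t) θ| ≤
        C * JSys.bnd α β (M + N + 1) |θ - φ| t := by
  have S := JSys_PJ hα hβ
  have hev : ∀ θ ∈ Ioo 0 π, ∀ φ ∈ Ioo 0 π, ∀ t > 0, (fun θ'' =>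
        deriv^[M] (fun s => deltaEven α β N (fun θ' => jHker α β s θ' φ) θ'') t)
      =ᶠ[nhds θ] fun θ'' => (1 / 2) * (-1) ^ M * TT α β (PJ α β) (N / 2) M (N % 2) 0 t θ'' φ := by
    intro θ hθ φ hφ t ht
    filter_upwards [isOpen_Ioo.mem_nhds hθ] with y hy
    exact kernel_series hα hβ M N hMN ht hy hφ
  rcases Nat.mod_two_eq_zero_or_one N with h2 | h2
  · obtain ⟨C, hC, H⟩ := S.TT_bound (N / 2) M 1 0 (by omega) (by omega) (by omega)
    refine ⟨C, hC, fun θ hθ φ hφ hne t ht => ?_⟩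
    have hd : 0 < |θ - φ| := abs_pos.2 (sub_ne_zero.2 hne)
    have h := H θ hθ φ hφ hne t ht
    have e : 2 * (N / 2) + M + (1 + 0) = M + N + 1 := by omega
    rw [e] at h
    rw [(hev θ hθ φ hφ t ht).deriv_eq, h2,
      ((S.TT_theta0 (N / 2) M 0 (by omega) ht hθ hφ).const_mul _).deriv]
    exact (mul_le_mul_of_nonneg_left (half_neg_pow_abs M _) (jV_pos α β hθ hd).le).trans h
  · obtain ⟨C, hC, H⟩ := S.TT_bound (N / 2 + 1) M 0 0 (by omega) (by omega) (by omega)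
    obtain ⟨C', hC', H'⟩ := S.TT_bound (N / 2) M 2 0 (by omega) (by omega) (by omega)
    have hA := jA_nonneg α β
    refine ⟨C + jA α β * C', by positivity, fun θ hθ φ hφ hne t ht => ?_⟩
    have hd : 0 < |θ - φ| := abs_pos.2 (sub_ne_zero.2 hne)
    have h := H θ hθ φ hφ hne t ht
    have h' := H' θ hθ φ hφ hne t ht
    have e : 2 * (N / 2 + 1) + M + (0 + 0) = M + N + 1 := by omega
    have e' : 2 * (N / 2) + M + (2 + 0) = M + N + 1 := by omega
    rw [e] at h
    rw [e'] at h'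
    rw [(hev θ hθ φ hφ t ht).deriv_eq, h2,
      ((S.TT_theta1 (N / 2) M 0 (by omega) ht hθ hφ).const_mul _).deriv]
    have hV := (jV_pos α β hθ hd).le
    refine (mul_le_mul_of_nonneg_left (half_neg_pow_abs M _) hV).trans ?_
    have h5 := abs_add_le (-TT α β (PJ α β) (N / 2 + 1) M 0 0 t θ φ)
      (kap α β θ * TT α β (PJ α β) (N / 2) M 2 0 t θ φ)
    rw [abs_neg, abs_mul] at h5
    refine (mul_le_mul_of_nonneg_left h5 hV).trans ?_
    have h6 : |kap α β θ| * (jV α β θ |θ - φ| * |TT α β (PJ α β) (N / 2) M 2 0 t θ φ|) ≤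
        jA α β * (C' * JSys.bnd α β (M + N + 1) |θ - φ| t) :=
      mul_le_mul (kap_le α β θ) h' (by positivity) hA
    linarith

/-- Theorem (standard estimates for the vector-valued square function kernel
`{∂_t^M δ_N^even H_t^{α,β}(θ,φ)}_{t>0}` in `L²(ℝ₊, t^{2M+2N−1}dt)`). -/
theorem squareKernelEven_standard_estimates (α β : ℝ) (hα : -1 < α) (hβ : -1 < β)
    (M N : ℕ) (hMN : 0 < M + N) :
    ∃ C : ℝ, 0 < C ∧ ∀ θ ∈ Ioo (0 : ℝ) π, ∀ φ ∈ Ioo (0 : ℝ) π, θ ≠ φ →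
      (∫⁻ t in Ioi (0 : ℝ), ENNReal.ofReal
          ((deriv^[M] (fun s => deltaEven α β N (fun θ' => jHker α β s θ' φ) θ) t) ^ 2 *
            t ^ (2 * M + 2 * N - 1))) ^ (1 / 2 : ℝ) ≤
        ENNReal.ofReal (C / (ballMeasure α β θ |θ - φ|).toReal) ∧
      (∫⁻ t in Ioi (0 : ℝ), ENNReal.ofReal
            ((deriv (fun θ'' =>
                deriv^[M] (fun s => deltaEven α β N (fun θ' => jHker α β s θ' φ) θ'') t) θ) ^ 2 *
              t ^ (2 * M + 2 * N - 1))) ^ (1 / 2 : ℝ) +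
        (∫⁻ t in Ioi (0 : ℝ), ENNReal.ofReal
            ((deriv (fun φ' =>
                deriv^[M] (fun s => deltaEven α β N (fun θ' => jHker α β s θ' φ') θ) t) φ) ^ 2 *
              t ^ (2 * M + 2 * N - 1))) ^ (1 / 2 : ℝ) ≤
        ENNReal.ofReal (C / (|θ - φ| * (ballMeasure α β θ |θ - φ|).toReal)) := by
  obtain ⟨C0, hC0, H0⟩ := main_bound0 hα hβ M N hMN
  obtain ⟨C1, hC1, H1⟩ := main_boundθ hα hβ M N hMN
  obtain ⟨C2, hC2, H2⟩ := main_boundφ hα hβ M N hMN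
  obtain ⟨Cb, hCb, Hb⟩ := ballMeasure_le hα hβ
  have he := jeps_pos hα hβ
  have hq : 0 < Real.sqrt (1 + 1 / (2 * jeps α β)) := Real.sqrt_pos.2 (by positivity)
  set q := Real.sqrt (1 + 1 / (2 * jeps α β)) with hqd
  refine ⟨(C0 + C1 + C2) * q * Cb, by positivity, fun θ hθ φ hφ hne => ?_⟩
  have hd : 0 < |θ - φ| := abs_pos.2 (sub_ne_zero.2 hne)
  have hdπ : |θ - φ| ≤ π := by
    rw [abs_le]; constructor <;> linarith [hθ.1, hθ.2, hφ.1, hφ.2]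
  have hV := jV_pos α β hθ hd
  have hble := Hb θ hθ _ hd hdπ
  have hbpos := ballMeasure_pos α β hθ hd
  have hμ : 0 < (ballMeasure α β θ |θ - φ|).toReal :=
    ENNReal.toReal_pos hbpos.ne' (ne_top_of_le_ne_top ENNReal.ofReal_ne_top hble)
  have hμV : (ballMeasure α β θ |θ - φ|).toReal ≤ Cb * jV α β θ |θ - φ| :=
    ENNReal.toReal_le_of_le_ofReal (by positivity) hble
  have k0 := square_int hα hβ M N 0 hMN hd hV hC0.le (H0 θ hθ φ hφ hne)
  have k1 := square_int hα hβ M N 1 hMN hd hV hC1.le (H1 θ hθ φ hφ hne)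
  have k2 := square_int hα hβ M N 1 hMN hd hV hC2.le (H2 θ hθ φ hφ hne)
  rw [← hqd] at k0 k1 k2
  set μ := (ballMeasure α β θ |θ - φ|).toReal with hμd
  set V := jV α β θ |θ - φ| with hVd
  set d := |θ - φ| with hdd
  rw [pow_one] at k1 k2
  rw [pow_zero, one_mul] at k0
  constructor
  · refine k0.trans (ENNReal.ofReal_le_ofReal ?_)
    rw [div_le_div_iff₀ hV hμ]
    calc C0 * q * μ ≤ C0 * q * (Cb * V) := by gcongr
      _ ≤ (C0 + C1 + C2) * q * (Cb * V) := by gcongr; linarith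
      _ = _ := by ring
  · refine (add_le_add k1 k2).trans ?_
    rw [← ENNReal.ofReal_add (by positivity) (by positivity)]
    refine ENNReal.ofReal_le_ofReal ?_
    rw [← add_div, div_le_div_iff₀ (by positivity) (by positivity)]
    calc (C1 * q + C2 * q) * (d * μ) ≤ (C1 * q + C2 * q) * (d * (Cb * V)) := by gcongr
      _ = (C1 + C2) * q * (d * (Cb * V)) := by ring
      _ ≤ (C0 + C1 + C2) * q * (d * (Cb * V)) := by gcongr; linarith
      _ = _ := by ring
end
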